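/- arXiv:2406.12506 — 4 statements merged into one kernel-verified Lean document; each statement's English description precedes it below -/
import Mathlib

section
/- There exists a constant C > 0 such that for every ε > 0, every n ≥ 2 and every prime power q with (n,q) ∉ {(2,2),(2,3)}, the following holds for G = PSL_n(𝔽_q): if A and B are normal subsets of G with |A| ≥ ε|G| and |B| ≥ ε|G|, then for every g ∈ G with g ≠ 1, |P_{A,B}(g) − 1/|G|| ≤ (C/(ε·√q))·(1/|G|). -/
/-- `P_{A,B}(g)`: the probability that `ab = g` for `a ∈ A`, `b ∈ B` chosen
uniformly and independently at random. -/
noncomputable def Pab {G : Type*} [Group G] (A B : Set G) (g : G) : ℝ :=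
  (({p : G × G | p.1 ∈ A ∧ p.2 ∈ B ∧ p.1 * p.2 = g}).ncard : ℝ) /
    ((A.ncard : ℝ) * (B.ncard : ℝ))

open Module

section UnitaryRepresentation

variable {G V : Type*} [Group G] [NormedAddCommGroup V] [InnerProductSpace ℂ V]
  [FiniteDimensional ℂ V]

/-- The trace of a contraction is bounded by the dimension. -/
theorem norm_trace_le_finrank (T : V →ₗ[ℂ] V) (hT : ∀ v, ‖T v‖ ≤ ‖v‖) :
    ‖LinearMap.trace ℂ V T‖ ≤ finrank ℂ V := by
  rw [LinearMap.trace_eq_sum_inner T (stdOrthonormalBasis ℂ V)]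
  refine (norm_sum_le_of_le _ (n := fun _ => (1 : ℝ)) fun i _ => ?_).trans (by simp)
  refine (norm_inner_le_norm _ _).trans ?_
  have := hT (stdOrthonormalBasis ℂ V i)
  simp only [OrthonormalBasis.norm_eq_one] at this ⊢
  linarith

/-- If `y` is conjugate to all `y * f h`, then the character at `y` is at most the dimension of the
space of invariants of `f`. -/
theorem norm_character_le_finrank_invariants (ρ : Representation ℂ G V)
    (hρ : ∀ g v, ‖ρ g v‖ = ‖v‖) {H : Type*} [Group H] [Fintype H] (f : H →* G) (y : G)
    (hy : ∀ h, ρ.character (y * f h) = ρ.character y) :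
    ‖ρ.character y‖ ≤ finrank ℂ (Representation.invariants (ρ.comp f)) := by
  classical
  set σ : Representation ℂ H V := ρ.comp f
  have hH : (Fintype.card H : ℂ) ≠ 0 := by simp
  let : Invertible (Fintype.card H : ℂ) := invertibleOfNonzero hH
  have hP : ∀ v, σ.averageMap v = (Fintype.card H : ℂ)⁻¹ • ∑ h, σ h v := by
    intro v
    simp [GroupAlgebra.average, map_sum]
  let π : V →ₗ[ℂ] σ.invariants := σ.averageMap.codRestrict _ σ.averageMap_invariant
  have hπ : ∀ v, ‖π v‖ ≤ ‖v‖ := by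
    intro v
    change ‖σ.averageMap v‖ ≤ ‖v‖
    rw [hP, norm_smul, norm_inv, Complex.norm_natCast]
    have : ‖∑ h, σ h v‖ ≤ Fintype.card H * ‖v‖ := by
      refine (norm_sum_le_of_le _ (n := fun _ => ‖v‖) fun i _ => ?_).trans (by simp)
      exact (hρ _ _).le
    rw [inv_mul_le_iff₀ (by exact_mod_cast Fintype.card_pos)]
    exact this
  have h1 : ρ.character y = LinearMap.trace ℂ V (ρ y ∘ₗ σ.averageMap) := by
    have : ρ y ∘ₗ σ.averageMap = (Fintype.card H : ℂ)⁻¹ • ∑ h, ρ (y * f h) := by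
      ext v
      rw [LinearMap.comp_apply, hP]
      simp only [map_smul, map_sum, LinearMap.smul_apply, LinearMap.sum_apply, map_mul,
        Module.End.mul_apply]
      rfl
    rw [this, map_smul, map_sum]
    change ρ.character y = (Fintype.card H : ℂ)⁻¹ • ∑ h, ρ.character (y * f h)
    simp only [hy]
    simp [hH]
  have h2 : LinearMap.trace ℂ V (ρ y ∘ₗ σ.averageMap)
      = LinearMap.trace ℂ σ.invariants (π ∘ₗ (ρ y ∘ₗ σ.invariants.subtype)) := by
    exact LinearMap.trace_comp_comm' π (ρ y ∘ₗ σ.invariants.subtype)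
  rw [h1, h2]
  apply norm_trace_le_finrank
  intro v
  refine (hπ _).trans ?_
  simp [hρ]

theorem norm_sum_character_sq_le (ρ : Representation ℂ G V)
    (hρ : ∀ g v, ‖ρ g v‖ = ‖v‖) {S : Type*} [Fintype S] (a : S → G) :
    ‖∑ s, ρ.character (a s)‖ ^ 2 ≤
      finrank ℂ V * ‖∑ s, ∑ r, ρ.character ((a s)⁻¹ * a r)‖ := by
  let b := stdOrthonormalBasis ℂ V
  let Q : V →ₗ[ℂ] V := ∑ s, ρ (a s)
  have hinner : ∀ g v w, inner ℂ (ρ g v) (ρ g w) = inner ℂ v w := by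
    intro g
    exact (LinearMap.norm_map_iff_inner_map_map (ρ g)).1 (hρ g)
  have h1 : ∑ s, ρ.character (a s) = ∑ i, inner ℂ (b i) (Q (b i)) := by
    rw [← LinearMap.trace_eq_sum_inner]
    simp [Q, Representation.character]
  have h2 : ∑ s, ∑ r, ρ.character ((a s)⁻¹ * a r) = ∑ i, inner ℂ (Q (b i)) (Q (b i)) := by
    simp only [Q, LinearMap.sum_apply, sum_inner, inner_sum]
    simp_rw [Finset.sum_comm (s := (Finset.univ : Finset (Fin (finrank ℂ V))))]
    rw [Finset.sum_comm]
    refine Finset.sum_congr rfl fun s _ => Finset.sum_congr rfl fun r _ => ?_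
    rw [Representation.character, LinearMap.trace_eq_sum_inner _ b]
    refine Finset.sum_congr rfl fun i _ => ?_
    rw [← hinner (a r)]
    simp [← Module.End.mul_apply, ← map_mul]
  have h3 : ‖∑ i, inner ℂ (Q (b i)) (Q (b i))‖ = ∑ i, ‖Q (b i)‖ ^ 2 := by
    simp_rw [inner_self_eq_norm_sq_to_K]
    have : ((∑ i, ‖Q (b i)‖ ^ 2 : ℝ) : ℂ) = ∑ i, ((‖Q (b i)‖ : ℝ) : ℂ) ^ 2 := by push_cast; rfl
    refine (congrArg norm this.symm).trans ?_
    rw [Complex.norm_real, Real.norm_of_nonneg (by positivity)]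
  rw [h1, h2, h3]
  have h4 : ‖∑ i, inner ℂ (b i) (Q (b i))‖ ≤ ∑ i, ‖Q (b i)‖ := by
    refine norm_sum_le_of_le _ fun i _ => ?_
    refine (norm_inner_le_norm _ _).trans ?_
    simp
  calc _ ≤ (∑ i, ‖Q (b i)‖) ^ 2 := by gcongr
    _ ≤ _ := by
      have := sq_sum_le_card_mul_sum_sq (s := Finset.univ) (f := fun i => ‖Q (b i)‖)
      simpa using this

theorem norm_character_sq_le_of_commutator (ρ : Representation ℂ G V)
    (hρ : ∀ g v, ‖ρ g v‖ = ‖v‖) {S : Type*} [Fintype S] (h : S → G) (g : G) {m : ℝ} (hm0 : 0 ≤ m)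
    (hm : ∀ s r, s ≠ r → ‖ρ.character (h s * g⁻¹ * (h s)⁻¹ * (h r * g * (h r)⁻¹))‖ ≤ m) :
    Fintype.card S * ‖ρ.character g‖ ^ 2 ≤ finrank ℂ V * (finrank ℂ V + Fintype.card S * m) := by
  classical
  rcases isEmpty_or_nonempty S with hS | hS
  · simp; positivity
  obtain ⟨s₀⟩ := hS
  have hq : (0 : ℝ) < Fintype.card S := by exact_mod_cast Fintype.card_pos_iff.2 ⟨s₀⟩
  have key := norm_sum_character_sq_le ρ hρ fun s => h s * g * (h s)⁻¹
  have e1 : ∑ s : S, ρ.character (h s * g * (h s)⁻¹) = Fintype.card S * ρ.character g := by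
    simp [Representation.char_conj]
  rw [e1, norm_mul, Complex.norm_natCast] at key
  have e2 : ‖∑ s, ∑ r, ρ.character ((h s * g * (h s)⁻¹)⁻¹ * (h r * g * (h r)⁻¹))‖ ≤
      ∑ s : S, ∑ r : S, ((if s = r then (finrank ℂ V : ℝ) else 0) + m) := by
    refine norm_sum_le_of_le _ fun s _ => norm_sum_le_of_le _ fun r _ => ?_
    split_ifs with hsr
    · subst hsr
      rw [inv_mul_cancel, Representation.char_one, Complex.norm_natCast]
      linarith
    · have := hm s r hsr
      rw [zero_add]
      simpa [mul_assoc] using this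
  have e3 : ∑ s : S, ∑ r : S, ((if s = r then (finrank ℂ V : ℝ) else 0) + m)
      = Fintype.card S * (finrank ℂ V + Fintype.card S * m) := by
    simp [Finset.sum_add_distrib]
    ring
  rw [e3] at e2
  have : Fintype.card S * (Fintype.card S * ‖ρ.character g‖ ^ 2) ≤
    Fintype.card S * (finrank ℂ V * (finrank ℂ V + Fintype.card S * m)) := by
    calc _ = (Fintype.card S * ‖ρ.character g‖) ^ 2 := by ring
      _ ≤ _ := key
      _ ≤ finrank ℂ V * (Fintype.card S * (finrank ℂ V + Fintype.card S * m)) := by gcongr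
      _ = _ := by ring
  exact le_of_mul_le_mul_left this hq

end UnitaryRepresentation

section SpecialLinear

open Matrix Matrix.SpecialLinearGroup

variable {ι F : Type*} [Fintype ι] [DecidableEq ι] [Field F]

/-- The identity matrix with the off-diagonal part of row `i` replaced by `w`. -/
def rowElem (i : ι) (w : ι → F) : SpecialLinearGroup ι F :=
  ⟨1 + vecMulVec (Pi.single i 1) (Function.update w i 0), by
    rw [vecMulVec_eq Unit, det_one_add_replicateCol_mul_replicateRow]
    simp⟩

theorem rowElem_coe (i : ι) (w : ι → F) : (rowElem i w : Matrix ι ι F) =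
    1 + vecMulVec (Pi.single i 1) (Function.update w i 0) := rfl

theorem rowElem_mul (i : ι) (w w' : ι → F) : rowElem i w * rowElem i w' = rowElem i (w + w') := by
  apply Subtype.ext
  change (rowElem i w).1 * (rowElem i w').1 = (rowElem i (w + w')).1
  simp only [rowElem_coe, mul_add, add_mul, vecMulVec_mul_vecMulVec]
  have : Function.update (w + w') i 0 = Function.update w i 0 + Function.update w' i 0 := by
    ext k; by_cases h : k = i <;> simp [Function.update, h]
  rw [this, vecMulVec_add]
  simp [add_assoc]

theorem rowElem_zero (i : ι) : rowElem i (0 : ι → F) = 1 := by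
  apply Subtype.ext
  ext k l
  simp [rowElem_coe, vecMulVec_apply, Function.update_apply]

theorem rowElem_single {i j : ι} (hij : i ≠ j) (s : F) :
    rowElem i (Pi.single j s) = transvection hij s := by
  apply Subtype.ext
  ext k l
  simp [rowElem_coe, transvection_coe, vecMulVec_apply, Function.update_apply, Pi.single_apply,
    Matrix.single_apply]
  grind

theorem transvection_mul_rowElem {i j : ι} (hij : i ≠ j) (w : ι → F) (hw : w j ≠ 0) :
    transvection hij (w j) * rowElem j (Function.update ((w j)⁻¹ • w) i 0) =
      rowElem j (Function.update ((w j)⁻¹ • w) i 0) * rowElem i w := by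
  rw [← rowElem_single]
  apply Subtype.ext
  change (rowElem i _).1 * (rowElem j _).1 = (rowElem j _).1 * (rowElem i _).1
  simp only [rowElem_coe, mul_add, add_mul, vecMulVec_mul_vecMulVec]
  ext k l
  simp [vecMulVec_apply, Function.update_apply, Pi.single_apply, Matrix.one_apply, hij, hij.symm]
  grind

/-- The one-parameter group of transvections. -/
def transvectionHom {i j : ι} (hij : i ≠ j) : Multiplicative F →* SpecialLinearGroup ι F where
  toFun s := transvection hij s.toAdd
  map_one' := transvection_coeff_zero hij
  map_mul' s t := transvection_add hij s.toAdd t.toAdd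

/-- The group of all matrices differing from the identity only in the off-diagonal part of
row `i`, with the entry at `j` singled out. -/
def rowHom (i j : ι) : Multiplicative (F × (ι → F)) →* SpecialLinearGroup ι F where
  toFun p := rowElem i (Function.update p.toAdd.2 j p.toAdd.1)
  map_one' := by
    rw [← rowElem_zero i]
    congr 1
    ext k
    simp [Function.update_apply]
  map_mul' p p' := by
    rw [rowElem_mul]
    congr 1
    ext k
    simp only [toAdd_mul, Prod.fst_add, Prod.snd_add, Function.update_apply, Pi.add_apply]
    split_ifs <;> rfl

theorem diag2n_eq_prod {i j : ι} (hij : i ≠ j) (a : F) (ha : a ≠ 0) :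
    diag2n hij a ha = transvection hij a * transvection hij.symm (- a⁻¹) *
      transvection hij a * transvection hij (-1) * transvection hij.symm 1 *
      transvection hij (-1) := by
  apply Subtype.ext
  have h1 : (diag2n hij a ha).1 = 1 + single i i (a - 1) + single j j (a⁻¹ - 1) := by
    ext k l
    simp [diag2n_coe, Matrix.diagonal_apply, Matrix.single_apply, Matrix.one_apply]
    grind
  rw [h1]
  change _ = (transvection hij a).1 * (transvection hij.symm (- a⁻¹)).1 *
      (transvection hij a).1 * (transvection hij (-1)).1 * (transvection hij.symm 1).1 *
      (transvection hij (-1)).1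
  simp only [transvection_coe, mul_add, add_mul, single_mul_single_same, one_mul, mul_one,
    single_mul_single_of_ne _ _ _ _ hij, single_mul_single_of_ne _ _ _ _ hij.symm]
  ext k l
  simp [Matrix.single_apply, Matrix.one_apply, ha]
  grind

/-- Transvections generate the special linear group. -/
theorem closure_transvections [Nontrivial ι] (H : Subgroup (SpecialLinearGroup ι F))
    (hH : ∀ (i j : ι) (hij : i ≠ j) (s : F), transvection hij s ∈ H) : H = ⊤ := by
  refine eq_top_iff.2 fun A _ => ?_
  refine diagonal_transvection_induction' (· ∈ H) A (fun i j hij c hc => ?_) hH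
    fun A B hA hB => mul_mem hA hB
  rw [diag2n_eq_prod]
  exact mul_mem (mul_mem (mul_mem (mul_mem (mul_mem (hH _ _ _ _) (hH _ _ _ _)) (hH _ _ _ _))
    (hH _ _ _ _)) (hH _ _ _ _)) (hH _ _ _ _)

end SpecialLinear

section UnitaryRepresentation2

variable {G V : Type*} [Group G] [AddCommGroup V] [Module ℂ V] [FiniteDimensional ℂ V]

theorem sum_character_comp (ρ : Representation ℂ G V) {H : Type*} [Group H] [Fintype H]
    (f : H →* G) : ∑ h, ρ.character (f h) =
      Fintype.card H * finrank ℂ (Representation.invariants (ρ.comp f)) := by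
  have hH : (Nat.card H : ℂ) ≠ 0 := by simp
  let : Invertible (Nat.card H : ℂ) := invertibleOfNonzero hH
  have := Representation.card_inv_mul_sum_char_eq_finrank (ρ.comp f)
  rw [← Nat.card_eq_fintype_card, ← this, ← mul_assoc, mul_inv_cancel₀ hH, one_mul]
  rfl

theorem card_mul_finrank_invariants_le (ρ : Representation ℂ G V) {F W : Type*} [AddGroup F]
    [Fintype F] [AddGroup W] [Fintype W] (T : Multiplicative F →* G)
    (R : Multiplicative (F × W) →* G)
    (hR : ∀ s w, s ≠ 0 → ρ.character (R (Multiplicative.ofAdd (s, w))) =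
      ρ.character (T (Multiplicative.ofAdd s))) :
    Fintype.card F * finrank ℂ (Representation.invariants (ρ.comp T)) ≤
      Fintype.card F * finrank ℂ (Representation.invariants (ρ.comp R)) + finrank ℂ V := by
  classical
  let R₀ : Multiplicative W →* G := R.comp (AddMonoidHom.inr F W).toMultiplicative
  have h1 := sum_character_comp ρ T
  have h2 := sum_character_comp ρ R
  have h3 := sum_character_comp ρ R₀
  have hW : (Fintype.card W : ℂ) ≠ 0 := by simp
  replace h1 : ∑ s : F, ρ.character (T (Multiplicative.ofAdd s)) =
    Fintype.card F * finrank ℂ (Representation.invariants (ρ.comp T)) := by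
      rw [← Fintype.card_multiplicative F, ← h1]
      exact (Equiv.sum_comp Multiplicative.ofAdd fun h => ρ.character (T h))
  replace h2 : ∑ p : F × W, ρ.character (R (Multiplicative.ofAdd p)) =
    Fintype.card (F × W) * finrank ℂ (Representation.invariants (ρ.comp R)) := by
      rw [← Fintype.card_multiplicative (F × W), ← h2]
      exact (Equiv.sum_comp Multiplicative.ofAdd fun h => ρ.character (R h))
  replace h3 : ∑ w : W, ρ.character (R (Multiplicative.ofAdd (0, w))) =
    Fintype.card W * finrank ℂ (Representation.invariants (ρ.comp R₀)) := by
      rw [← Fintype.card_multiplicative W, ← h3]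
      exact (Equiv.sum_comp Multiplicative.ofAdd fun h => ρ.character (R₀ h))
  rw [Fintype.sum_prod_type, ← Finset.add_sum_erase _ _ (Finset.mem_univ (0 : F)), h3,
    Finset.sum_congr rfl (g := fun s => Fintype.card W * ρ.character (T (Multiplicative.ofAdd s)))
      (fun s hs => by simp [hR _ _ (Finset.ne_of_mem_erase hs)]), ← Finset.mul_sum,
    Fintype.card_prod] at h2
  rw [← Finset.add_sum_erase _ _ (Finset.mem_univ (0 : F)), ofAdd_zero, map_one,
    Representation.char_one] at h1
  have h4 : (finrank ℂ (Representation.invariants (ρ.comp R₀)) : ℂ) +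
      Fintype.card F * finrank ℂ (Representation.invariants (ρ.comp T)) =
      Fintype.card F * finrank ℂ (Representation.invariants (ρ.comp R)) + finrank ℂ V := by
    rw [← h1]
    apply mul_left_cancel₀ hW
    push_cast at h2
    linear_combination h2
  have h5 : finrank ℂ (Representation.invariants (ρ.comp R₀)) +
      Fintype.card F * finrank ℂ (Representation.invariants (ρ.comp T)) =
      Fintype.card F * finrank ℂ (Representation.invariants (ρ.comp R)) + finrank ℂ V := by
    exact_mod_cast h4
  omega

/-- The stabilizer of a vector. -/
def vectorStabilizer {V : Type*} [AddCommGroup V] [Module ℂ V] (ρ : Representation ℂ G V) (v : V) :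
    Subgroup G where
  carrier := {g | ρ g v = v}
  mul_mem' := fun {a b} ha hb => by
    simp only [Set.mem_ofPred_eq, map_mul, Module.End.mul_apply] at *
    rw [hb, ha]
  one_mem' := by simp
  inv_mem' := fun {a} ha => by
    simp only [Set.mem_ofPred_eq] at *
    nth_rw 1 [← ha]
    simp

theorem mul_finrank_le_mul_finrank_inf {A B W : Submodule ℂ V} (hA : A ≤ W) (hB : B ≤ W) {q d : ℕ}
    (h : q * finrank ℂ W ≤ q * finrank ℂ A + d) :
    q * finrank ℂ B ≤ q * finrank ℂ (B ⊓ A : Submodule ℂ V) + d := by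
  have h1 := Submodule.finrank_sup_add_finrank_inf_eq B A
  have h2 := Submodule.finrank_mono (sup_le hB hA)
  nlinarith

end UnitaryRepresentation2

section SpecialLinear2

open Matrix Matrix.SpecialLinearGroup

variable {ι F : Type*} [Fintype ι] [DecidableEq ι] [Field F]
variable {V : Type*} [AddCommGroup V] [Module ℂ V]

/-- The inverse transpose automorphism. -/
def inverseTranspose : SpecialLinearGroup ι F →* SpecialLinearGroup ι F where
  toFun A := (A⁻¹).transpose
  map_one' := by apply Subtype.ext; simp
  map_mul' A B := by
    rw [_root_.mul_inv_rev]
    apply Subtype.ext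
    change ((B⁻¹).1 * (A⁻¹).1)ᵀ = (A⁻¹).1ᵀ * (B⁻¹).1ᵀ
    rw [Matrix.transpose_mul]

theorem inverseTranspose_transvection {i j : ι} (hij : i ≠ j) (s : F) :
    inverseTranspose (transvection hij s) = transvection hij.symm (-s) := by
  apply Subtype.ext
  change ((transvection hij s)⁻¹).1ᵀ = _
  rw [transvection_inv]
  simp [transvection_coe]

theorem commutator_transvection {i j k : ι} (hki : k ≠ i) (hij : i ≠ j) (hkj : k ≠ j) (s : F) :
    transvection hki s * transvection hij 1 * transvection hki (-s) * transvection hij (-1) =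
      transvection hkj s := by
  apply Subtype.ext
  change (transvection hki s).1 * (transvection hij 1).1 * (transvection hki (-s)).1 *
    (transvection hij (-1)).1 = _
  simp only [transvection_coe, mul_add, add_mul, single_mul_single_same, one_mul, mul_one,
    single_mul_single_of_ne _ _ _ _ hij.symm, single_mul_single_of_ne _ _ _ _ hki.symm,
    single_mul_single_of_ne _ _ _ _ hkj.symm]
  ext a b
  simp [Matrix.single_apply, Matrix.one_apply]
  grind

theorem mem_invariants_transvectionHom (ρ : Representation ℂ (SpecialLinearGroup ι F) V) {i j : ι}
    (hij : i ≠ j) {v : V} : v ∈ Representation.invariants (ρ.comp (transvectionHom hij)) ↔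
      ∀ s, ρ (transvection hij s) v = v := by
  rw [Representation.mem_invariants]
  rfl

theorem exists_rowFixed [FiniteDimensional ℂ V] [Fintype F]
    (ρ : Representation ℂ (SpecialLinearGroup ι F) V) {i j : ι}
    (hij : i ≠ j) : ∃ U : Submodule ℂ V,
      (∀ v ∈ U, ∀ k (hik : i ≠ k) s, ρ (transvection hik s) v = v) ∧
      Fintype.card F * finrank ℂ (Representation.invariants (ρ.comp (transvectionHom hij))) ≤
        Fintype.card F * finrank ℂ U + finrank ℂ V := by
  refine ⟨Representation.invariants (ρ.comp (rowHom i j)), ?_, ?_⟩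
  · intro v hv k hik s
    rw [Representation.mem_invariants] at hv
    have := hv (Multiplicative.ofAdd ((Pi.single k s : ι → F) j, Pi.single k s))
    rw [← rowElem_single hik]
    change ρ (rowElem i (Function.update (Pi.single k s) j ((Pi.single k s : ι → F) j))) v = v at this
    rwa [Function.update_eq_self] at this
  · refine card_mul_finrank_invariants_le ρ _ _ fun s w hs => ?_
    change ρ.character (rowElem i (Function.update w j s)) = ρ.character (transvection hij s)
    have h := transvection_mul_rowElem hij (Function.update w j s) (by simpa using hs)
    rw [Function.update_self] at h
    rw [eq_inv_mul_of_mul_eq h.symm, ← Representation.char_conj ρ _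
      (rowElem j (Function.update (s⁻¹ • Function.update w j s) i 0))]
    congr 1
    group

theorem exists_colFixed [FiniteDimensional ℂ V] [Fintype F]
    (ρ : Representation ℂ (SpecialLinearGroup ι F) V) {i j : ι}
    (hij : i ≠ j) : ∃ U : Submodule ℂ V,
      (∀ v ∈ U, ∀ k (hkj : k ≠ j) s, ρ (transvection hkj s) v = v) ∧
      Fintype.card F * finrank ℂ (Representation.invariants (ρ.comp (transvectionHom hij))) ≤
        Fintype.card F * finrank ℂ U + finrank ℂ V := by
  obtain ⟨U, hU, hU'⟩ := exists_rowFixed (ρ.comp inverseTranspose) hij.symm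
  refine ⟨U, fun v hv k hkj s => ?_, ?_⟩
  · have := hU v hv k hkj.symm (-s)
    simpa [inverseTranspose_transvection] using this
  · suffices h : Representation.invariants (ρ.comp (transvectionHom hij)) =
        Representation.invariants ((ρ.comp inverseTranspose).comp (transvectionHom hij.symm)) by
      rw [h]; exact hU'
    ext v
    rw [mem_invariants_transvectionHom, mem_invariants_transvectionHom]
    simp only [MonoidHom.comp_apply, inverseTranspose_transvection]
    exact ⟨fun h s => h _, fun h s => by simpa using h (-s)⟩

/-- In a representation of `SL_n(q)`, `n ≥ 3`, without invariants, a root subgroup has few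
invariants. -/
theorem card_mul_finrank_invariants_transvectionHom_le [FiniteDimensional ℂ V] [Fintype F]
    (ρ : Representation ℂ (SpecialLinearGroup ι F) V) (hV : ρ.invariants = ⊥) {i j k : ι}
    (hij : i ≠ j) (hki : k ≠ i) (hkj : k ≠ j) :
    Fintype.card F * finrank ℂ (Representation.invariants (ρ.comp (transvectionHom hij))) ≤
      4 * finrank ℂ V := by
  have : Nontrivial ι := ⟨i, j, hij⟩
  obtain ⟨A₁, h1, h1'⟩ := exists_rowFixed ρ hij
  obtain ⟨A₂, h2, h2'⟩ := exists_colFixed ρ hij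
  obtain ⟨A₃, h3, h3'⟩ := exists_rowFixed ρ hkj
  obtain ⟨A₄, h4, h4'⟩ := exists_colFixed ρ hki
  have e1 := mul_finrank_le_mul_finrank_inf (A := A₁) (B := A₂)
    (fun v hv => (mem_invariants_transvectionHom ρ hij).2 (h1 v hv j hij))
    (fun v hv => (mem_invariants_transvectionHom ρ hij).2 (h2 v hv i hij)) h1'
  have e2 := mul_finrank_le_mul_finrank_inf (A := A₃) (B := A₂ ⊓ A₁)
    (fun v hv => (mem_invariants_transvectionHom ρ hkj).2 (h3 v hv j hkj))
    (fun v hv => (mem_invariants_transvectionHom ρ hkj).2 (h2 v hv.1 k hkj)) h3'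
  have e3 := mul_finrank_le_mul_finrank_inf (A := A₄) (B := A₂ ⊓ A₁ ⊓ A₃)
    (fun v hv => (mem_invariants_transvectionHom ρ hki).2 (h4 v hv k hki))
    (fun v hv => (mem_invariants_transvectionHom ρ hki).2 (h3 v hv.2 i hki)) h4'
  have e4 : A₂ ⊓ A₁ ⊓ A₃ ⊓ A₄ = ⊥ := by
    refine eq_bot_iff.2 fun v hv => ?_
    rw [← hV, Representation.mem_invariants]
    let H := vectorStabilizer ρ v
    have hH : H = ⊤ := by
      apply closure_transvections
      intro a b hab s
      by_cases hai : a = i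
      · subst hai
        exact h1 v hv.1.1.2 b hab s
      by_cases hbi : b = i
      · subst hbi
        exact h4 v hv.2 a hab s
      have c1 : ∀ s, SpecialLinearGroup.transvection hai s ∈ H := fun s => h4 v hv.2 a hai s
      have c2 : ∀ s, SpecialLinearGroup.transvection (Ne.symm hbi) s ∈ H := fun s => h1 v hv.1.1.2 b (Ne.symm hbi) s
      rw [← commutator_transvection hai (Ne.symm hbi) hab]
      exact mul_mem (mul_mem (mul_mem (c1 _) (c2 _)) (c1 _)) (c2 _)
    intro g
    have : g ∈ H := hH ▸ Subgroup.mem_top g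
    exact this
  rw [e4, finrank_bot] at e3
  omega

end SpecialLinear2

section SpecialLinear3

open Matrix Matrix.SpecialLinearGroup

variable {ι F : Type*} [Fintype ι] [DecidableEq ι] [Field F]

theorem exists_conj_eq_mul_transvection {i j k : ι} (hij : i ≠ j) (hik : i ≠ k) (hjk : j ≠ k)
    (g : SpecialLinearGroup ι F) (hg : ∀ a, g.1 a j = if a = i then 1 else 0) {d : F} (hd : d ≠ 0)
    (x : F) : ∃ u : SpecialLinearGroup ι F,
      u⁻¹ * (g⁻¹ * SpecialLinearGroup.transvection hik d * g *
        SpecialLinearGroup.transvection hik (-d)) * u =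
      g⁻¹ * SpecialLinearGroup.transvection hik d * g *
        SpecialLinearGroup.transvection hik (-d) * SpecialLinearGroup.transvection hjk x := by
  set y := g⁻¹ * SpecialLinearGroup.transvection hik d * g *
        SpecialLinearGroup.transvection hik (-d) with hy
  set r := x / d with hr
  refine ⟨SpecialLinearGroup.transvection hij.symm r, ?_⟩
  rw [mul_assoc, inv_mul_eq_iff_eq_mul]
  obtain ⟨P, hPg⟩ : ∃ P : Matrix ι ι F, P = (g⁻¹).1 := ⟨_, rfl⟩
  obtain ⟨Q, hQg⟩ : ∃ Q : Matrix ι ι F, Q = g.1 := ⟨_, rfl⟩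
  obtain ⟨Y, hYy⟩ : ∃ Y : Matrix ι ι F, Y = y.1 := ⟨_, rfl⟩
  rw [← hQg] at hg
  have hPQ : P * Q = 1 := by
    rw [hPg, hQg]
    change (g⁻¹ * g).1 = 1
    rw [inv_mul_cancel]; rfl
  have hP : ∀ a, P a i = if a = j then 1 else 0 := by
    intro a
    have h2 := congrFun (congrFun hPQ a) j
    rw [Matrix.mul_apply] at h2
    simpa [hg, Matrix.one_apply] using h2
  have hy1 : Y = (1 + single j k d * Q) * (1 + single i k (-d)) := by
    have h0 : Y = P * (1 + single i k d) * Q * (1 + single i k (-d)) := by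
      rw [hYy, hPg, hQg]; rfl
    have h2 : P * single i k d = single j k d := by
      ext a b
      by_cases hb : b = k
      · subst hb
        simp [hP, Matrix.single_apply, eq_comm]
      · simp [Matrix.mul_apply, Ne.symm hb]
    rw [h0, mul_add P, h2, mul_one, add_mul P, hPQ]
  have h1 : ∀ b z, Y * single j b z = single j b z := by
    intro b z
    rw [hy1, Matrix.mul_assoc, add_mul 1 (single i k (-d)), single_mul_single_of_ne _ _ _ _ hjk.symm,
      one_mul, add_zero, add_mul, single_mul_mul_single, hg, if_neg hik.symm]
    simp
  have h2 : single j i r * Y = single j i r - single j k x := by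
    have hx : r * d = x := by rw [hr]; field_simp
    have : single j i r * (1 + single j k d * Q) = single j i r := by
      rw [mul_add, ← Matrix.mul_assoc, single_mul_single_of_ne _ _ _ _ hij]
      simp
    rw [hy1, ← Matrix.mul_assoc, this, mul_add, single_mul_single_same, mul_neg, hx, mul_one,
      sub_eq_add_neg, ← single_neg]
  apply Subtype.ext
  have h3 : Y * (1 + single j i r) = (1 + single j i r) * (Y * (1 + single j k x)) := by
    rw [mul_add, mul_add, h1, h1, add_mul, mul_add, mul_add, mul_one, h2,
      single_mul_single_of_ne _ _ _ _ hij]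
    simp
  rw [hYy] at h3
  exact h3

theorem card_mul_norm_character_sq_le_of_col [Fintype F] {V : Type*} [NormedAddCommGroup V]
    [InnerProductSpace ℂ V] [FiniteDimensional ℂ V]
    (ρ : Representation ℂ (SpecialLinearGroup ι F) V) (hρ : ∀ g v, ‖ρ g v‖ = ‖v‖)
    (hV : ρ.invariants = ⊥) {i j k : ι} (hij : i ≠ j) (hik : i ≠ k) (hjk : j ≠ k)
    (g : SpecialLinearGroup ι F) (hg : ∀ a, g.1 a j = if a = i then 1 else 0) :
    Fintype.card F * ‖ρ.character g‖ ^ 2 ≤ 5 * (finrank ℂ V : ℝ) ^ 2 := by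
  have h1 := card_mul_finrank_invariants_transvectionHom_le ρ hV hjk hij hik
  have h2 := norm_character_sq_le_of_commutator ρ hρ
    (fun s : F => SpecialLinearGroup.transvection hik s) g
    (m := finrank ℂ (Representation.invariants (ρ.comp (transvectionHom (F := F) hjk))))
    (by positivity) (by
      intro s r hsr
      have e : ρ.character (SpecialLinearGroup.transvection hik s * g⁻¹ *
          (SpecialLinearGroup.transvection hik s)⁻¹ * (SpecialLinearGroup.transvection hik r * g *
          (SpecialLinearGroup.transvection hik r)⁻¹)) =
          ρ.character (g⁻¹ * SpecialLinearGroup.transvection hik (r - s) * g *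
            SpecialLinearGroup.transvection hik (-(r - s))) := by
        rw [← ρ.char_conj _ (SpecialLinearGroup.transvection hik s)⁻¹]
        congr 1
        have e1 : SpecialLinearGroup.transvection hik (r - s) =
            (SpecialLinearGroup.transvection hik s)⁻¹ * SpecialLinearGroup.transvection hik r := by
          rw [transvection_inv, ← transvection_add, neg_add_eq_sub]
        have e2 : SpecialLinearGroup.transvection hik (-(r - s)) =
            (SpecialLinearGroup.transvection hik r)⁻¹ * SpecialLinearGroup.transvection hik s := by
          rw [transvection_inv, ← transvection_add, neg_sub, neg_add_eq_sub]
        rw [e1, e2]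
        group
      rw [e]
      refine norm_character_le_finrank_invariants ρ hρ _ _ fun x => ?_
      obtain ⟨u, hu⟩ := exists_conj_eq_mul_transvection hij hik hjk g hg
        (sub_ne_zero.2 hsr.symm) x.toAdd
      change ρ.character (_ * SpecialLinearGroup.transvection hjk x.toAdd) = _
      rw [← hu]
      simpa using ρ.char_conj (g⁻¹ * SpecialLinearGroup.transvection hik (r - s) * g *
            SpecialLinearGroup.transvection hik (-(r - s))) u⁻¹)
  have h3 : (Fintype.card F : ℝ) *
      finrank ℂ (Representation.invariants (ρ.comp (transvectionHom (F := F) hjk))) ≤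
      4 * finrank ℂ V := by exact_mod_cast h1
  calc _ ≤ _ := h2
    _ ≤ (finrank ℂ V : ℝ) * (finrank ℂ V + 4 * finrank ℂ V) := by gcongr
    _ = _ := by ring

/-- Conjugation by an invertible matrix. -/
def conjHom (P : (Matrix ι ι F)ˣ) : SpecialLinearGroup ι F →* SpecialLinearGroup ι F where
  toFun A := ⟨P.1 * A.1 * P⁻¹.1, by rw [Matrix.det_units_conj]; exact A.2⟩
  map_one' := by
    apply Subtype.ext
    change P.1 * 1 * P⁻¹.1 = 1
    simp
  map_mul' A B := by
    apply Subtype.ext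
    change P.1 * (A.1 * B.1) * P⁻¹.1 = P.1 * A.1 * P⁻¹.1 * (P.1 * B.1 * P⁻¹.1)
    simp [mul_assoc]

theorem conjHom_conjHom_inv (P : (Matrix ι ι F)ˣ) (A : SpecialLinearGroup ι F) :
    conjHom P (conjHom P⁻¹ A) = A := by
  apply Subtype.ext
  change P.1 * (P⁻¹.1 * A.1 * P⁻¹⁻¹.1) * P⁻¹.1 = A.1
  simp [mul_assoc]

theorem exists_linearIndependent_of_notMem_center (g : SpecialLinearGroup ι F)
    (hg : g ∉ Subgroup.center (SpecialLinearGroup ι F)) :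
    ∃ v : ι → F, LinearIndependent F ![v, g.1 *ᵥ v] := by
  by_contra! h
  obtain ⟨a, ha⟩ := LinearMap.exists_eq_smul_id_of_forall_notLinearIndependent
    (f := Matrix.mulVecLin g.1) (by simpa using h)
  apply hg
  rw [mem_center_iff]
  have h1 : scalar ι a = g.1 := by
    ext k l
    have := congrFun (LinearMap.congr_fun ha (Pi.single l 1)) k
    simp [Pi.single_apply] at this
    simp [Matrix.diagonal_apply, this]
  refine ⟨a, ?_, h1⟩
  have := g.2
  rw [← h1] at this
  simpa using this

theorem exists_conjHom_col {i j : ι} (hij : i ≠ j) (g : SpecialLinearGroup ι F)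
    (hg : g ∉ Subgroup.center (SpecialLinearGroup ι F)) :
    ∃ P : (Matrix ι ι F)ˣ, ∀ a, (conjHom P⁻¹ g).1 a j = if a = i then 1 else 0 := by
  obtain ⟨v, hv⟩ := exists_linearIndependent_of_notMem_center g hg
  have he : LinearIndependent F ![(Pi.single j 1 : ι → F), Pi.single i 1] := by
    have := (Pi.basisFun F ι).linearIndependent.comp ![j, i] (by
      intro a b; fin_cases a <;> fin_cases b <;> simp [hij, hij.symm])
    convert this using 1
    ext a; fin_cases a <;> simp
  obtain ⟨p, hp⟩ : ∃ p : (ι → F) ≃ₗ[F] (ι → F), p (Pi.single j 1) = v ∧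
      p (Pi.single i 1) = g.1 *ᵥ v := by
    let f := he.linearCombinationEquiv.symm ≪≫ₗ hv.linearCombinationEquiv
    have : FiniteDimensional F
        (Submodule.span F (Set.range ![(Pi.single j 1 : ι → F), Pi.single i 1])) :=
      FiniteDimensional.span_of_finite F (Set.finite_range _)
    obtain ⟨p, hp⟩ := Submodule.exists_linearEquiv_restrict_eq f
    have key : ∀ a, p (![(Pi.single j 1 : ι → F), Pi.single i 1] a) = ![v, g.1 *ᵥ v] a := by
      intro a
      have h1 : ((he.linearCombinationEquiv (Finsupp.single a 1) : _) : ι → F) =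
          ![(Pi.single j 1 : ι → F), Pi.single i 1] a := by simp
      rw [← h1, ← hp]
      simp [f]
    exact ⟨p, key 0, key 1⟩
  let P : (Matrix ι ι F)ˣ := ⟨LinearMap.toMatrix' p, LinearMap.toMatrix' p.symm, by
    rw [← LinearMap.toMatrix'_comp]; simp, by rw [← LinearMap.toMatrix'_comp]; simp⟩
  refine ⟨P, fun a => ?_⟩
  have h1 : (conjHom P⁻¹ g).1 *ᵥ Pi.single j 1 = Pi.single i 1 := by
    change (P⁻¹.1 * g.1 * P⁻¹⁻¹.1) *ᵥ Pi.single j 1 = Pi.single i 1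
    rw [inv_inv]
    change (LinearMap.toMatrix' p.symm.toLinearMap * g.1 * LinearMap.toMatrix' p.toLinearMap) *ᵥ
      Pi.single j 1 = Pi.single i 1
    rw [← Matrix.mulVec_mulVec, LinearMap.toMatrix'_mulVec, ← Matrix.mulVec_mulVec,
      LinearMap.toMatrix'_mulVec]
    simp [hp.1, ← hp.2, -Matrix.mulVec_single]
  have := congrFun h1 a
  simpa [Pi.single_apply] using this

/-- Character ratio bound for `SL_n(q)`, `n ≥ 3`. -/
theorem card_mul_norm_character_sq_le [Fintype F] {V : Type*} [NormedAddCommGroup V]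
    [InnerProductSpace ℂ V] [FiniteDimensional ℂ V]
    (ρ : Representation ℂ (SpecialLinearGroup ι F) V) (hρ : ∀ g v, ‖ρ g v‖ = ‖v‖)
    (hV : ρ.invariants = ⊥) (hι : 3 ≤ Fintype.card ι)
    (g : SpecialLinearGroup ι F) (hg : g ∉ Subgroup.center (SpecialLinearGroup ι F)) :
    Fintype.card F * ‖ρ.character g‖ ^ 2 ≤ 5 * (finrank ℂ V : ℝ) ^ 2 := by
  obtain ⟨i, j, k, hij, hik, hjk⟩ := Fintype.two_lt_card_iff.1 hι
  obtain ⟨P, hP⟩ := exists_conjHom_col hij g hg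
  have h := card_mul_norm_character_sq_le_of_col (ρ.comp (conjHom P)) (fun _ _ => hρ _ _) (by
    rw [← hV]
    ext v
    simp only [Representation.mem_invariants]
    exact ⟨fun h g => by simpa [conjHom_conjHom_inv] using h (conjHom P⁻¹ g),
      fun h g => h _⟩) hij hik hjk _ hP
  have e : Representation.character (ρ.comp (conjHom P)) (conjHom P⁻¹ g) = ρ.character g := by
    change ρ.character (conjHom P (conjHom P⁻¹ g)) = _
    rw [conjHom_conjHom_inv]
  rwa [e] at h

end SpecialLinear3

section Isotypic

variable {F V : Type*} [Field F] [Fintype F] [AddCommGroup V] [Module ℂ V]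

/-- The twist of a representation of `(F, +)` by the inverse of an additive character. -/
def twistRep (σ : Representation ℂ (Multiplicative F) V) (ψ : AddChar F ℂ) :
    Representation ℂ (Multiplicative F) V where
  toFun s := ψ (-s.toAdd) • σ s
  map_one' := by simp
  map_mul' s t := by
    rw [toAdd_mul, neg_add, AddChar.map_add_eq_mul, map_mul, smul_mul_smul_comm]

/-- The isotypic subspace of a representation of `(F, +)`. -/
noncomputable def isotypic (σ : Representation ℂ (Multiplicative F) V) (ψ : AddChar F ℂ) : Submodule ℂ V :=
  (twistRep σ ψ).invariants

theorem mem_isotypic (σ : Representation ℂ (Multiplicative F) V) (ψ : AddChar F ℂ) (v : V) :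
    v ∈ isotypic σ ψ ↔ ∀ s : F, ψ (-s) • σ (Multiplicative.ofAdd s) v = v := by
  rw [isotypic, Representation.mem_invariants]
  rfl

variable [FiniteDimensional ℂ V]

theorem card_mul_finrank_isotypic (σ : Representation ℂ (Multiplicative F) V) (ψ : AddChar F ℂ) :
    (Fintype.card F : ℂ) * finrank ℂ (isotypic σ ψ) =
      ∑ s : F, ψ (-s) * σ.character (Multiplicative.ofAdd s) := by
  have h := sum_character_comp (twistRep σ ψ) (MonoidHom.id _)
  rw [Fintype.card_multiplicative F] at h
  refine h.symm.trans ?_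
  rw [← Equiv.sum_comp Multiplicative.ofAdd]
  refine Finset.sum_congr rfl fun s _ => ?_
  change LinearMap.trace ℂ V (ψ (-s) • σ (Multiplicative.ofAdd s)) = _
  rw [map_smul, smul_eq_mul]
  rfl

theorem sum_finrank_isotypic (σ : Representation ℂ (Multiplicative F) V) :
    ∑ ψ : AddChar F ℂ, finrank ℂ (isotypic σ ψ) = finrank ℂ V := by
  classical
  have hF : (Fintype.card F : ℂ) ≠ 0 := by simp
  have : (Fintype.card F : ℂ) * ∑ ψ : AddChar F ℂ, (finrank ℂ (isotypic σ ψ) : ℂ) =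
      Fintype.card F * finrank ℂ V := by
    rw [Finset.mul_sum]
    simp_rw [card_mul_finrank_isotypic]
    rw [Finset.sum_comm]
    simp_rw [← Finset.sum_mul, AddChar.sum_apply_eq_ite]
    simp
  exact_mod_cast mul_left_cancel₀ hF this

theorem card_sub_one_mul_finrank_isotypic_le (σ : Representation ℂ (Multiplicative F) V)
    (hσ : ∀ t : Fˣ, ∀ s : F, σ.character (Multiplicative.ofAdd ((t : F) ^ 2 * s)) =
      σ.character (Multiplicative.ofAdd s)) (ψ : AddChar F ℂ) (hψ : ψ ≠ 1) :
    (Fintype.card F - 1) * finrank ℂ (isotypic σ ψ) ≤ 2 * finrank ℂ V := by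
  classical
  have hF : (Fintype.card F : ℂ) ≠ 0 := by simp
  let f : Fˣ → AddChar F ℂ := fun t => AddChar.mulShift ψ ((t : F) ^ 2)
  have h1 : ∀ t, finrank ℂ (isotypic σ (f t)) = finrank ℂ (isotypic σ ψ) := by
    intro t
    have : (Fintype.card F : ℂ) * finrank ℂ (isotypic σ (f t)) =
        Fintype.card F * finrank ℂ (isotypic σ ψ) := by
      rw [card_mul_finrank_isotypic, card_mul_finrank_isotypic]
      refine Eq.trans ?_ (Equiv.sum_comp (Equiv.mulLeft₀ ((t : F) ^ 2) (by simp))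
        fun s => ψ (-s) * σ.character (Multiplicative.ofAdd s))
      refine Finset.sum_congr rfl fun s _ => ?_
      simp [f, hσ]
    exact_mod_cast mul_left_cancel₀ hF this
  have h2 : ∀ χ : AddChar F ℂ, (Finset.univ.filter fun t => f t = χ).card ≤ 2 := by
    intro χ
    rcases (Finset.univ.filter fun t => f t = χ).eq_empty_or_nonempty with h | ⟨t₀, ht₀⟩
    · simp [h]
    refine (Finset.card_le_card (t := {t₀, -t₀}) fun t ht => ?_).trans Finset.card_le_two
    have e : f t = f t₀ := by simp_all
    by_contra hne
    apply hψ
    have hsq : (t : F) ^ 2 - (t₀ : F) ^ 2 ≠ 0 := by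
      intro h
      apply hne
      rcases sq_eq_sq_iff_eq_or_eq_neg.1 (sub_eq_zero.1 h) with h | h
      · simp [Units.ext h]
      · have : t = -t₀ := Units.ext (by simpa using h)
        simp [this]
    ext x
    have e2 := DFunLike.congr_fun e (x / ((t : F) ^ 2 - (t₀ : F) ^ 2))
    simp only [f, AddChar.mulShift_apply] at e2
    have e3 : x = (t : F) ^ 2 * (x / ((t : F) ^ 2 - (t₀ : F) ^ 2)) +
        -((t₀ : F) ^ 2 * (x / ((t : F) ^ 2 - (t₀ : F) ^ 2))) := by
      field_simp
      ring
    rw [e3, AddChar.map_add_eq_mul, e2, ← AddChar.map_add_eq_mul]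
    simp
  calc (Fintype.card F - 1) * finrank ℂ (isotypic σ ψ)
      = ∑ t : Fˣ, finrank ℂ (isotypic σ (f t)) := by
        simp [h1, Fintype.card_units]
    _ = ∑ χ : AddChar F ℂ, (Finset.univ.filter fun t => f t = χ).card * finrank ℂ (isotypic σ χ) := by
        rw [← Finset.sum_fiberwise_of_maps_to (g := f) (t := Finset.univ) (by simp)]
        refine Finset.sum_congr rfl fun χ _ => ?_
        rw [Finset.sum_congr rfl (g := fun _ => finrank ℂ (isotypic σ χ))]
        · simp
        · intro t ht
          rw [(Finset.mem_filter.1 ht).2]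
    _ ≤ ∑ χ : AddChar F ℂ, 2 * finrank ℂ (isotypic σ χ) := by
        gcongr with χ
        exact h2 χ
    _ = 2 * finrank ℂ V := by rw [← Finset.mul_sum, sum_finrank_isotypic]

open Matrix Matrix.SpecialLinearGroup in
/-- A representation of `SL₂(q)` without invariants contains a subspace of small relative dimension,
invariant under the commutant. -/
theorem exists_submodule_card_sub_one_mul_finrank_le
    (ρ : Representation ℂ (SpecialLinearGroup (Fin 2) F) V) (hV : ρ.invariants = ⊥)
    [Nontrivial V] : ∃ W : Submodule ℂ V, W ≠ ⊥ ∧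
      (Fintype.card F - 1) * finrank ℂ W ≤ 2 * finrank ℂ V ∧
      ∀ f : V →ₗ[ℂ] V, (∀ g v, f (ρ g v) = ρ g (f v)) → ∀ v ∈ W, f v ∈ W := by
  have h01 : (0 : Fin 2) ≠ 1 := by decide
  set σ : Representation ℂ (Multiplicative F) V := ρ.comp (transvectionHom h01) with hσ
  have hσ' : ∀ s, σ (Multiplicative.ofAdd s) = ρ (SpecialLinearGroup.transvection h01 s) :=
    fun s => rfl
  obtain ⟨ψ, hψ, hψ'⟩ : ∃ ψ : AddChar F ℂ, ψ ≠ 1 ∧ isotypic σ ψ ≠ ⊥ := by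
    by_contra! h
    have h1 := sum_finrank_isotypic σ
    rw [Finset.sum_eq_single 1 (fun ψ _ hψ => by rw [h ψ hψ, finrank_bot]) (by simp)] at h1
    have h2 := Submodule.eq_top_of_finrank_eq h1
    have h3 : ∀ s v, ρ (SpecialLinearGroup.transvection h01 s) v = v := by
      intro s v
      have : v ∈ isotypic σ 1 := h2 ▸ Submodule.mem_top
      simpa [hσ'] using (mem_isotypic σ 1 v).1 this s
    have h4 : ∀ s v, ρ (SpecialLinearGroup.transvection h01.symm s) v = v := by
      intro s v
      let w : SpecialLinearGroup (Fin 2) F := ⟨!![0, -1; 1, 0], by simp⟩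
      have e : SpecialLinearGroup.transvection h01.symm s =
          w * SpecialLinearGroup.transvection h01 (-s) * w⁻¹ := by
        rw [eq_mul_inv_iff_mul_eq]
        apply Subtype.ext
        change (SpecialLinearGroup.transvection h01.symm s).1 * !![0, -1; 1, 0] =
          !![0, -1; 1, 0] * (SpecialLinearGroup.transvection h01 (-s)).1
        rw [transvection_coe, transvection_coe]
        ext a b
        fin_cases a <;> fin_cases b <;>
          simp [Matrix.mul_apply, Fin.sum_univ_two, Matrix.one_apply, Matrix.single_apply]
      rw [e, map_mul, map_mul, Module.End.mul_apply, Module.End.mul_apply, h3]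
      simp
    obtain ⟨v, hv⟩ := exists_ne (0 : V)
    apply hv
    rw [← Submodule.mem_bot ℂ, ← hV, Representation.mem_invariants]
    have h5 : vectorStabilizer ρ v = ⊤ := by
      apply closure_transvections
      intro i j hij s
      fin_cases i <;> fin_cases j
      · exact absurd rfl hij
      · exact h3 s v
      · exact h4 s v
      · exact absurd rfl hij
    intro g
    have : g ∈ vectorStabilizer ρ v := h5 ▸ Subgroup.mem_top g
    exact this
  refine ⟨isotypic σ ψ, hψ', card_sub_one_mul_finrank_isotypic_le σ ?_ ψ hψ, ?_⟩
  · intro t s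
    have e : SpecialLinearGroup.transvection h01 ((t : F) ^ 2 * s) =
        diag2n h01 (t : F) t.ne_zero * SpecialLinearGroup.transvection h01 s *
          (diag2n h01 (t : F) t.ne_zero)⁻¹ := by
      rw [eq_mul_inv_iff_mul_eq]
      apply Subtype.ext
      change (SpecialLinearGroup.transvection h01 _).1 * (diag2n h01 (t : F) t.ne_zero).1 =
        (diag2n h01 (t : F) t.ne_zero).1 * (SpecialLinearGroup.transvection h01 _).1
      rw [transvection_coe, transvection_coe, diag2n_coe]
      ext a b
      fin_cases a <;> fin_cases b <;>
        simp [Matrix.mul_apply, Fin.sum_univ_two, Matrix.one_apply, Matrix.single_apply]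
      field_simp
    change ρ.character (SpecialLinearGroup.transvection h01 ((t : F) ^ 2 * s)) =
      ρ.character (SpecialLinearGroup.transvection h01 s)
    rw [e, Representation.char_conj]
  · intro f hf v hv
    rw [mem_isotypic] at hv ⊢
    intro s
    rw [hσ', ← hf, ← map_smul, ← hσ', hv s]

open Matrix in
/-- Two commuting representations of `SL₂(q)` without invariants need a space of dimension at least
`(q - 1)² / 4`. -/
theorem card_sub_one_sq_le_finrank
    (ρ τ : Representation ℂ (SpecialLinearGroup (Fin 2) F) V) (hρ : ρ.invariants = ⊥)
    (hτ : τ.invariants = ⊥) (hρτ : ∀ g h v, ρ g (τ h v) = τ h (ρ g v)) [Nontrivial V] :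
    (Fintype.card F - 1) ^ 2 ≤ 4 * finrank ℂ V := by
  obtain ⟨W, hW, hW1, hW2⟩ := exists_submodule_card_sub_one_mul_finrank_le ρ hρ
  have : Nontrivial W := Submodule.nontrivial_iff_ne_bot.2 hW
  have hW3 : ∀ g, W ≤ W.comap (τ g) := fun g v hv =>
    hW2 (τ g) (fun h v => (hρτ h g v).symm) v hv
  obtain ⟨U, hU, hU1, -⟩ := exists_submodule_card_sub_one_mul_finrank_le
    (τ.subrepresentation W hW3) (by
      refine eq_bot_iff.2 fun v hv => ?_
      rw [Representation.mem_invariants] at hv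
      have : (v : V) ∈ τ.invariants := by
        rw [Representation.mem_invariants]
        exact fun g => congrArg Subtype.val (hv g)
      rw [hτ, Submodule.mem_bot] at this
      simpa using this)
  have : Nontrivial U := Submodule.nontrivial_iff_ne_bot.2 hU
  have hU2 : 0 < finrank ℂ U := finrank_pos
  nlinarith

end Isotypic

section ConjugacyDeviation

theorem norm_apply_le_of_isStarNormal {V : Type*} [NormedAddCommGroup V] [InnerProductSpace ℂ V]
    [FiniteDimensional ℂ V] [CompleteSpace V] (T : V →L[ℂ] V) [IsStarNormal T] {δ : ℝ} (hδ : 0 ≤ δ)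
    (h : ∀ c : ℂ, c ≠ 0 → Module.End.HasEigenvalue (T : V →ₗ[ℂ] V) c → ‖c‖ ≤ δ) (v : V) :
    ‖T v‖ ≤ δ * ‖v‖ := by
  rcases subsingleton_or_nontrivial V with hV | hV
  · simp [Subsingleton.elim v 0]
  have key : ‖T‖ ≤ δ := by
    obtain ⟨z, hz, hzT⟩ := spectrum.exists_nnnorm_eq_spectralRadius T
    rw [IsStarNormal.spectralRadius_eq_nnnorm] at hzT
    have hzn : ‖z‖ = ‖T‖ := congrArg NNReal.toReal (ENNReal.coe_injective hzT)
    rw [← hzn]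
    rcases eq_or_ne z 0 with rfl | hz0
    · simpa using hδ
    refine h z hz0 ?_
    rw [Module.End.hasEigenvalue_iff_mem_spectrum]
    have := AlgEquiv.spectrum_eq (R := ℂ) (Module.End.toContinuousLinearMap V) (T : V →ₗ[ℂ] V)
    rw [← this]
    exact hz
  exact (T.le_opNorm v).trans (by gcongr)

variable {G V : Type*} [Group G] [Fintype G]

/-- The difference between the averages of a representation over a conjugacy class and over the
whole group. -/
noncomputable def conjDeviation [AddCommGroup V] [Module ℂ V] (ρ : Representation ℂ G V) (g : G) :
    V →ₗ[ℂ] V :=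
  (Fintype.card G : ℂ)⁻¹ • ∑ h, (ρ (h * g * h⁻¹) - ρ h)

theorem conjDeviation_apply [AddCommGroup V] [Module ℂ V] (ρ : Representation ℂ G V) (g : G)
    (v : V) : conjDeviation ρ g v =
      (Fintype.card G : ℂ)⁻¹ • ∑ h, (ρ (h * g * h⁻¹) v - ρ h v) := by
  simp [conjDeviation]

theorem conjDeviation_comm [AddCommGroup V] [Module ℂ V] (ρ : Representation ℂ G V) (g a : G)
    (v : V) : conjDeviation ρ g (ρ a v) = ρ a (conjDeviation ρ g v) := by
  have hm : ∀ x y (v : V), ρ x (ρ y v) = ρ (x * y) v := fun x y v => by rw [map_mul]; rfl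
  rw [conjDeviation_apply, conjDeviation_apply, map_smul, map_sum]
  congr 1
  simp only [map_sub, hm, Finset.sum_sub_distrib]
  congr 1
  · refine Fintype.sum_equiv (Equiv.mulLeft a⁻¹) _ _ fun h => ?_
    congr 2
    simp [mul_assoc]
  · refine Fintype.sum_equiv (MulAut.conj a⁻¹).toEquiv _ _ fun h => ?_
    congr 2
    simp [mul_assoc]

variable [NormedAddCommGroup V] [InnerProductSpace ℂ V] [FiniteDimensional ℂ V]

theorem norm_conjDeviation_apply_le (ρ : Representation ℂ G V) (hρ : ∀ g v, ‖ρ g v‖ = ‖v‖) (g : G)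
    {δ : ℝ} (hδ : 0 ≤ δ)
    (h : ∀ c : ℂ, c ≠ 0 → Module.End.HasEigenvalue (conjDeviation ρ g) c → ‖c‖ ≤ δ) (v : V) :
    ‖conjDeviation ρ g v‖ ≤ δ * ‖v‖ := by
  have : CompleteSpace V := FiniteDimensional.complete ℂ V
  let φ := Module.End.toContinuousLinearMap (𝕜 := ℂ) V
  have hstar : ∀ a, star (φ (ρ a)) = φ (ρ a⁻¹) := by
    intro a
    rw [ContinuousLinearMap.star_eq_adjoint, eq_comm, ContinuousLinearMap.eq_adjoint_iff]
    intro x y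
    have h1 := (LinearIsometry.mk (ρ a) (hρ a)).inner_map_map (ρ a⁻¹ x) y
    have h2 : ρ a (ρ a⁻¹ x) = x := by simp
    simp only [LinearIsometry.coe_mk, h2] at h1
    exact h1.symm
  have hcomm : ∀ a, Commute (φ (ρ a)) (φ (conjDeviation ρ g)) := fun a =>
    ContinuousLinearMap.ext fun v => (conjDeviation_comm ρ g a v).symm
  have hφ : φ (conjDeviation ρ g) =
      (Fintype.card G : ℂ)⁻¹ • ∑ h, (φ (ρ (h * g * h⁻¹)) - φ (ρ h)) := by
    simp only [conjDeviation, map_smul, map_sum, map_sub]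
  have hn : IsStarNormal (φ (conjDeviation ρ g)) := by
    constructor
    nth_rewrite 1 [hφ]
    simp only [star_smul, star_sum, star_sub, hstar]
    exact (Commute.sum_left _ _ _ fun i _ => (hcomm _).sub_left (hcomm _)).smul_left _
  exact norm_apply_le_of_isStarNormal (φ (conjDeviation ρ g)) hδ h v

section

variable {V : Type*} [AddCommGroup V] [Module ℂ V]

theorem eigenspace_conjDeviation_le_comap (ρ : Representation ℂ G V) (g : G) (c : ℂ) (a : G) :
    Module.End.eigenspace (conjDeviation ρ g) c ≤
      (Module.End.eigenspace (conjDeviation ρ g) c).comap (ρ a) := by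
  intro v hv
  rw [Submodule.mem_comap, Module.End.mem_eigenspace_iff, conjDeviation_comm,
    Module.End.mem_eigenspace_iff.1 hv, map_smul]

theorem eq_zero_of_mem_eigenspace_conjDeviation (ρ : Representation ℂ G V) (g : G) {c : ℂ}
    (hc : c ≠ 0) {v : V} (hv : v ∈ Module.End.eigenspace (conjDeviation ρ g) c)
    (hinv : ∀ a, ρ a v = v) : v = 0 := by
  have := Module.End.mem_eigenspace_iff.1 hv
  rw [conjDeviation_apply] at this
  simp only [hinv, sub_self, Finset.sum_const_zero, smul_zero] at this
  exact (smul_eq_zero.1 this.symm).resolve_left hc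

/-- The action on an eigenspace of `conjDeviation`. -/
noncomputable abbrev eigenRep (ρ : Representation ℂ G V) (g : G) (c : ℂ) :
    Representation ℂ G (Module.End.eigenspace (conjDeviation ρ g) c) :=
  ρ.subrepresentation _ (eigenspace_conjDeviation_le_comap ρ g c)

theorem invariants_eigenRep (ρ : Representation ℂ G V) (g : G) {c : ℂ} (hc : c ≠ 0) :
    (eigenRep ρ g c).invariants = ⊥ := by
  rw [eq_bot_iff]
  intro v hv
  exact Subtype.ext (eq_zero_of_mem_eigenspace_conjDeviation ρ g hc v.2
    fun a => congrArg Subtype.val (hv a))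

theorem sum_apply_eq_zero_of_mem_eigenspace (ρ : Representation ℂ G V) (g : G) {c : ℂ}
    (hc : c ≠ 0) {v : V} (hv : v ∈ Module.End.eigenspace (conjDeviation ρ g) c) :
    ∑ h, ρ h v = 0 := by
  refine eq_zero_of_mem_eigenspace_conjDeviation ρ g hc
    (Submodule.sum_mem _ fun h _ => eigenspace_conjDeviation_le_comap ρ g c h hv) fun a => ?_
  rw [map_sum]
  refine Fintype.sum_equiv (Equiv.mulLeft a) _ _ fun h => ?_
  rw [Equiv.coe_mulLeft, map_mul]
  rfl

theorem sum_conj_apply_of_mem_eigenspace (ρ : Representation ℂ G V) (g : G) {c : ℂ}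
    (hc : c ≠ 0) {v : V} (hv : v ∈ Module.End.eigenspace (conjDeviation ρ g) c) :
    ∑ h, ρ (h * g * h⁻¹) v = (Fintype.card G * c) • v := by
  have h1 := Module.End.mem_eigenspace_iff.1 hv
  rw [conjDeviation_apply, Finset.sum_sub_distrib, sum_apply_eq_zero_of_mem_eigenspace ρ g hc hv,
    sub_zero] at h1
  have hG : (Fintype.card G : ℂ) ≠ 0 := by simp
  rw [mul_smul, ← h1, smul_inv_smul₀ hG]

theorem character_eigenRep [FiniteDimensional ℂ V] (ρ : Representation ℂ G V) (g : G) {c : ℂ} (hc : c ≠ 0) :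
    (eigenRep ρ g c).character g =
      c * finrank ℂ (Module.End.eigenspace (conjDeviation ρ g) c) := by
  have hG : (Fintype.card G : ℂ) ≠ 0 := by simp
  have h1 : ∑ h, eigenRep ρ g c (h * g * h⁻¹) = (Fintype.card G * c) • LinearMap.id := by
    ext v
    simpa using sum_conj_apply_of_mem_eigenspace ρ g hc v.2
  have h2 := congrArg (LinearMap.trace ℂ _) h1
  rw [map_sum, map_smul, LinearMap.trace_id, smul_eq_mul] at h2
  have h3 : ∀ h, LinearMap.trace ℂ _ (eigenRep ρ g c (h * g * h⁻¹)) =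
      (eigenRep ρ g c).character g := fun h => (eigenRep ρ g c).char_conj g h
  simp only [h3, Finset.sum_const, Finset.card_univ, nsmul_eq_mul] at h2
  rw [mul_assoc] at h2
  exact mul_left_cancel₀ hG h2

end

end ConjugacyDeviation

section RegularRepresentation

variable {G : Type*} [Group G] [Fintype G]

/-- The left regular representation on functions. -/
noncomputable def leftReg (G : Type*) [Group G] [Fintype G] :
    Representation ℂ G (EuclideanSpace ℂ G) where
  toFun a :=
    { toFun f := WithLp.toLp 2 fun x => f (a⁻¹ * x)
      map_add' _ _ := rfl
      map_smul' _ _ := rfl }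
  map_one' := by ext; simp
  map_mul' a b := by
    refine LinearMap.ext fun f => ?_
    ext x
    change f ((a * b)⁻¹ * x) = f (b⁻¹ * (a⁻¹ * x))
    rw [mul_inv_rev, mul_assoc]

/-- The right regular representation on functions. -/
noncomputable def rightReg (G : Type*) [Group G] [Fintype G] :
    Representation ℂ G (EuclideanSpace ℂ G) where
  toFun a :=
    { toFun f := WithLp.toLp 2 fun x => f (x * a)
      map_add' _ _ := rfl
      map_smul' _ _ := rfl }
  map_one' := by ext; simp
  map_mul' a b := by
    refine LinearMap.ext fun f => ?_
    ext x
    change f (x * (a * b)) = f (x * a * b)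
    rw [mul_assoc]

theorem leftReg_apply (a x : G) (f : EuclideanSpace ℂ G) : leftReg G a f x = f (a⁻¹ * x) := rfl

theorem rightReg_apply (a x : G) (f : EuclideanSpace ℂ G) : rightReg G a f x = f (x * a) := rfl

theorem leftReg_rightReg_comm (a b : G) (f : EuclideanSpace ℂ G) :
    leftReg G a (rightReg G b f) = rightReg G b (leftReg G a f) := by
  ext x
  simp [leftReg_apply, rightReg_apply, mul_assoc]

theorem norm_leftReg (a : G) (f : EuclideanSpace ℂ G) : ‖leftReg G a f‖ = ‖f‖ := by
  rw [EuclideanSpace.norm_eq, EuclideanSpace.norm_eq]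
  congr 1
  exact Fintype.sum_equiv (Equiv.mulLeft a⁻¹) _ _ fun x => rfl

variable [DecidableEq G]

/-- The indicator function of a finset. -/
noncomputable def indicatorVec (A : Finset G) : EuclideanSpace ℂ G :=
  WithLp.toLp 2 fun x => if x ∈ A then 1 else 0

theorem norm_indicatorVec (A : Finset G) : ‖indicatorVec A‖ = √(A.card : ℝ) := by
  rw [EuclideanSpace.norm_eq]
  congr 1
  have : ∀ x, ‖indicatorVec A x‖ ^ 2 = if x ∈ A then (1 : ℝ) else 0 := by
    intro x
    by_cases h : x ∈ A <;> simp [indicatorVec, h]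
  simp [this]

theorem inner_indicatorVec (A : Finset G) (f : EuclideanSpace ℂ G) :
    inner ℂ (indicatorVec A) f = ∑ x ∈ A, f x := by
  simp [indicatorVec, PiLp.inner_apply, Finset.sum_ite_mem]

theorem abs_card_filter_sub_le (A B : Finset G) (hA : ∀ a ∈ A, ∀ h, h * a * h⁻¹ ∈ A)
    (hB : ∀ b ∈ B, ∀ h, h * b * h⁻¹ ∈ B) (g : G) {δ : ℝ} (hδ : 0 ≤ δ)
    (h : ∀ c : ℂ, c ≠ 0 → Module.End.HasEigenvalue (conjDeviation (leftReg G) g) c → ‖c‖ ≤ δ) :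
    |((A.filter fun x => x⁻¹ * g ∈ B).card : ℝ) - A.card * B.card / Fintype.card G| ≤
      δ * √(A.card * B.card : ℝ) := by
  have hG : (Fintype.card G : ℂ) ≠ 0 := by simp
  let w : EuclideanSpace ℂ G := indicatorVec (B.map (Equiv.inv G).toEmbedding)
  have hN : ∀ z, inner ℂ (indicatorVec A) (leftReg G z w) =
      ((A.filter fun x => x⁻¹ * z ∈ B).card : ℂ) := by
    intro z
    rw [inner_indicatorVec, Finset.card_filter, Nat.cast_sum]
    refine Finset.sum_congr rfl fun x _ => ?_
    have : z⁻¹ * x ∈ B.map (Equiv.inv G).toEmbedding ↔ x⁻¹ * z ∈ B := by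
      rw [Finset.mem_map_equiv]
      simp
    simp [leftReg_apply, w, indicatorVec, this]
  have hconj : ∀ k, (A.filter fun x => x⁻¹ * (k * g * k⁻¹) ∈ B).card =
      (A.filter fun x => x⁻¹ * g ∈ B).card := by
    intro k
    refine Finset.card_equiv (MulAut.conj k⁻¹).toEquiv fun x => ?_
    simp only [Finset.mem_filter, MulEquiv.coe_toEquiv, MulAut.conj_apply, inv_inv]
    refine and_congr ⟨fun hx => ?_, fun hx => ?_⟩ ⟨fun hx => ?_, fun hx => ?_⟩
    · simpa using hA _ hx k⁻¹
    · simpa [mul_assoc] using hA _ hx k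
    · simpa [mul_assoc] using hB _ hx k⁻¹
    · simpa [mul_assoc] using hB _ hx k
  have hsum : ∑ z, ((A.filter fun x => x⁻¹ * z ∈ B).card : ℂ) = A.card * B.card := by
    simp only [Finset.card_filter, Nat.cast_sum]
    rw [Finset.sum_comm, ← nsmul_eq_mul, ← Finset.sum_const]
    refine Finset.sum_congr rfl fun x _ => ?_
    refine (Fintype.sum_equiv (Equiv.mulLeft x⁻¹) _ (fun y => ((if y ∈ B then 1 else 0 : ℕ) : ℂ))
      fun _ => rfl).trans ?_
    simp
  have key : inner ℂ (indicatorVec A) (conjDeviation (leftReg G) g w) =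
      ((((A.filter fun x => x⁻¹ * g ∈ B).card : ℝ) -
        A.card * B.card / Fintype.card G : ℝ) : ℂ) := by
    rw [conjDeviation_apply, inner_smul_right, inner_sum]
    simp only [inner_sub_right, hN, hconj, Finset.sum_sub_distrib, hsum, Finset.sum_const,
      Finset.card_univ, nsmul_eq_mul]
    push_cast
    field_simp
  rw [← Real.norm_eq_abs, ← Complex.norm_real, ← key]
  refine (norm_inner_le_norm _ _).trans ?_
  have hw : ‖w‖ = √(B.card : ℝ) := by rw [norm_indicatorVec, Finset.card_map]
  have := norm_conjDeviation_apply_le (leftReg G) norm_leftReg g hδ h w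
  rw [norm_indicatorVec, Real.sqrt_mul (by positivity), ← hw]
  nlinarith [Real.sqrt_nonneg (A.card : ℝ)]

end RegularRepresentation

section DegreeBound

variable {G : Type*} [Group G] [Fintype G]

open Classical in
theorem norm_sq_mul_finrank_eigenspace_le (g : G) {c : ℂ} (hc : c ≠ 0) {K : ℝ}
    (hK : ∀ z, ((Finset.univ.filter fun h => h * g * h⁻¹ = z).card : ℝ) ≤ K) :
    ‖c‖ ^ 2 * finrank ℂ (Module.End.eigenspace (conjDeviation (leftReg G) g) c) ≤ K := by
  set E := Module.End.eigenspace (conjDeviation (leftReg G) g) c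
  have hG : (0 : ℝ) < Fintype.card G := by exact_mod_cast Fintype.card_pos
  have hG' : (Fintype.card G : ℂ) ≠ 0 := by exact_mod_cast hG.ne'
  let b := stdOrthonormalBasis ℂ E
  let v : Fin (finrank ℂ E) → EuclideanSpace ℂ G := fun i => (b i : EuclideanSpace ℂ G)
  have hv : Orthonormal ℂ v := b.orthonormal.comp_linearIsometry E.subtypeₗᵢ
  let m : G → EuclideanSpace ℂ G := fun x =>
    (Fintype.card G : ℂ)⁻¹ • ∑ h : G, EuclideanSpace.single ((h * g * h⁻¹)⁻¹ * x) (1 : ℂ)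
  have hm : ∀ x f, inner ℂ (m x) f = (Fintype.card G : ℂ)⁻¹ * ∑ h, f ((h * g * h⁻¹)⁻¹ * x) := by
    intro x f
    simp [m, inner_smul_left, sum_inner, EuclideanSpace.inner_single_left, mul_comm]
  have hmE : ∀ x i, inner ℂ (m x) (v i) = c * v i x := by
    intro x i
    have h1 := congrArg (fun f : EuclideanSpace ℂ G => f x)
      (sum_conj_apply_of_mem_eigenspace (leftReg G) g hc (b i).2)
    simp only [WithLp.ofLp_sum, Finset.sum_apply, leftReg_apply, PiLp.smul_apply, smul_eq_mul] at h1
    rw [hm, h1, mul_assoc, inv_mul_cancel_left₀ hG']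
  have hmy : ∀ x y, ‖m x y‖ ≤ K / Fintype.card G := by
    intro x y
    have h1 : m x y = (Fintype.card G : ℂ)⁻¹ *
        ((Finset.univ.filter fun h => h * g * h⁻¹ = x * y⁻¹).card : ℂ) := by
      simp only [m, PiLp.smul_apply, WithLp.ofLp_sum, Finset.sum_apply, smul_eq_mul,
        Finset.card_filter, Nat.cast_sum, PiLp.single_apply]
      congr 1
      refine Finset.sum_congr rfl fun h _ => ?_
      have : y = (h * g * h⁻¹)⁻¹ * x ↔ h * g * h⁻¹ = x * y⁻¹ := by
        rw [eq_inv_mul_iff_mul_eq, eq_mul_inv_iff_mul_eq]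
      simp only [this, Nat.cast_ite, Nat.cast_one, Nat.cast_zero]
    rw [h1, norm_mul, norm_inv, Complex.norm_natCast, Complex.norm_natCast, div_eq_inv_mul]
    gcongr
    exact hK _
  have hnorm : ∀ x, ‖m x‖ ^ 2 ≤ K / Fintype.card G := by
    intro x
    have h1 : ‖m x‖ ^ 2 = ‖inner ℂ (m x) (m x)‖ := by
      rw [inner_self_eq_norm_sq_to_K]
      simp
    rw [h1, hm, norm_mul, norm_inv, Complex.norm_natCast, inv_mul_le_iff₀ hG]
    refine (norm_sum_le _ _).trans ((Finset.sum_le_card_nsmul _ _ _ fun h _ => hmy x _).trans ?_)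
    rw [Finset.card_univ, nsmul_eq_mul]
  have h2 : ∀ x, ∑ i, ‖c‖ ^ 2 * ‖v i x‖ ^ 2 ≤ K / Fintype.card G := by
    intro x
    refine le_trans (le_of_eq ?_) ((hv.sum_inner_products_le (m x) (s := Finset.univ)).trans
      (hnorm x))
    refine Finset.sum_congr rfl fun i _ => ?_
    rw [norm_inner_symm, hmE, norm_mul, mul_pow]
  have h3 := Finset.sum_le_card_nsmul Finset.univ _ _ fun x _ => h2 x
  rw [Finset.sum_comm, Finset.card_univ, nsmul_eq_mul, mul_div_cancel₀ _ hG.ne'] at h3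
  refine le_trans (le_of_eq ?_) h3
  have h4 : ∀ i, ∑ x, ‖c‖ ^ 2 * ‖v i x‖ ^ 2 = ‖c‖ ^ 2 := by
    intro i
    rw [← Finset.mul_sum, ← EuclideanSpace.norm_sq_eq, hv.1 i]
    simp
  simp [h4, mul_comm]

theorem eigenspace_leftReg_le_comap_rightReg (g : G) (c : ℂ) (a : G) :
    Module.End.eigenspace (conjDeviation (leftReg G) g) c ≤
      (Module.End.eigenspace (conjDeviation (leftReg G) g) c).comap (rightReg G a) := by
  intro v hv
  rw [Submodule.mem_comap, Module.End.mem_eigenspace_iff, ← map_smul,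
    ← Module.End.mem_eigenspace_iff.1 hv]
  simp only [conjDeviation_apply, leftReg_rightReg_comm, map_smul, map_sum, map_sub]

theorem rightReg_invariant_of_forall {f : EuclideanSpace ℂ G} (hf : ∀ a, rightReg G a f = f)
    (a : G) : leftReg G a f = f := by
  have h1 : ∀ x, f x = f 1 := fun x => by
    simpa [rightReg_apply] using congrArg (fun f : EuclideanSpace ℂ G => f 1) (hf x)
  ext x
  rw [leftReg_apply, h1, ← h1 x]

/-- The right regular action on an eigenspace of the left `conjDeviation`. -/
noncomputable abbrev rightEigenRep (g : G) (c : ℂ) :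
    Representation ℂ G (Module.End.eigenspace (conjDeviation (leftReg G) g) c) :=
  (rightReg G).subrepresentation _ (eigenspace_leftReg_le_comap_rightReg g c)

theorem invariants_rightEigenRep (g : G) {c : ℂ} (hc : c ≠ 0) :
    (rightEigenRep g c).invariants = ⊥ := by
  rw [eq_bot_iff]
  intro v hv
  exact Subtype.ext (eq_zero_of_mem_eigenspace_conjDeviation _ _ hc v.2
    (rightReg_invariant_of_forall fun a => congrArg Subtype.val (hv a)))

theorem eigenRep_rightEigenRep_comm (g : G) (c : ℂ) (a b : G)
    (v : Module.End.eigenspace (conjDeviation (leftReg G) g) c) :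
    eigenRep (leftReg G) g c a (rightEigenRep g c b v) =
      rightEigenRep g c b (eigenRep (leftReg G) g c a v) :=
  Subtype.ext (leftReg_rightReg_comm a b (v : EuclideanSpace ℂ G))

theorem norm_eigenRep_leftReg (g : G) (c : ℂ) (a : G)
    (v : Module.End.eigenspace (conjDeviation (leftReg G) g) c) :
    ‖eigenRep (leftReg G) g c a v‖ = ‖v‖ :=
  norm_leftReg a (v : EuclideanSpace ℂ G)

end DegreeBound

section CentralizerBound

open Matrix Matrix.SpecialLinearGroup

variable {F : Type*} [Field F] [Fintype F]

open Classical in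
theorem card_sub_one_mul_card_conj_eq_le (g z : SpecialLinearGroup (Fin 2) F)
    (hg : g ∉ Subgroup.center (SpecialLinearGroup (Fin 2) F)) :
    (Fintype.card F - 1) * (Finset.univ.filter fun h => h * g * h⁻¹ = z).card ≤
      2 * Fintype.card F ^ 2 := by
  obtain ⟨v, hv⟩ := exists_linearIndependent_of_notMem_center g hg
  set T := Finset.univ.filter fun h => h * g * h⁻¹ = z with hT
  let κ : (Fin 2 → F) → (Fin 2 → F) → F := fun a b => (Matrix.of ![a, b]).det
  have hκ : κ v (g.1 *ᵥ v) ≠ 0 := by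
    have := (Matrix.linearIndependent_rows_iff_isUnit (A := Matrix.of ![v, g.1 *ᵥ v])).1 hv
    exact ((Matrix.isUnit_iff_isUnit_det _).1 this).ne_zero
  have hκh : ∀ (h : SpecialLinearGroup (Fin 2) F) a b, κ (h.1 *ᵥ a) (h.1 *ᵥ b) = κ a b := by
    intro h a b
    have h1 := h.2
    rw [Matrix.det_fin_two] at h1
    simp only [κ, Matrix.det_fin_two, Matrix.mulVec, dotProduct, Fin.sum_univ_two, of_apply,
      cons_val_zero, cons_val_one]
    linear_combination (a 0 * b 1 - a 1 * b 0) * h1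
  have hzh : ∀ h ∈ T, ∀ u, z.1 *ᵥ (h.1 *ᵥ u) = h.1 *ᵥ (g.1 *ᵥ u) := by
    intro h hh u
    have h1 : z * h = h * g := by
      rw [← (Finset.mem_filter.1 hh).2]
      simp
    have h2 : z.1 * h.1 = h.1 * g.1 := congrArg Subtype.val h1
    rw [Matrix.mulVec_mulVec, Matrix.mulVec_mulVec, h2]
  let f : Fˣ × SpecialLinearGroup (Fin 2) F → (Fin 2 → F) := fun p => (p.1 : F) • (p.2.1 *ᵥ v)
  have hfib : ∀ w ∈ ((Finset.univ : Finset Fˣ) ×ˢ T).image f,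
      ((((Finset.univ : Finset Fˣ) ×ˢ T).filter fun p => f p = w).card) ≤ 2 := by
    intro w _
    have hsq : ∀ p ∈ ((Finset.univ : Finset Fˣ) ×ˢ T).filter (fun p => f p = w),
        (p.1 : F) ^ 2 * κ v (g.1 *ᵥ v) = κ w (z.1 *ᵥ w) := by
      intro p hp
      obtain ⟨hp1, hp2⟩ := Finset.mem_filter.1 hp
      have hpT := (Finset.mem_product.1 hp1).2
      rw [← hp2]
      simp only [f, Matrix.mulVec_smul, hzh _ hpT]
      rw [← hκh p.2 v]
      simp only [κ, Matrix.det_fin_two, of_apply, cons_val_zero, cons_val_one, Pi.smul_apply,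
        smul_eq_mul]
      ring
    rcases (((Finset.univ : Finset Fˣ) ×ˢ T).filter fun p => f p = w).eq_empty_or_nonempty with
      h0 | ⟨p₀, hp₀⟩
    · simp [h0]
    refine le_trans (Finset.card_le_card_of_injOn (t := {p₀.1, -p₀.1}) Prod.fst ?_ ?_)
      Finset.card_le_two
    · intro p hp
      have h1 := (hsq p hp).trans (hsq p₀ hp₀).symm
      have h2 := sq_eq_sq_iff_eq_or_eq_neg.1 (mul_right_cancel₀ hκ h1)
      simpa [Units.ext_iff] using h2
    · intro p hp p' hp' hpp
      obtain ⟨hp1, hp2⟩ := Finset.mem_filter.1 hp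
      obtain ⟨hp1', hp2'⟩ := Finset.mem_filter.1 hp'
      have hpT := (Finset.mem_product.1 hp1).2
      have hpT' := (Finset.mem_product.1 hp1').2
      refine Prod.ext hpp ?_
      have h1 : p.2.1 *ᵥ v = p'.2.1 *ᵥ v := by
        have h2 := hp2.trans hp2'.symm
        simp only [f] at h2
        rw [show p.1 = p'.1 from hpp] at h2
        exact smul_right_injective _ p'.1.ne_zero h2
      have h2 : p.2.1 *ᵥ (g.1 *ᵥ v) = p'.2.1 *ᵥ (g.1 *ᵥ v) := by
        rw [← hzh _ hpT, ← hzh _ hpT', h1]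
      have h3 : p.2.1 * (Matrix.of ![v, g.1 *ᵥ v])ᵀ = p'.2.1 * (Matrix.of ![v, g.1 *ᵥ v])ᵀ := by
        ext i j
        fin_cases j
        · exact congrFun h1 i
        · exact congrFun h2 i
      have hu : IsUnit (Matrix.of ![v, g.1 *ᵥ v])ᵀ := by
        rw [Matrix.isUnit_iff_isUnit_det, Matrix.det_transpose]
        exact hκ.isUnit
      exact Subtype.ext (hu.mul_right_cancel h3)
  have h1 := Finset.card_le_mul_card_image _ 2 hfib
  rw [Finset.card_product, Finset.card_univ, Fintype.card_units] at h1
  refine h1.trans (Nat.mul_le_mul_left _ ((Finset.card_le_univ _).trans ?_))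
  simp

open Classical in
theorem card_sub_one_mul_card_conj_eq_le_quotient (g : SpecialLinearGroup (Fin 2) F)
    [Fintype (ProjectiveSpecialLinearGroup (Fin 2) F)]
    (hg : g ∉ Subgroup.center (SpecialLinearGroup (Fin 2) F))
    (z : ProjectiveSpecialLinearGroup (Fin 2) F) :
    (Fintype.card F - 1) * (Finset.univ.filter fun h : ProjectiveSpecialLinearGroup (Fin 2) F =>
      h * QuotientGroup.mk g * h⁻¹ = z).card ≤ 4 * Fintype.card F ^ 2 := by
  obtain ⟨z, rfl⟩ := QuotientGroup.mk_surjective z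
  have h1 : (Finset.univ.filter fun h : ProjectiveSpecialLinearGroup (Fin 2) F =>
      h * QuotientGroup.mk g * h⁻¹ = QuotientGroup.mk z) ⊆
      ((Finset.univ.filter fun h => h * g * h⁻¹ = z) ∪
        (Finset.univ.filter fun h => h * g * h⁻¹ = -z)).image QuotientGroup.mk := by
    intro h hh
    obtain ⟨h, rfl⟩ := QuotientGroup.mk_surjective h
    refine Finset.mem_image_of_mem _ ?_
    have h2 := (Finset.mem_filter.1 hh).2
    rw [← QuotientGroup.mk_inv, ← QuotientGroup.mk_mul, ← QuotientGroup.mk_mul, eq_comm,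
      QuotientGroup.eq, Matrix.SpecialLinearGroup.mem_center_iff] at h2
    obtain ⟨r, hr, hr'⟩ := h2
    have h3 : h * g * h⁻¹ = z * (z⁻¹ * (h * g * h⁻¹)) := by group
    have h4 : (h * g * h⁻¹).1 = r • z.1 := by
      rw [h3, Matrix.SpecialLinearGroup.coe_mul z, ← hr', Matrix.scalar_apply]
      ext i j
      simp [mul_comm]
    rw [Fintype.card_fin, sq_eq_one_iff] at hr
    rw [Finset.mem_union, Finset.mem_filter, Finset.mem_filter]
    rcases hr with rfl | rfl
    · left
      exact ⟨Finset.mem_univ _, Subtype.ext (by rw [h4, one_smul])⟩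
    · right
      exact ⟨Finset.mem_univ _, Subtype.ext (by rw [h4, neg_smul, one_smul]; rfl)⟩
  have h2 := (Finset.card_le_card h1).trans (Finset.card_image_le.trans (Finset.card_union_le _ _))
  have h3 := card_sub_one_mul_card_conj_eq_le g z hg
  have h4 := card_sub_one_mul_card_conj_eq_le g (-z) hg
  refine (Nat.mul_le_mul_left _ h2).trans ?_
  rw [mul_add]
  linarith

end CentralizerBound

section ProjectiveSpecialLinear

theorem invariants_comp_of_surjective {G H V : Type*} [Group G] [Group H] [AddCommGroup V]
    [Module ℂ V] (ρ : Representation ℂ G V) (f : H →* G) (hf : Function.Surjective f) :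
    Representation.invariants (ρ.comp f) = ρ.invariants := by
  ext v
  exact ⟨fun hv a => by obtain ⟨b, rfl⟩ := hf a; exact hv b, fun hv b => hv (f b)⟩

variable {F : Type*} [Field F] [Fintype F]

theorem card_mul_norm_character_sq_le_of_submodule {ι V : Type*} [Fintype ι] [DecidableEq ι]
    (hι : 3 ≤ Fintype.card ι) [NormedAddCommGroup V] [InnerProductSpace ℂ V]
    [FiniteDimensional ℂ V] (E : Submodule ℂ V)
    (σ : Representation ℂ (Matrix.SpecialLinearGroup ι F) E) (hσ : ∀ g v, ‖σ g v‖ = ‖v‖)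
    (hE : σ.invariants = ⊥) (g : Matrix.SpecialLinearGroup ι F)
    (hg : g ∉ Subgroup.center (Matrix.SpecialLinearGroup ι F)) :
    Fintype.card F * ‖σ.character g‖ ^ 2 ≤ 5 * (finrank ℂ E : ℝ) ^ 2 :=
  card_mul_norm_character_sq_le σ hσ hE hι g hg

theorem card_mul_norm_sq_le_of_three_le {ι G : Type*} [Fintype ι] [DecidableEq ι]
    (hι : 3 ≤ Fintype.card ι) [Group G] [Fintype G] (f : Matrix.SpecialLinearGroup ι F →* G)
    (hf : Function.Surjective f) (g : Matrix.SpecialLinearGroup ι F)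
    (hg : g ∉ Subgroup.center (Matrix.SpecialLinearGroup ι F)) {c : ℂ} (hc : c ≠ 0)
    (hcg : Module.End.HasEigenvalue (conjDeviation (leftReg G) (f g)) c) :
    Fintype.card F * ‖c‖ ^ 2 ≤ 144 := by
  let σ : Representation ℂ (Matrix.SpecialLinearGroup ι F)
      (Module.End.eigenspace (conjDeviation (leftReg G) (f g)) c) :=
    (eigenRep (leftReg G) (f g) c).comp f
  have hσ : σ.invariants = ⊥ :=
    (invariants_comp_of_surjective _ f hf).trans (invariants_eigenRep _ _ hc)
  have h1 := card_mul_norm_character_sq_le_of_submodule hι _ σ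
    (fun a v => norm_eigenRep_leftReg (f g) c (f a) v) hσ g hg
  have h2 : σ.character g = (eigenRep (leftReg G) (f g) c).character (f g) := rfl
  rw [h2, character_eigenRep _ _ hc, norm_mul, Complex.norm_natCast, mul_pow, ← mul_assoc] at h1
  have h3 : 0 < finrank ℂ (Module.End.eigenspace (conjDeviation (leftReg G) (f g)) c) := by
    have := Submodule.nontrivial_iff_ne_bot.2 hcg
    exact finrank_pos
  have h4 := le_of_mul_le_mul_right h1 (by positivity)
  linarith

open Classical in
theorem card_mul_norm_sq_le_of_two {G : Type*} [Group G] [Fintype G]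
    (f : Matrix.SpecialLinearGroup (Fin 2) F →* G) (hf : Function.Surjective f) (g : G)
    {c : ℂ} (hc : c ≠ 0) (hcg : Module.End.HasEigenvalue (conjDeviation (leftReg G) g) c)
    (hcard : ∀ z, (Fintype.card F - 1) *
      (Finset.univ.filter fun h : G => h * g * h⁻¹ = z).card ≤ 4 * Fintype.card F ^ 2) :
    Fintype.card F * ‖c‖ ^ 2 ≤ 144 := by
  have := Submodule.nontrivial_iff_ne_bot.2 hcg
  have h1 := card_sub_one_sq_le_finrank ((eigenRep (leftReg G) g c).comp f)
    ((rightEigenRep g c).comp f)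
    ((invariants_comp_of_surjective _ f hf).trans (invariants_eigenRep _ _ hc))
    ((invariants_comp_of_surjective _ f hf).trans (invariants_rightEigenRep _ hc))
    (fun a b v => eigenRep_rightEigenRep_comm g c (f a) (f b) v)
  have hq : 1 < Fintype.card F := Fintype.one_lt_card
  obtain ⟨s, hs⟩ : ∃ s, Fintype.card F = s + 2 := ⟨Fintype.card F - 2, by omega⟩
  have hs1 : (0 : ℝ) < s + 1 := by positivity
  have h2 := norm_sq_mul_finrank_eigenspace_le g hc
    (K := 4 * (s + 2) ^ 2 / (s + 1)) fun z => by
      have h3 := hcard z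
      rw [hs, show s + 2 - 1 = s + 1 by omega] at h3
      rw [le_div_iff₀ hs1, mul_comm]
      exact_mod_cast h3
  rw [le_div_iff₀ hs1] at h2
  rw [hs, show s + 2 - 1 = s + 1 by omega] at h1
  rw [hs]
  have h4 : ((s : ℝ) + 1) ^ 2 ≤ 4 * finrank ℂ
      (Module.End.eigenspace (conjDeviation (leftReg G) g) c) := by
    exact_mod_cast h1
  have h5 : ‖c‖ ^ 2 * ((s : ℝ) + 1) ^ 3 ≤ 16 * (s + 2) ^ 2 := by
    have := mul_le_mul_of_nonneg_left h4 (by positivity : (0 : ℝ) ≤ ‖c‖ ^ 2 * (s + 1))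
    nlinarith
  have hs0 : (0 : ℝ) ≤ s := by positivity
  have h6 : ((s : ℝ) + 2) ^ 3 ≤ 8 * (s + 1) ^ 3 := by
    have : (s : ℝ) + 2 ≤ 2 * (s + 1) := by linarith
    calc ((s : ℝ) + 2) ^ 3 ≤ (2 * (s + 1)) ^ 3 := by gcongr
      _ = _ := by ring
  have h7 : ((s : ℝ) + 2) ^ 2 * ((s + 2) * ‖c‖ ^ 2) ≤ (s + 2) ^ 2 * 128 := by
    nlinarith [mul_le_mul_of_nonneg_left h6 (by positivity : (0 : ℝ) ≤ ‖c‖ ^ 2)]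
  have h8 := le_of_mul_le_mul_left h7 (by positivity)
  push_cast
  linarith

open Classical in
theorem abs_Pab_sub_le {G : Type*} [Group G] [Fintype G] {A B : Set G}
    (hA : ∀ a ∈ A, ∀ h, h * a * h⁻¹ ∈ A) (hB : ∀ b ∈ B, ∀ h, h * b * h⁻¹ ∈ B) {ε : ℝ} (hε : 0 < ε)
    (hAε : ε * Nat.card G ≤ A.ncard) (hBε : ε * Nat.card G ≤ B.ncard) (g : G) {δ : ℝ} (hδ : 0 ≤ δ)
    (h : ∀ c : ℂ, c ≠ 0 → Module.End.HasEigenvalue (conjDeviation (leftReg G) g) c → ‖c‖ ≤ δ) :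
    |Pab A B g - 1 / Nat.card G| ≤ δ / ε * (1 / Nat.card G) := by
  have key := abs_card_filter_sub_le A.toFinset B.toFinset (by simpa using hA) (by simpa using hB)
    g hδ h
  rw [← Set.ncard_eq_toFinset_card', ← Set.ncard_eq_toFinset_card',
    ← Nat.card_eq_fintype_card] at key
  have hN : ({p : G × G | p.1 ∈ A ∧ p.2 ∈ B ∧ p.1 * p.2 = g}).ncard =
      (A.toFinset.filter fun x => x⁻¹ * g ∈ B.toFinset).card := by
    rw [Set.ncard_eq_toFinset_card']
    refine Finset.card_nbij' Prod.fst (fun x => (x, x⁻¹ * g)) ?_ ?_ ?_ ?_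
    · rintro ⟨a, b⟩ hab
      simp only [Finset.mem_coe, Set.mem_toFinset, Set.mem_ofPred_eq] at hab
      obtain ⟨ha, hb, rfl⟩ := hab
      simp [ha, hb]
    · intro x hx
      simpa using hx
    · rintro ⟨a, b⟩ hab
      simp only [Finset.mem_coe, Set.mem_toFinset, Set.mem_ofPred_eq] at hab
      obtain ⟨ha, hb, rfl⟩ := hab
      simp
    · intro x hx
      rfl
  rw [Pab, hN]
  have hG : (0 : ℝ) < Nat.card G := by exact_mod_cast Nat.card_pos
  have hεG : 0 < ε * Nat.card G := by positivity
  have ha : (0 : ℝ) < A.ncard := hεG.trans_le hAε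
  have hb : (0 : ℝ) < B.ncard := hεG.trans_le hBε
  set N : ℝ := ((A.toFinset.filter fun x => x⁻¹ * g ∈ B.toFinset).card : ℝ)
  have hab : ε * Nat.card G ≤ √(A.ncard * B.ncard : ℝ) := by
    refine Real.le_sqrt_of_sq_le ?_
    rw [sq]
    gcongr
  have hs := Real.mul_self_sqrt (mul_pos ha hb).le
  have hs0 := hεG.trans_le hab
  set s := √(A.ncard * B.ncard : ℝ)
  rw [show N / ((A.ncard : ℝ) * B.ncard) - 1 / Nat.card G =
    (N - A.ncard * B.ncard / Nat.card G) / ((A.ncard : ℝ) * B.ncard) by field_simp,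
    abs_div, abs_of_pos (mul_pos ha hb), div_le_iff₀ (mul_pos ha hb)]
  refine key.trans ?_
  rw [← hs, show δ / ε * (1 / Nat.card G) * (s * s) = (δ * s) * (s / (ε * Nat.card G)) by
    field_simp]
  exact le_mul_of_one_le_right (by positivity) ((one_le_div hεG).2 hab)

end ProjectiveSpecialLinear

theorem stmt12 :
    ∃ C : ℝ, 0 < C ∧
      ∀ ε : ℝ, 0 < ε →
      ∀ (n q : ℕ), 2 ≤ n → IsPrimePow q → ¬(n = 2 ∧ (q = 2 ∨ q = 3)) →
      ∀ (F : Type) [Field F] [Fintype F], Fintype.card F = q →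
      ∀ (A B : Set (Matrix.ProjectiveSpecialLinearGroup (Fin n) F)),
        (∀ a ∈ A, ∀ g, g * a * g⁻¹ ∈ A) →
        (∀ b ∈ B, ∀ g, g * b * g⁻¹ ∈ B) →
        (A.ncard : ℝ) ≥ ε * (Nat.card (Matrix.ProjectiveSpecialLinearGroup (Fin n) F) : ℝ) →
        (B.ncard : ℝ) ≥ ε * (Nat.card (Matrix.ProjectiveSpecialLinearGroup (Fin n) F) : ℝ) →
        ∀ g : Matrix.ProjectiveSpecialLinearGroup (Fin n) F, g ≠ 1 →
          |Pab A B g - 1 / (Nat.card (Matrix.ProjectiveSpecialLinearGroup (Fin n) F) : ℝ)| ≤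
            C / (ε * Real.sqrt (q : ℝ)) *
              (1 / (Nat.card (Matrix.ProjectiveSpecialLinearGroup (Fin n) F) : ℝ)) := by
  classical
  refine ⟨12, by norm_num, ?_⟩
  intro ε hε n q hn _ _ F _ _ hF A B hA hB hAε hBε g hg
  have : Fintype (Matrix.ProjectiveSpecialLinearGroup (Fin n) F) := Fintype.ofFinite _
  have hq : (0 : ℝ) < √(q : ℝ) := by
    rw [← hF]
    exact Real.sqrt_pos.2 (by exact_mod_cast Fintype.card_pos)
  rw [show 12 / (ε * √(q : ℝ)) = 12 / √(q : ℝ) / ε by rw [div_div, mul_comm]]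
  refine abs_Pab_sub_le hA hB hε hAε hBε g (by positivity) fun c hc hcg => ?_
  obtain ⟨g, rfl⟩ := QuotientGroup.mk_surjective g
  have hg' : g ∉ Subgroup.center (Matrix.SpecialLinearGroup (Fin n) F) :=
    fun h => hg ((QuotientGroup.eq_one_iff g).2 h)
  have h1 : Fintype.card F * ‖c‖ ^ 2 ≤ 144 := by
    rcases hn.eq_or_lt with rfl | hn
    · exact card_mul_norm_sq_le_of_two _ (QuotientGroup.mk'_surjective _) _ hc hcg
        fun z => by convert card_sub_one_mul_card_conj_eq_le_quotient g hg' z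
    · exact card_mul_norm_sq_le_of_three_le (by rw [Fintype.card_fin]; exact hn) _
        (QuotientGroup.mk'_surjective _) g hg' hc hcg
  rw [le_div_iff₀ hq]
  refine le_of_sq_le_sq ?_ (by norm_num)
  rw [mul_pow, Real.sq_sqrt (by positivity), ← hF]
  linarith
end

section
/- There exists a constant c > 0 such that for every n ≥ 2 and every prime power q with (n,q) ∉ {(2,2),(2,3)}, the following holds for G = PSL_n(𝔽_q): if A is a normal subset of G containing at least one nonidentity element and B is a nonempty subset of G, then |AB| ≥ |G|/2 or |AB| ≥ c·q·|B|. -/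
open scoped Pointwise

section Mean

variable {ι κ V : Type*} [NormedAddCommGroup V] [InnerProductSpace ℝ V]

/-- The average of a finite family of vectors. -/
noncomputable def mean (f : ι → V) : V := (Nat.card ι : ℝ)⁻¹ • ∑ᶠ i, f i

lemma mean_eq_sum [Fintype ι] (f : ι → V) : mean f = (Fintype.card ι : ℝ)⁻¹ • ∑ i, f i := by
  rw [mean, finsum_eq_sum_of_fintype, Nat.card_eq_fintype_card]

lemma mean_equiv (e : ι ≃ κ) (f : κ → V) : mean (fun i => f (e i)) = mean f := by
  simp only [mean, Nat.card_congr e, finsum_comp_equiv e]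

variable [Finite ι] [Finite κ]

lemma mean_prod (f : ι → κ → V) : mean (fun t : ι × κ => f t.1 t.2) = mean fun i => mean (f i) := by
  have := Fintype.ofFinite ι
  have := Fintype.ofFinite κ
  simp only [mean_eq_sum, Fintype.card_prod, Nat.cast_mul, mul_inv, Fintype.sum_prod_type,
    ← Finset.smul_sum, smul_smul]

lemma mean_comm (f : ι → κ → V) : mean (fun i => mean (f i)) = mean fun k => mean fun i => f i k := by
  rw [← mean_prod, ← mean_prod fun k i => f i k]
  exact mean_equiv (Equiv.prodComm ι κ) fun t => f t.2 t.1

lemma mean_const [Nonempty ι] (v : V) : mean (fun _ : ι => v) = v := by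
  have := Fintype.ofFinite ι
  simp [mean_eq_sum, ← Nat.cast_smul_eq_nsmul ℝ, smul_smul]

lemma map_mean {W : Type*} [NormedAddCommGroup W] [InnerProductSpace ℝ W] (L : V →ₗ[ℝ] W)
    (f : ι → V) : L (mean f) = mean fun i => L (f i) := by
  have := Fintype.ofFinite ι
  simp [mean_eq_sum]

lemma mean_inner (f : ι → V) (v : V) : inner ℝ (mean f) v = mean fun i => inner ℝ (f i) v := by
  have := Fintype.ofFinite ι
  simp [mean_eq_sum, inner_smul_left, sum_inner]

lemma inner_mean (f : ι → V) (v : V) : inner ℝ v (mean f) = mean fun i => inner ℝ v (f i) := by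
  have := Fintype.ofFinite ι
  simp [mean_eq_sum, inner_smul_right, inner_sum]

lemma mean_add (f g : ι → V) : mean (fun i => f i + g i) = mean f + mean g := by
  have := Fintype.ofFinite ι
  simp [mean_eq_sum, Finset.sum_add_distrib]

lemma mean_sub (f g : ι → V) : mean (fun i => f i - g i) = mean f - mean g := by
  have := Fintype.ofFinite ι
  simp [mean_eq_sum, Finset.sum_sub_distrib, smul_sub]

lemma mean_mul_const (f : ι → ℝ) (c : ℝ) : mean (fun i => f i * c) = mean f * c := by
  have := Fintype.ofFinite ι
  simp [mean_eq_sum, ← Finset.sum_mul, mul_assoc]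

lemma mean_le_mean {f g : ι → ℝ} (h : ∀ i, f i ≤ g i) : mean f ≤ mean g := by
  have := Fintype.ofFinite ι
  simp only [mean_eq_sum]
  exact mul_le_mul_of_nonneg_left (Finset.sum_le_sum fun i _ => h i) (by positivity)

lemma norm_mean_sq_le (f : ι → V) : ‖mean f‖ ^ 2 ≤ mean fun i => ‖f i‖ ^ 2 := by
  rcases isEmpty_or_nonempty ι with h | h
  · simp [mean]
  have h0 : 0 ≤ mean fun i => ‖f i - mean f‖ ^ 2 :=
    (mean_const (ι := ι) (0 : ℝ)).symm.le.trans (mean_le_mean fun i => by positivity)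
  have h1 : (mean fun i => ‖f i - mean f‖ ^ 2) + ‖mean f‖ ^ 2 = mean fun i => ‖f i‖ ^ 2 := by
    have h2 : ∀ i, ‖f i - mean f‖ ^ 2 = ‖f i‖ ^ 2 + (inner ℝ (f i) (mean f) * (-2) + ‖mean f‖ ^ 2) := by
      intro i; rw [norm_sub_sq_real]; ring
    simp only [h2, mean_add, mean_mul_const, mean_const, ← mean_inner, real_inner_self_eq_norm_sq]
    ring
  linarith

end Mean

section Representation

variable {S V : Type*} [Group S] [NormedAddCommGroup V] [InnerProductSpace ℝ V]
  (ρ : S →* V →ₗ[ℝ] V)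

/-- The average of the orbit of a vector under a subgroup. -/
noncomputable def subgroupMean (D : Subgroup S) (v : V) : V := mean fun d : D => ρ d v

variable {ρ}

lemma rho_mul_apply (g h : S) (v : V) : ρ (g * h) v = ρ g (ρ h v) := by simp

lemma norm_rho (hρ : ∀ g v w, inner ℝ (ρ g v) (ρ g w) = inner ℝ v w) (g : S) (v : V) :
    ‖ρ g v‖ = ‖v‖ := by
  rw [← sq_eq_sq₀ (norm_nonneg _) (norm_nonneg _), ← real_inner_self_eq_norm_sq, hρ,
    real_inner_self_eq_norm_sq]

lemma inner_rho (hρ : ∀ g v w, inner ℝ (ρ g v) (ρ g w) = inner ℝ v w) (g : S) (v w : V) :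
    inner ℝ (ρ g v) w = inner ℝ v (ρ g⁻¹ w) := by
  rw [← hρ g⁻¹, ← rho_mul_apply]; simp

lemma subgroupMean_rho {D : Subgroup S} {d : S} (hd : d ∈ D) (v : V) :
    subgroupMean ρ D (ρ d v) = subgroupMean ρ D v := by
  simp only [subgroupMean, ← rho_mul_apply]
  exact mean_equiv (Equiv.mulRight (⟨d, hd⟩ : D)) fun x : D => ρ x v

variable (ρ) in
/-- The mean matrix coefficient of `x` along the orbit of a vector. -/
noncomputable def orbitCoeff (x : S) (v : V) : ℝ :=
  mean fun g : S => inner ℝ (ρ x (ρ g v)) (ρ g v)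

lemma orbitCoeff_conj (hρ : ∀ g v w, inner ℝ (ρ g v) (ρ g w) = inner ℝ v w) (x d : S) (v : V) :
    orbitCoeff ρ (d * x * d⁻¹) v = orbitCoeff ρ x v := by
  simp only [orbitCoeff]
  rw [← mean_equiv (Equiv.mulLeft d)]
  congr 1; ext g
  rw [Equiv.coe_mulLeft, rho_mul_apply d g, ← hρ d (ρ x (ρ g v))]
  simp only [← rho_mul_apply]
  congr 3; group

variable [Finite S]

lemma rho_subgroupMean {D : Subgroup S} {d : S} (hd : d ∈ D) (v : V) :
    ρ d (subgroupMean ρ D v) = subgroupMean ρ D v := by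
  simp only [subgroupMean, map_mean, ← rho_mul_apply]
  exact mean_equiv (Equiv.mulLeft (⟨d, hd⟩ : D)) fun x : D => ρ x v

lemma subgroupMean_of_fixed {D : Subgroup S} {v : V} (h : ∀ d ∈ D, ρ d v = v) :
    subgroupMean ρ D v = v := by
  rw [subgroupMean]
  simp only [h _ (Subtype.property _), mean_const]

lemma inner_subgroupMean (hρ : ∀ g v w, inner ℝ (ρ g v) (ρ g w) = inner ℝ v w) (D : Subgroup S)
    (v w : V) : inner ℝ (subgroupMean ρ D v) w = inner ℝ v (subgroupMean ρ D w) := by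
  simp only [subgroupMean, mean_inner, inner_mean, inner_rho hρ]
  exact mean_equiv (Equiv.inv D) fun x : D => inner ℝ v (ρ x w)

lemma subgroupMean_idem (D : Subgroup S) (v : V) :
    subgroupMean ρ D (subgroupMean ρ D v) = subgroupMean ρ D v :=
  subgroupMean_of_fixed fun _ hd => rho_subgroupMean hd v

lemma inner_subgroupMean_self (hρ : ∀ g v w, inner ℝ (ρ g v) (ρ g w) = inner ℝ v w)
    (D : Subgroup S) (v : V) : inner ℝ (subgroupMean ρ D v) v = ‖subgroupMean ρ D v‖ ^ 2 := by
  rw [← real_inner_self_eq_norm_sq, ← inner_subgroupMean hρ, subgroupMean_idem]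

lemma subgroupMean_sub (D : Subgroup S) (v w : V) :
    subgroupMean ρ D (v - w) = subgroupMean ρ D v - subgroupMean ρ D w := by
  simp [subgroupMean, mean_sub]

lemma subgroupMean_add (D : Subgroup S) (v w : V) :
    subgroupMean ρ D (v + w) = subgroupMean ρ D v + subgroupMean ρ D w := by
  simp [subgroupMean, mean_add]

variable (ρ) in
/-- The average over `d ∈ D` of the projections to the vectors fixed by `d⁻¹ E d`. -/
noncomputable def conjMean (D E : Subgroup S) (v : V) : V :=
  mean fun d : D => ρ (d : S)⁻¹ (subgroupMean ρ E (ρ d v))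

lemma conjMean_rho (D E : Subgroup S) {d : S} (hd : d ∈ D) (v : V) :
    conjMean ρ D E (ρ d v) = ρ d (conjMean ρ D E v) := by
  simp only [conjMean, map_mean, ← rho_mul_apply]
  rw [← mean_equiv (Equiv.mulRight (⟨d, hd⟩ : D)) fun x : D =>
    ρ (d * (x : S)⁻¹) (subgroupMean ρ E (ρ x v))]
  simp

lemma conjMean_subgroupMean {D E : Subgroup S} (hE : E ≤ D) (v : V) :
    conjMean ρ D E (subgroupMean ρ E v) = subgroupMean ρ E (conjMean ρ D E v) := by
  have hlin : ∀ (f : E → V), conjMean ρ D E (mean f) = mean fun i => conjMean ρ D E (f i) := by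
    intro f
    simp only [conjMean, subgroupMean, map_mean]
    refine Eq.trans ?_ (mean_comm _)
    congr 1; ext d
    exact mean_comm _
  rw [subgroupMean, hlin, subgroupMean]
  congr 1; ext d
  exact conjMean_rho D E (hE d.2) v

lemma inner_conjMean_self (hρ : ∀ g v w, inner ℝ (ρ g v) (ρ g w) = inner ℝ v w) 
    (D E : Subgroup S) (v : V) :
    inner ℝ (conjMean ρ D E v) v = mean fun d : D => ‖subgroupMean ρ E (ρ d v)‖ ^ 2 := by
  rw [conjMean, mean_inner]
  simp only [inner_rho hρ, inv_inv, inner_subgroupMean_self hρ]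

/-- A bound for the averaged projection on `E`-fixed vectors implies one for all vectors. -/
lemma mean_norm_subgroupMean_le (hρ : ∀ g v w, inner ℝ (ρ g v) (ρ g w) = inner ℝ v w)
    {D E : Subgroup S} (hE : E ≤ D) {ε : ℝ} (hε : 0 ≤ ε)
    (h : ∀ u, subgroupMean ρ E u = u → subgroupMean ρ D u = 0 → ‖conjMean ρ D E u‖ ≤ ε * ‖u‖)
    (v : V) :
    (mean fun d : D => ‖subgroupMean ρ E (ρ d v)‖ ^ 2) ≤
      ‖subgroupMean ρ D v‖ ^ 2 + ε * ‖v‖ ^ 2 := by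
  set p := subgroupMean ρ D v with hp
  set w := v - p with hw
  have hpw : subgroupMean ρ D w = 0 := by
    rw [hw, subgroupMean_sub, hp, subgroupMean_idem, sub_self]
  have hvw : v = p + w := by simp [hw]
  have hort : inner ℝ p w = 0 := by
    rw [hp, inner_subgroupMean hρ, hpw, inner_zero_right]
  have hnorm : ‖v‖ ^ 2 = ‖p‖ ^ 2 + ‖w‖ ^ 2 := by
    rw [hvw, norm_add_sq_real, hort]; ring
  set M := conjMean ρ D E w with hM
  have hMw : inner ℝ M w = mean fun d : D => ‖subgroupMean ρ E (ρ d w)‖ ^ 2 :=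
    inner_conjMean_self hρ D E w
  have hMM : ‖M‖ ^ 2 ≤ ε * inner ℝ M w := by
    have h1 : ‖M‖ ^ 2 = mean fun d : D =>
        inner ℝ (subgroupMean ρ E (ρ d w)) (conjMean ρ D E (subgroupMean ρ E (ρ d w))) := by
      rw [← real_inner_self_eq_norm_sq]
      nth_rw 1 [hM]
      rw [conjMean, mean_inner]
      congr 1; ext d
      rw [inner_rho hρ, inv_inv, hM, ← conjMean_rho D E d.2, conjMean_subgroupMean hE,
        ← inner_subgroupMean hρ, subgroupMean_idem]
    rw [h1, hMw, mul_comm ε, ← mean_mul_const]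
    refine mean_le_mean fun d => ?_
    refine (real_inner_le_norm _ _).trans ?_
    have h2 := h (subgroupMean ρ E (ρ d w)) (subgroupMean_idem _ _) ?_
    · nlinarith [norm_nonneg (subgroupMean ρ E (ρ d w))]
    · have h3 : ∀ y, subgroupMean ρ D (subgroupMean ρ E y) = subgroupMean ρ D y := by
        intro y
        refine ext_inner_right ℝ fun z => ?_
        rw [inner_subgroupMean hρ, inner_subgroupMean hρ, inner_subgroupMean hρ,
          subgroupMean_of_fixed fun x hx => rho_subgroupMean (hE hx) z]
      rw [h3, subgroupMean_rho d.2, hpw]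
  have hMw' : inner ℝ M w ≤ ε * ‖w‖ ^ 2 := by
    have h1 := real_inner_le_norm M w
    have h2 : ‖M‖ ≤ ε * ‖w‖ := by
      by_contra! h3
      have h4 : 0 ≤ ε * ‖w‖ := by positivity
      nlinarith [mul_le_mul_of_nonneg_left h1 hε]
    nlinarith [norm_nonneg w]
  have hsplit : (mean fun d : D => ‖subgroupMean ρ E (ρ d v)‖ ^ 2) = ‖p‖ ^ 2 + inner ℝ M w := by
    rw [hMw]
    have h1 : ∀ d : D, ‖subgroupMean ρ E (ρ d v)‖ ^ 2 =
        ‖p‖ ^ 2 + ‖subgroupMean ρ E (ρ d w)‖ ^ 2 := by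
      intro d
      have h2 : subgroupMean ρ E (ρ d v) = p + subgroupMean ρ E (ρ d w) := by
        conv_lhs => rw [hvw]
        rw [map_add, subgroupMean_add, hp, rho_subgroupMean d.2,
          subgroupMean_of_fixed fun x hx => rho_subgroupMean (hE hx) v]
      have h3 : inner ℝ p (subgroupMean ρ E (ρ d w)) = 0 := by
        rw [← inner_subgroupMean hρ, hp,
          subgroupMean_of_fixed fun x hx => rho_subgroupMean (hE hx) v, real_inner_comm,
          inner_rho hρ, rho_subgroupMean (D.inv_mem d.2), ← hp, real_inner_comm, hort]
      rw [h2, norm_add_sq_real, h3]; ring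
    simp only [h1, mean_add, mean_const]
  rw [hsplit, hnorm]
  nlinarith [sq_nonneg ‖p‖]

/-- If the products `d⁻¹ x d y` with `d ∈ D` and `x, y ∈ E` are close to uniformly distributed
in `D`, then averaging the projections to `E`-fixed vectors over conjugates by `D` nearly gives
the projection to `D`-fixed vectors. -/
lemma norm_conjMean_le (hρ : ∀ g v w, inner ℝ (ρ g v) (ρ g w) = inner ℝ v w)
    {D E : Subgroup S} (hE : E ≤ D) {δ η : ℝ} (hδ : 0 ≤ δ) (hδ1 : δ ≤ 1)
    (bad : Finset D) (hbad : (bad.card : ℝ) ≤ η * Nat.card D)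
    (hgood : ∀ g : D, g ∉ bad → (1 - δ) * (Nat.card E : ℝ) ^ 2 ≤
      Nat.card {t : D × E × E // (t.1 : S)⁻¹ * t.2.1 * t.1 * t.2.2 = g})
    (u : V) (hu : subgroupMean ρ E u = u) (huD : subgroupMean ρ D u = 0) :
    ‖conjMean ρ D E u‖ ≤ (δ + 2 * η) * ‖u‖ := by
  classical
  have := Fintype.ofFinite D
  have := Fintype.ofFinite E
  rw [Nat.card_eq_fintype_card] at hbad
  rw [Nat.card_eq_fintype_card (α := E)] at hgood
  set p : D × E × E → D := fun t => ⟨(t.1 : S)⁻¹ * t.2.1 * t.1 * t.2.2,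
    D.mul_mem (D.mul_mem (D.mul_mem (D.inv_mem t.1.2) (hE t.2.1.2)) t.1.2) (hE t.2.2.2)⟩ with hp
  set m : ℝ := ((Fintype.card (D × E × E) : ℕ) : ℝ) with hm
  have hm0 : 0 < m := by rw [hm]; exact_mod_cast Fintype.card_pos
  have hmm : m = Fintype.card D * (Fintype.card E : ℝ) ^ 2 := by
    rw [hm]; simp [Fintype.card_prod]; ring
  set N : D → ℝ := fun g => ((Finset.univ.filter fun t => p t = g).card : ℝ) with hN
  have hD0 : (0 : ℝ) < Fintype.card D := by exact_mod_cast Fintype.card_pos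
  have hfix : ∀ y ∈ E, ρ y u = u := fun y hy => by rw [← hu, rho_subgroupMean hy]
  have h1 : conjMean ρ D E u = mean fun t : D × E × E => ρ (p t) u := by
    rw [mean_prod fun d (s : E × E) => ρ (p (d, s)) u]
    have : ∀ d : D, (mean fun s : E × E => ρ (p (d, s)) u) =
        ρ (d : S)⁻¹ (subgroupMean ρ E (ρ d u)) := by
      intro d
      rw [mean_prod fun x y => ρ (p (d, (x, y))) u]
      simp only [hp, rho_mul_apply, hfix _ (Subtype.property _), mean_const, subgroupMean, map_mean]
    simp only [this, conjMean]
  have hsumN : ∑ g, N g = m := by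
    simp only [hN, hm]
    rw [← Nat.cast_sum, ← Finset.card_eq_sum_card_fiberwise (fun t _ => Finset.mem_univ _),
      Finset.card_univ]
  have h2 : conjMean ρ D E u = ∑ g : D, (N g / m) • ρ g u := by
    rw [h1, mean_eq_sum, ← Finset.sum_fiberwise (s := Finset.univ) (g := p), Finset.smul_sum]
    refine Finset.sum_congr rfl fun g _ => ?_
    rw [Finset.sum_congr rfl (g := fun _ => ρ g u), Finset.sum_const, ← Nat.cast_smul_eq_nsmul ℝ,
      smul_smul]
    · congr 1; simp only [hN, hm]; ring
    · intro t ht; rw [(Finset.mem_filter.1 ht).2]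
  have h3 : ∑ g : D, ρ g u = 0 := by
    have := huD
    rw [subgroupMean, mean_eq_sum] at this
    exact (smul_eq_zero.1 this).resolve_left (by
      simp only [inv_eq_zero, Nat.cast_eq_zero]; exact Fintype.card_ne_zero)
  set c : ℝ := (1 - δ) / Fintype.card D with hc
  have hc0 : 0 ≤ c := div_nonneg (by linarith) hD0.le
  have h5 : conjMean ρ D E u = ∑ g : D, (N g / m - c) • ρ g u := by
    simp only [sub_smul, Finset.sum_sub_distrib, ← Finset.smul_sum, h3, smul_zero, sub_zero, h2]
  rw [h5]
  refine (norm_sum_le _ _).trans ?_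
  have h6 : ∀ g : D, ‖(N g / m - c) • ρ g u‖ ≤
      (N g / m - c + 2 * c * if g ∈ bad then 1 else 0) * ‖u‖ := by
    intro g
    rw [norm_smul, norm_rho hρ]
    refine mul_le_mul_of_nonneg_right ?_ (norm_nonneg u)
    have hN0 : 0 ≤ N g / m := by positivity
    rw [Real.norm_eq_abs, abs_le]
    split_ifs with hg
    · constructor <;> linarith
    · have h7 := hgood g hg
      have h8 : (Nat.card {t : D × E × E // (t.1 : S)⁻¹ * t.2.1 * t.1 * t.2.2 = g} : ℝ) = N g := by
        rw [Nat.card_eq_fintype_card, Fintype.card_subtype]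
        simp only [hN, hp, Subtype.ext_iff]
      rw [h8] at h7
      have h9 : c ≤ N g / m := by
        rw [hc, hmm, div_le_div_iff₀ hD0 (hmm ▸ hm0)]
        nlinarith
      constructor <;> linarith
  refine (Finset.sum_le_sum fun g _ => h6 g).trans ?_
  rw [← Finset.sum_mul]
  refine mul_le_mul_of_nonneg_right ?_ (norm_nonneg u)
  have hcD : c * Fintype.card D = 1 - δ := by rw [hc]; field_simp
  have hb : c * bad.card ≤ η := by
    refine (mul_le_mul_of_nonneg_left hbad hc0).trans ?_
    have : 0 ≤ η := by
      by_contra! hη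
      have : (0 : ℝ) ≤ bad.card := by positivity
      nlinarith
    nlinarith
  rw [Finset.sum_add_distrib, Finset.sum_sub_distrib, ← Finset.sum_div, hsumN, div_self hm0.ne',
    ← Finset.mul_sum, Finset.sum_boole]
  simp only [Finset.sum_const, Finset.card_univ, nsmul_eq_mul, Finset.filter_mem_eq_inter,
    Finset.univ_inter]
  nlinarith

variable (ρ) in
/-- The mean square norm of the projections of a vector to the vectors fixed by the conjugates
of `D`. -/
noncomputable def orbitEnergy (D : Subgroup S) (v : V) : ℝ :=
  mean fun g : S => ‖subgroupMean ρ D (ρ g v)‖ ^ 2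

lemma orbitEnergy_le (hρ : ∀ g v w, inner ℝ (ρ g v) (ρ g w) = inner ℝ v w)
    {D E : Subgroup S} {ε : ℝ}
    (h : ∀ v, (mean fun d : D => ‖subgroupMean ρ E (ρ d v)‖ ^ 2) ≤
      ‖subgroupMean ρ D v‖ ^ 2 + ε * ‖v‖ ^ 2) (v : V) :
    orbitEnergy ρ E v ≤ orbitEnergy ρ D v + ε * ‖v‖ ^ 2 := by
  have h1 : orbitEnergy ρ E v =
      mean fun g : S => mean fun d : D => ‖subgroupMean ρ E (ρ d (ρ g v))‖ ^ 2 := by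
    rw [mean_comm]
    have : ∀ d : D, (mean fun g : S => ‖subgroupMean ρ E (ρ d (ρ g v))‖ ^ 2) =
        orbitEnergy ρ E v := by
      intro d
      simp only [← rho_mul_apply]
      exact mean_equiv (Equiv.mulLeft (d : S)) fun g => ‖subgroupMean ρ E (ρ g v)‖ ^ 2
    simp only [this, mean_const]
  rw [h1]
  refine (mean_le_mean fun g => h (ρ g v)).trans_eq ?_
  simp only [norm_rho hρ, mean_add, mean_const, orbitEnergy]

lemma orbitCoeff_le_norm (hρ : ∀ g v w, inner ℝ (ρ g v) (ρ g w) = inner ℝ v w) (x : S) (v : V) :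
    orbitCoeff ρ x v ≤ ‖v‖ ^ 2 := by
  refine (mean_le_mean fun g => ?_).trans_eq (mean_const (ι := S) (‖v‖ ^ 2))
  refine (real_inner_le_norm _ _).trans_eq ?_
  simp only [norm_rho hρ]; ring

/-- If conjugation by `D` spreads `x` uniformly over the coset `D x = x D`, the matrix coefficients
of `x` are controlled by the `D`-fixed vectors. -/
lemma orbitCoeff_le_orbitEnergy (hρ : ∀ g v w, inner ℝ (ρ g v) (ρ g w) = inner ℝ v w) {x : S}
    {D : Subgroup S} (hx : ∀ d ∈ D, x * d * x⁻¹ ∈ D) (e : D ≃ D)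
    (he : ∀ d : D, (e d : S) * x = d * x * (d : S)⁻¹) (v : V) :
    orbitCoeff ρ x v ≤ orbitEnergy ρ D v := by
  have h1 : ∀ w, subgroupMean ρ D (ρ x w) = subgroupMean ρ D (ρ x (subgroupMean ρ D w)) := by
    intro w
    conv_rhs => rw [subgroupMean, subgroupMean]
    simp only [map_mean]
    rw [mean_comm]
    have : ∀ k : D, (mean fun i : D => ρ i (ρ x (ρ k w))) = subgroupMean ρ D (ρ x w) := by
      intro k
      rw [← subgroupMean_rho (hx k k.2) (ρ x w), subgroupMean]
      congr 1; ext i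
      simp only [← rho_mul_apply]
      congr 3; group
    simp only [this, mean_const]
  have h2 : orbitCoeff ρ x v =
      mean fun g : S => inner ℝ (subgroupMean ρ D (ρ x (ρ g v))) (ρ g v) := by
    rw [← mean_const (ι := D) (orbitCoeff ρ x v)]
    conv_lhs => enter [1, d]; rw [← orbitCoeff_conj hρ x d, ← he, orbitCoeff]
    rw [mean_comm]
    congr 1; ext g
    rw [← mean_inner]
    congr 1
    simp only [rho_mul_apply]
    exact mean_equiv e fun d : D => ρ d (ρ x (ρ g v))
  rw [h2]
  refine mean_le_mean fun g => ?_
  rw [h1, inner_subgroupMean hρ]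
  refine (real_inner_le_norm _ _).trans_eq ?_
  rw [norm_rho hρ, sq]

/-- Cauchy-Schwarz along a subgroup, for the average over a conjugacy class. -/
lemma norm_classMean_sq_le (hρ : ∀ g v w, inner ℝ (ρ g v) (ρ g w) = inner ℝ v w)
    {K : Type*} [Group K] [Finite K] (η : K →* S) (a : S) (v : V) :
    ‖mean fun g : S => ρ (g⁻¹ * a * g) v‖ ^ 2 ≤
      mean fun k : K => orbitCoeff ρ (a⁻¹ * η k * a * (η k)⁻¹) v := by
  have h1 : (mean fun g : S => ρ (g⁻¹ * a * g) v) =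
      mean fun g : S => ρ g⁻¹ (mean fun k : K => ρ (η k * a * (η k)⁻¹) (ρ g v)) := by
    simp only [map_mean]
    rw [mean_comm, ← mean_const (ι := K) (mean fun g : S => ρ (g⁻¹ * a * g) v)]
    congr 1; ext k
    rw [← mean_equiv (Equiv.mulLeft (η k)⁻¹)]
    congr 1; ext g
    simp only [← rho_mul_apply, Equiv.coe_mulLeft]
    congr 2; group
  rw [h1]
  refine (norm_mean_sq_le _).trans_eq ?_
  have h2 : ∀ g : S, ‖ρ g⁻¹ (mean fun k : K => ρ (η k * a * (η k)⁻¹) (ρ g v))‖ ^ 2 =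
      mean fun l : K => mean fun k : K =>
        inner ℝ (ρ (η l * (a⁻¹ * η (l⁻¹ * k) * a * (η (l⁻¹ * k))⁻¹) * (η l)⁻¹) (ρ g v)) (ρ g v) := by
    intro g
    rw [norm_rho hρ, ← real_inner_self_eq_norm_sq, inner_mean]
    congr 1; ext l
    rw [mean_inner]
    congr 1; ext k
    rw [real_inner_comm, inner_rho hρ, real_inner_comm, ← rho_mul_apply, map_mul η, map_inv η]
    congr 3; group
  simp only [h2]
  rw [mean_comm]
  have h3 : ∀ l : K, (mean fun g : S => mean fun k : K =>
        inner ℝ (ρ (η l * (a⁻¹ * η (l⁻¹ * k) * a * (η (l⁻¹ * k))⁻¹) * (η l)⁻¹) (ρ g v)) (ρ g v)) =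
      mean fun k : K => orbitCoeff ρ (a⁻¹ * η k * a * (η k)⁻¹) v := by
    intro l
    rw [mean_comm, ← mean_equiv (Equiv.mulLeft l⁻¹) fun k => orbitCoeff ρ (a⁻¹ * η k * a * (η k)⁻¹) v]
    congr 1; ext k
    exact orbitCoeff_conj hρ _ (η l) v
  simp only [h3, mean_const]

end Representation

section Action

variable {S X : Type*} [Group S] [MulAction S X]

open Classical in
lemma card_transporter {D E : Subgroup S} [Fintype D] [Fintype E] {x₀ : X}
    (hE : ∀ g, g ∈ E ↔ g ∈ D ∧ g • x₀ = x₀) {x : X} (hx : ∃ d ∈ D, d • x₀ = x) :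
    (Finset.univ.filter fun d : D => (d : S) • x₀ = x).card = Fintype.card E := by
  obtain ⟨a, ha, rfl⟩ := hx
  rw [← Finset.card_univ]
  refine Finset.card_nbij' (fun d => ⟨if h : a⁻¹ * d ∈ E then a⁻¹ * d else 1, ?_⟩)
    (fun e => ⟨a * e, D.mul_mem ha ((hE _).1 e.2).1⟩) ?_ ?_ ?_ ?_
  · split_ifs with h
    exacts [h, E.one_mem]
  · intro d _; simp
  · intro e _
    simp [mul_smul, ((hE _).1 e.2).2]
  · intro d hd
    have h1 : (d : S) • x₀ = a • x₀ := by simpa using hd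
    have h2 : a⁻¹ * (d : S) ∈ E :=
      (hE _).2 ⟨D.mul_mem (D.inv_mem ha) d.2, by rw [mul_smul, h1, inv_smul_smul]⟩
    ext; simp [h2]
  · intro e _
    ext; simp

open Classical in
/-- Quantitative orbit-stabilizer bound for the elements `e ∈ E` with `g e` fixing a point. -/
lemma card_le_mul_card_fixing {D E : Subgroup S} [Fintype E] {x₀ : X}
    (hE : ∀ g, g ∈ E ↔ g ∈ D ∧ g • x₀ = x₀) {g : S} (hg : g ∈ D) {z : X}
    (hz : ∃ a ∈ D, a • z = z ∧ a • x₀ = g • x₀) {m : ℕ}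
    (hm : {y | ∃ e ∈ E, e • z = y}.ncard ≤ m) :
    Fintype.card E ≤ m * (Finset.univ.filter fun e : E => (g * e) • z = z).card := by
  obtain ⟨a, ha, haz, hax⟩ := hz
  have he₀ : g⁻¹ * a ∈ E :=
    (hE _).2 ⟨D.mul_mem (D.inv_mem hg) ha, by rw [mul_smul, hax, inv_smul_smul]⟩
  have h1 := Finset.card_le_mul_card_image (f := fun e : E => (e : S) • z) Finset.univ
    (Finset.univ.filter fun e : E => (g * e) • z = z).card ?_
  · rw [Finset.card_univ, mul_comm] at h1
    refine h1.trans (Nat.mul_le_mul_right _ (le_trans (le_of_eq ?_) hm))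
    rw [← Set.ncard_coe_finset]
    congr 1; ext y; simp
  · intro b hb
    obtain ⟨f, -, rfl⟩ := Finset.mem_image.1 hb
    refine Finset.card_le_card_of_injOn
      (fun e => ⟨g⁻¹ * a * (f : S)⁻¹ * e, E.mul_mem (E.mul_mem he₀ (E.inv_mem f.2)) e.2⟩) ?_ ?_
    · intro e he
      have h2 : (e : S) • z = (f : S) • z := by simpa using he
      simp [mul_smul, h2, haz]
    · intro e _ e' _ h
      simpa using h

variable [Finite S] {V : Type*} [NormedAddCommGroup V] [InnerProductSpace ℝ V]
  {ρ : S →* V →ₗ[ℝ] V}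

open Classical in
/-- Let `D` act transitively on `Ω` and let `E` be the stabilizer in `D` of a point. If for most
points `x` of `Ω` there are enough points fixed by some element of `D` taking the base point to `x`,
then averaging the projections to `E`-fixed vectors over `D`-conjugates nearly gives the
projection to `D`-fixed vectors. -/
lemma mean_norm_le_of_action (hρ : ∀ g v w, inner ℝ (ρ g v) (ρ g w) = inner ℝ v w)
    {D E : Subgroup S} {x₀ : X} (hE : ∀ g, g ∈ E ↔ g ∈ D ∧ g • x₀ = x₀) (Ω B : Finset X)
    (hΩ : ∀ d ∈ D, d • x₀ ∈ Ω) (htrans : ∀ x ∈ Ω, ∃ d ∈ D, d • x₀ = x) {δ η : ℝ}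
    (hδ : 0 ≤ δ) (hδ1 : δ ≤ 1) (hη : 0 ≤ η) (hBΩ : B ⊆ Ω) (hB : (B.card : ℝ) ≤ η * Ω.card)
    (m : ℕ) (hm0 : 0 < m)
    (hgood : ∀ x ∈ Ω, x ∉ B → ∃ Y ⊆ Ω, (1 - δ) * m ≤ (Y.card : ℝ) ∧ ∀ z ∈ Y,
      (∃ a ∈ D, a • z = z ∧ a • x₀ = x) ∧ {y | ∃ e ∈ E, e • z = y}.ncard ≤ m) (v : V) :
    (mean fun d : D => ‖subgroupMean ρ E (ρ d v)‖ ^ 2) ≤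
      ‖subgroupMean ρ D v‖ ^ 2 + (δ + 2 * η) * ‖v‖ ^ 2 := by
  have := Fintype.ofFinite D
  have := Fintype.ofFinite E
  have hED : E ≤ D := fun g hg => ((hE g).1 hg).1
  have hcount : ∀ Y ⊆ Ω, (Finset.univ.filter fun d : D => (d : S) • x₀ ∈ Y).card =
      Y.card * Fintype.card E := by
    intro Y hY
    rw [Finset.card_eq_sum_card_fiberwise (f := fun d : D => (d : S) • x₀) (t := Y)
      (fun d hd => by simpa using hd), ← smul_eq_mul, ← Finset.sum_const]
    refine Finset.sum_congr rfl fun y hy => ?_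
    rw [← card_transporter hE (htrans y (hY hy)), Finset.filter_filter]
    congr 1; ext d
    simp only [Finset.mem_filter, Finset.mem_univ, true_and]
    exact ⟨fun h => h.2, fun h => ⟨h ▸ hy, h⟩⟩
  have hcountinv : ∀ Y ⊆ Ω, (Finset.univ.filter fun d : D => (d : S)⁻¹ • x₀ ∈ Y).card =
      Y.card * Fintype.card E := by
    intro Y hY
    rw [← hcount Y hY]
    exact Finset.card_equiv (Equiv.inv D) (by simp)
  have hD : Fintype.card D = Ω.card * Fintype.card E := by
    rw [← hcount Ω subset_rfl, Finset.filter_true_of_mem (fun (d : D) _ => hΩ d d.2), Finset.card_univ]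
  refine mean_norm_subgroupMean_le hρ hED (by positivity) (fun u hu huD =>
    norm_conjMean_le hρ hED hδ hδ1 (Finset.univ.filter fun d : D => (d : S) • x₀ ∈ B) ?_ ?_
      u hu huD) v
  · rw [hcount B hBΩ, Nat.card_eq_fintype_card, hD]
    push_cast
    nlinarith [mul_le_mul_of_nonneg_right hB (Nat.cast_nonneg (α := ℝ) (Fintype.card E))]
  · intro g hg
    obtain ⟨Y, hYΩ, hYm, hY⟩ := hgood ((g : S) • x₀) (hΩ g g.2) (by simpa using hg)
    set R : Finset (D × E) := Finset.univ.filter fun t =>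
      ((g : S) * t.2) • (t.1 : S)⁻¹ • x₀ = (t.1 : S)⁻¹ • x₀ with hR
    set T := Finset.univ.filter fun d : D => (d : S)⁻¹ • x₀ ∈ Y with hT
    have h1 : Y.card * Fintype.card E * Fintype.card E ≤ m * R.card := by
      calc Y.card * Fintype.card E * Fintype.card E = ∑ _d ∈ T, Fintype.card E := by
            rw [Finset.sum_const, smul_eq_mul, hT, hcountinv Y hYΩ]
        _ ≤ ∑ d ∈ T, m * (R.filter fun t => t.1 = d).card := by
            refine Finset.sum_le_sum fun d hd => ?_
            obtain ⟨h2, h3⟩ := hY _ (Finset.mem_filter.1 hd).2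
            refine (card_le_mul_card_fixing hE g.2 h2 h3).trans (Nat.mul_le_mul_left _ ?_)
            refine Finset.card_le_card_of_injOn (fun e => (d, e)) ?_ ?_
            · intro e he
              simpa [hR] using he
            · intro e _ e' _ h
              simpa using h
        _ ≤ m * R.card := by
            rw [← Finset.mul_sum]
            refine Nat.mul_le_mul_left _ ?_
            rw [← Finset.card_biUnion]
            · exact Finset.card_le_card (by intro t ht; simp at ht; exact ht.2)
            · intro d _ d' _ hdd
              refine Finset.disjoint_left.2 fun t ht ht' => hdd ?_
              rw [← (Finset.mem_filter.1 ht).2, (Finset.mem_filter.1 ht').2]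
    have h2 : R.card ≤ Nat.card {t : D × E × E // (t.1 : S)⁻¹ * t.2.1 * t.1 * t.2.2 = g} := by
      have hmem : ∀ t : R, (t.1.1 : S) * (g * t.1.2) * (t.1.1 : S)⁻¹ ∈ E := by
        intro t
        have h3 := (Finset.mem_filter.1 t.2).2
        refine (hE _).2 ⟨D.mul_mem (D.mul_mem t.1.1.2 (D.mul_mem g.2 (hED t.1.2.2)))
          (D.inv_mem t.1.1.2), ?_⟩
        rw [mul_smul, mul_smul, h3, smul_inv_smul]
      rw [← Nat.card_eq_finsetCard]
      refine Nat.card_le_card_of_injective (fun t : R =>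
        ⟨(t.1.1, ⟨_, hmem t⟩, t.1.2⁻¹), by simp [mul_assoc]⟩) ?_
      intro t t' h
      simp only [Subtype.mk.injEq, Prod.mk.injEq, inv_inj] at h
      exact Subtype.ext (Prod.ext h.1 h.2.2)
    have h3 : (1 - δ) * (m : ℝ) * Fintype.card E ^ 2 ≤ m * R.card := by
      have h4 : (Y.card : ℝ) * Fintype.card E * Fintype.card E ≤ m * R.card := by exact_mod_cast h1
      nlinarith [mul_le_mul_of_nonneg_right hYm (sq_nonneg (Fintype.card E : ℝ))]
    have hm0' : (0 : ℝ) < m := by exact_mod_cast hm0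
    have h5 : (1 - δ) * (Fintype.card E : ℝ) ^ 2 ≤ R.card := by
      refine le_of_mul_le_mul_left ?_ hm0'
      linarith
    rw [Nat.card_eq_fintype_card (α := E)]
    exact h5.trans (by exact_mod_cast h2)

end Action

section Linear

open Matrix

variable {ι F : Type*} [Fintype ι] [Field F]

lemma mem_sup_span_singleton_iff {M : Type*} [AddCommGroup M] [Module F M] {p : Submodule F M}
    {x y : M} : x ∈ p ⊔ Submodule.span F {y} ↔ ∃ t : F, x - t • y ∈ p := by
  simp only [Submodule.mem_sup, Submodule.mem_span_singleton]
  constructor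
  · rintro ⟨w, hw, _, ⟨t, rfl⟩, rfl⟩
    exact ⟨t, by simpa using hw⟩
  · rintro ⟨t, ht⟩
    exact ⟨_, ht, _, ⟨t, rfl⟩, by simp⟩

lemma mem_sup_span_singleton_exchange {M : Type*} [AddCommGroup M] [Module F M]
    {p : Submodule F M} {x y : M} (hx : x ∉ p) (h : x ∈ p ⊔ Submodule.span F {y}) :
    y ∈ p ⊔ Submodule.span F {x} := by
  obtain ⟨t, ht⟩ := mem_sup_span_singleton_iff.1 h
  have ht0 : t ≠ 0 := by
    rintro rfl
    exact hx (by simpa using ht)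
  refine mem_sup_span_singleton_iff.2 ⟨t⁻¹, ?_⟩
  have h1 := p.smul_mem (-t⁻¹) ht
  rw [smul_sub, smul_smul, neg_mul, inv_mul_cancel₀ ht0] at h1
  convert h1 using 1
  module

lemma exists_notMem_of_finrank_lt {W : Submodule F (ι → F)}
    (hW : Module.finrank F W < Fintype.card ι) : ∃ x, x ∉ W := by
  by_contra! h
  rw [(Submodule.eq_top_iff'.2 h : W = ⊤), finrank_top, Module.finrank_fintype_fun_eq_card] at hW
  exact hW.false

lemma sup_span_singleton_eq_top {W : Submodule F (ι → F)}
    (hW : Module.finrank F W + 1 = Fintype.card ι) {x : ι → F} (hx : x ∉ W) :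
    W ⊔ Submodule.span F {x} = ⊤ := by
  apply Submodule.eq_top_of_finrank_eq
  rw [Submodule.finrank_sup_span_singleton hx, hW, Module.finrank_fintype_fun_eq_card]

variable [DecidableEq ι]

lemma exists_dotProduct_eq_one {W : Submodule F (ι → F)} {x : ι → F} (hx : x ∉ W) :
    ∃ φ : ι → F, φ ⬝ᵥ x = 1 ∧ ∀ w ∈ W, φ ⬝ᵥ w = 0 := by
  obtain ⟨f, hf, hW⟩ := Submodule.exists_le_ker_of_notMem hx
  have h : ∀ w, (dotProductEquiv F ι).symm f ⬝ᵥ w = f w := fun w =>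
    congrArg (fun g => g w) ((dotProductEquiv F ι).apply_symm_apply f)
  refine ⟨(f x)⁻¹ • (dotProductEquiv F ι).symm f, ?_, fun w hw => ?_⟩
  · rw [smul_dotProduct, h, smul_eq_mul, inv_mul_cancel₀ hf]
  · rw [smul_dotProduct, h, LinearMap.mem_ker.1 (hW hw), smul_zero]

lemma det_one_add_vecMulVec_eq (u φ : ι → F) : (1 + vecMulVec u φ).det = 1 + φ ⬝ᵥ u := by
  rw [vecMulVec_eq Unit, det_one_add_replicateCol_mul_replicateRow]

lemma one_add_vecMulVec_mulVec (u φ w : ι → F) :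
    (1 + vecMulVec u φ) *ᵥ w = w + (φ ⬝ᵥ w) • u := by
  rw [add_mulVec, one_mulVec, vecMulVec_mulVec, op_smul_eq_smul]

/-- The transvection `w ↦ w + φ(w) u`. -/
def slTransvection (u φ : ι → F) (h : φ ⬝ᵥ u = 0) : SpecialLinearGroup ι F :=
  ⟨1 + vecMulVec u φ, by rw [det_one_add_vecMulVec_eq, h, add_zero]⟩

lemma sl_smul_eq_mulVec (g : SpecialLinearGroup ι F) (w : ι → F) :
    g • w = (g : Matrix ι ι F) *ᵥ w := rfl

lemma slTransvection_smul (u φ : ι → F) (h : φ ⬝ᵥ u = 0) (w : ι → F) :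
    slTransvection u φ h • w = w + (φ ⬝ᵥ w) • u :=
  one_add_vecMulVec_mulVec u φ w

lemma sl_ext_smul {g h : SpecialLinearGroup ι F} (H : ∀ w : ι → F, g • w = h • w) : g = h :=
  Subtype.ext (ext_iff_mulVec.2 H)

/-- The pointwise stabilizer of a subspace in the special linear group. -/
def slFixer (W : Submodule F (ι → F)) : Subgroup (SpecialLinearGroup ι F) :=
  fixingSubgroup _ (W : Set (ι → F))

lemma mem_slFixer {W : Submodule F (ι → F)} {g : SpecialLinearGroup ι F} :
    g ∈ slFixer W ↔ ∀ w ∈ W, g • w = w := by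
  simp [slFixer, mem_fixingSubgroup_iff]

lemma mem_slFixer_sup {W : Submodule F (ι → F)} {x : ι → F} {g : SpecialLinearGroup ι F} :
    g ∈ slFixer (W ⊔ Submodule.span F {x}) ↔ g ∈ slFixer W ∧ g • x = x := by
  simp only [mem_slFixer]
  constructor
  · exact fun h => ⟨fun w hw => h w (Submodule.mem_sup_left hw),
      h x (Submodule.mem_sup_right (Submodule.mem_span_singleton_self x))⟩
  · rintro ⟨h, hx⟩ w hw
    obtain ⟨t, ht⟩ := mem_sup_span_singleton_iff.1 hw
    have h1 := h _ ht
    rw [smul_sub, smul_comm, hx] at h1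
    simpa using h1

lemma exists_mem_slFixer_of_sub_mem {W : Submodule F (ι → F)} {x y : ι → F} (hx : x ∉ W)
    (h : y - x ∈ W) : ∃ g ∈ slFixer W, g • x = y := by
  obtain ⟨φ, hφ, hW⟩ := exists_dotProduct_eq_one hx
  refine ⟨slTransvection (y - x) φ (hW _ h), mem_slFixer.2 fun w hw => ?_, ?_⟩
  · rw [slTransvection_smul, hW w hw, zero_smul, add_zero]
  · rw [slTransvection_smul, hφ, one_smul, add_sub_cancel]

lemma exists_mem_slFixer {W : Submodule F (ι → F)}
    (hW : Module.finrank F W + 2 ≤ Fintype.card ι) {x y : ι → F} (hx : x ∉ W) (hy : y ∉ W) :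
    ∃ g ∈ slFixer W, g • x = y := by
  have key : ∀ {x y : ι → F}, x ∉ W → y ∉ W ⊔ Submodule.span F {x} →
      ∃ g ∈ slFixer W, g • x = y := by
    intro x y hx hy
    have hx' : x ∉ W ⊔ Submodule.span F {y - x} := by
      intro h
      have h1 := mem_sup_span_singleton_exchange hx h
      refine hy ?_
      have h2 := add_mem h1 (Submodule.mem_sup_right (S := W) (Submodule.mem_span_singleton_self x))
      rwa [sub_add_cancel] at h2
    obtain ⟨g, hg, hgx⟩ := exists_mem_slFixer_of_sub_mem hx'
      (Submodule.mem_sup_right (Submodule.mem_span_singleton_self _))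
    exact ⟨g, (mem_slFixer_sup.1 hg).1, hgx⟩
  by_cases h : y ∈ W ⊔ Submodule.span F {x}
  · obtain ⟨z, hz⟩ := exists_notMem_of_finrank_lt (W := W ⊔ Submodule.span F {x}) (by
      rw [Submodule.finrank_sup_span_singleton hx]; omega)
    obtain ⟨g, hg, hgx⟩ := key hx hz
    obtain ⟨g', hg', hgy⟩ := key (x := z) (y := y) (fun hzW => hz (Submodule.mem_sup_left hzW)) (by
      intro h1
      have h2 := mem_sup_span_singleton_exchange hy h1
      have h3 : W ⊔ Submodule.span F {y} ≤ W ⊔ Submodule.span F {x} :=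
        sup_le le_sup_left (by rwa [Submodule.span_singleton_le_iff_mem])
      exact hz (h3 h2))
    exact ⟨g' * g, mul_mem hg' hg, by rw [mul_smul, hgx, hgy]⟩
  · exact key hx h

/-- An element of determinant one fixing a hyperplane pointwise acts trivially on the quotient. -/
lemma smul_sub_mem_of_mem_slFixer {W : Submodule F (ι → F)}
    (hW : Module.finrank F W + 1 = Fintype.card ι) {g : SpecialLinearGroup ι F}
    (hg : g ∈ slFixer W) (x : ι → F) : g • x - x ∈ W := by
  by_cases hx : x ∈ W
  · rw [mem_slFixer.1 hg x hx, sub_self]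
    exact W.zero_mem
  obtain ⟨φ, hφ, hφW⟩ := exists_dotProduct_eq_one hx
  have htop := sup_span_singleton_eq_top hW hx
  have h1 : (g : Matrix ι ι F) = 1 + vecMulVec (g • x - x) φ := by
    refine ext_iff_mulVec.2 fun w => ?_
    rw [one_add_vecMulVec_mulVec, ← sl_smul_eq_mulVec]
    obtain ⟨t, ht⟩ := mem_sup_span_singleton_iff.1 (htop ▸ Submodule.mem_top :
      w ∈ W ⊔ Submodule.span F {x})
    have h2 := mem_slFixer.1 hg _ ht
    have h3 := hφW _ ht
    rw [dotProduct_sub, dotProduct_smul, hφ, smul_eq_mul, mul_one, sub_eq_zero] at h3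
    rw [smul_sub, smul_comm, sub_eq_iff_eq_add] at h2
    rw [h2, h3]
    generalize g • x = y
    module
  have h2 := det_one_add_vecMulVec_eq (g • x - x) φ
  rw [← h1, g.det_coe, left_eq_add] at h2
  obtain ⟨t, ht⟩ := mem_sup_span_singleton_iff.1 (htop ▸ Submodule.mem_top :
      g • x - x ∈ W ⊔ Submodule.span F {x})
  have h3 := hφW _ ht
  rw [dotProduct_sub, dotProduct_smul, hφ, h2, smul_eq_mul, mul_one, zero_sub, neg_eq_zero] at h3
  simpa [h3] using ht

end Linear

lemma card_subspace {ι F : Type*} [Fintype ι] [Field F] [Fintype F] (W : Submodule F (ι → F))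
    [DecidablePred fun x => x ∈ W] [Fintype (ι → F)] :
    (Finset.univ.filter fun x => x ∈ W).card = Fintype.card F ^ Module.finrank F W := by
  rw [← Module.card_eq_pow_finrank (K := F) (V := W), Fintype.card_subtype]

lemma exists_eq_sup_span_singleton {F M : Type*} [Field F] [AddCommGroup M] [Module F M]
    [Module.Finite F M] {W : Submodule F M} {j : ℕ} (h : Module.finrank F W = j + 1) :
    ∃ (W' : Submodule F M) (x : M), Module.finrank F W' = j ∧ x ∉ W' ∧
      W = W' ⊔ Submodule.span F {x} := by
  let b := Module.finBasisOfFinrankEq F W h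
  have hb : LinearIndependent F fun i => (b i : M) :=
    b.linearIndependent.map' W.subtype W.ker_subtype
  have hspan : Submodule.span F (Set.range fun i => (b i : M)) = W := by
    have h1 := congrArg (Submodule.map W.subtype) b.span_eq
    rwa [Submodule.map_span, ← Set.range_comp, Submodule.map_top, Submodule.range_subtype] at h1
  obtain ⟨h1, h2⟩ := linearIndependent_finSucc.1 hb
  refine ⟨_, _, ?_, h2, ?_⟩
  · rw [finrank_span_eq_card h1, Fintype.card_fin]
  · refine hspan.symm.trans ?_
    rw [sup_comm, ← Submodule.span_union, Set.singleton_union, Fin.range_fin_succ]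

section Chain

variable {ι F V : Type*} [Fintype ι] [DecidableEq ι] [Field F] [Fintype F] [NormedAddCommGroup V]
  [InnerProductSpace ℝ V] {ρ : Matrix.SpecialLinearGroup ι F →* V →ₗ[ℝ] V}

open Classical in
/-- Adding one vector to a subspace of codimension at least two costs little energy. -/
lemma orbitEnergy_slFixer_sup_le (hρ : ∀ g v w, inner ℝ (ρ g v) (ρ g w) = inner ℝ v w)
    {W : Submodule F (ι → F)} {c : ℕ} (hc : 1 ≤ c)
    (hW : Module.finrank F W + 1 + c = Fintype.card ι) {x₀ : ι → F} (hx₀ : x₀ ∉ W) (v : V) :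
    orbitEnergy ρ (slFixer (W ⊔ Submodule.span F {x₀})) v ≤
      orbitEnergy ρ (slFixer W) v + 6 * (Fintype.card F : ℝ)⁻¹ ^ c * ‖v‖ ^ 2 := by
  set q := Fintype.card F with hq
  set j := Module.finrank F W with hj
  have hq2 : 2 ≤ q := Fintype.one_lt_card
  have hqR : (2 : ℝ) ≤ q := by exact_mod_cast hq2
  set r : ℝ := (q : ℝ)⁻¹ ^ c with hr
  have hr0 : 0 ≤ r := by positivity
  have hr2 : r ≤ 1 / 2 := by
    have h1 : (q : ℝ)⁻¹ ≤ 1 / 2 := by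
      rw [inv_le_comm₀ (by positivity) (by norm_num)]; linarith
    exact (pow_le_of_le_one (by positivity) (by linarith) (by omega)).trans h1
  have hrq : r * (q : ℝ) ^ (j + 1 + c) = q ^ (j + 1) := by
    rw [hr, pow_add _ (j + 1) c, mul_left_comm, ← mul_pow, inv_mul_cancel₀ (by positivity),
      one_pow, mul_one]
  have hsup : ∀ {y : ι → F}, y ∉ W →
      (Finset.univ.filter fun x => x ∈ W ⊔ Submodule.span F {y}).card = q ^ (j + 1) := by
    intro y hy
    rw [card_subspace, Submodule.finrank_sup_span_singleton hy]
  have hdiff : ∀ {y : ι → F}, y ∉ W →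
      ((Finset.univ.filter fun x => x ∈ W ⊔ Submodule.span F {y} ∧ x ∉ W).card : ℝ) =
        q ^ (j + 1) - q ^ j := by
    intro y hy
    have h1 := Finset.card_filter_add_card_filter_not
      (s := Finset.univ.filter fun x => x ∈ W ⊔ Submodule.span F {y}) (fun x => x ∈ W)
    rw [Finset.filter_filter, Finset.filter_filter, hsup hy] at h1
    have h2 : (Finset.univ.filter fun x => x ∈ W ⊔ Submodule.span F {y} ∧ x ∈ W).card = q ^ j := by
      rw [hj, ← card_subspace]
      congr 1; ext x
      simp only [Finset.mem_filter, Finset.mem_univ, true_and, and_iff_right_iff_imp]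
      exact fun hx => Submodule.mem_sup_left hx
    rw [h2] at h1
    rw [eq_sub_iff_add_eq']
    exact_mod_cast h1
  have hqj : (0 : ℝ) < q ^ j := by positivity
  have hΩcard : ((Finset.univ.filter fun x => x ∉ W).card : ℝ) = q ^ (j + 1 + c) - q ^ j := by
    have h1 := Finset.card_filter_add_card_filter_not (s := Finset.univ) (fun x => x ∈ W)
    rw [card_subspace, Finset.card_univ, Fintype.card_fun, ← hW] at h1
    rw [eq_sub_iff_add_eq']
    exact_mod_cast h1
  have h6 : 6 * r = 2 * r + 2 * (2 * r) := by ring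
  rw [h6]
  refine orbitEnergy_le hρ (fun u => mean_norm_le_of_action hρ (fun g => mem_slFixer_sup)
    (Finset.univ.filter fun x => x ∉ W)
    (Finset.univ.filter fun x => x ∈ W ⊔ Submodule.span F {x₀} ∧ x ∉ W) ?_ ?_
    (by positivity) (by linarith) (by positivity) ?_ ?_ (if c = 1 then q ^ (j + 1) else
      q ^ (j + 1 + c)) ?_ ?_ u) v
  · intro d hd
    simp only [Finset.mem_filter, Finset.mem_univ, true_and]
    intro h
    have h1 := mem_slFixer.1 (inv_mem hd) _ h
    rw [inv_smul_smul] at h1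
    exact hx₀ (h1 ▸ h)
  · intro x hx
    exact exists_mem_slFixer (by omega) hx₀ (by simpa using hx)
  · exact fun x hx => by simp at hx ⊢; exact hx.2
  · rw [hdiff hx₀, hΩcard, mul_sub, mul_assoc, hrq]
    nlinarith
  · split_ifs <;> positivity
  · intro x hxΩ hxB
    have hxW : x ∉ W := by simpa using hxΩ
    have hxW' : x ∉ W ⊔ Submodule.span F {x₀} := fun h => hxB (by simp [h, hxW])
    split_ifs with hc1
    · subst hc1
      have hsub : x - x₀ ∉ W ⊔ Submodule.span F {x₀} := fun h => hxW' (by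
        have := add_mem h (Submodule.mem_sup_right (S := W) (Submodule.mem_span_singleton_self x₀))
        rwa [sub_add_cancel] at this)
      have hsubW : x - x₀ ∉ W := fun h => hsub (Submodule.mem_sup_left h)
      refine ⟨Finset.univ.filter fun z => z ∈ W ⊔ Submodule.span F {x - x₀} ∧ z ∉ W,
        fun z hz => by simp at hz ⊢; exact hz.2, ?_, ?_⟩
      · rw [hdiff hsubW]
        push_cast
        have h1 : r * (q : ℝ) ^ (j + 1) = q ^ j := by
          rw [hr, pow_one, pow_succ', inv_mul_cancel_left₀ (by positivity)]
        nlinarith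
      · intro z hz
        obtain ⟨hz1, hzW⟩ : z ∈ W ⊔ Submodule.span F {x - x₀} ∧ z ∉ W := by simpa using hz
        have hz2 := mem_sup_span_singleton_exchange hzW hz1
        have hle : ∀ {U : Submodule F (ι → F)}, W ≤ U → z ∈ U → x - x₀ ∈ U := fun hU hzU =>
          (sup_le hU (by rwa [Submodule.span_singleton_le_iff_mem]) :
            W ⊔ Submodule.span F {z} ≤ _) hz2
        have hzW' : z ∉ W ⊔ Submodule.span F {x₀} := fun h => hsub (hle le_sup_left h)
        have hx₀z : x₀ ∉ W ⊔ Submodule.span F {z} := fun h =>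
          hzW' (mem_sup_span_singleton_exchange hx₀ h)
        obtain ⟨a, ha, hax⟩ := exists_mem_slFixer_of_sub_mem hx₀z hz2
        refine ⟨⟨a, (mem_slFixer_sup.1 ha).1, (mem_slFixer_sup.1 ha).2, hax⟩, ?_⟩
        rw [← hsup hx₀, ← Set.ncard_coe_finset]
        refine Set.ncard_le_ncard_of_injOn (fun y => y - z) ?_ ?_
        · rintro _ ⟨e, he, rfl⟩
          simp only [Finset.coe_filter, Finset.mem_univ, true_and, Set.mem_ofPred_eq]
          refine smul_sub_mem_of_mem_slFixer ?_ he z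
          rw [Submodule.finrank_sup_span_singleton hx₀, ← hW]
        · intro y _ y' _ h
          exact sub_left_injective h
    · refine ⟨Finset.univ.filter fun z => z ∉ W ⊔ Submodule.span F {x₀} ∧
        z ∉ W ⊔ Submodule.span F {x}, fun z hz => ?_, ?_, ?_⟩
      · simp only [Finset.mem_filter, Finset.mem_univ, true_and] at hz ⊢
        exact fun h => hz.1 (Submodule.mem_sup_left h)
      · have h1 := Finset.card_filter_add_card_filter_not (s := Finset.univ)
          (fun z => z ∉ W ⊔ Submodule.span F {x₀} ∧ z ∉ W ⊔ Submodule.span F {x})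
        have h2 : (Finset.univ.filter fun z => ¬(z ∉ W ⊔ Submodule.span F {x₀} ∧
            z ∉ W ⊔ Submodule.span F {x})).card ≤ q ^ (j + 1) + q ^ (j + 1) := by
          nth_rw 1 [← hsup hx₀]
          rw [← hsup hxW]
          refine (Finset.card_le_card ?_).trans (Finset.card_union_le _ _)
          intro z hz
          simp only [Finset.mem_filter, Finset.mem_univ, true_and, Finset.mem_union] at hz ⊢
          tauto
        rw [Finset.card_univ, Fintype.card_fun, ← hW, ← hq] at h1
        have h3 : q ^ (j + 1 + c) ≤ (Finset.univ.filter fun z => z ∉ W ⊔ Submodule.span F {x₀} ∧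
            z ∉ W ⊔ Submodule.span F {x}).card + (q ^ (j + 1) + q ^ (j + 1)) := by omega
        have h4 : (q : ℝ) ^ (j + 1 + c) ≤ ((Finset.univ.filter fun z =>
            z ∉ W ⊔ Submodule.span F {x₀} ∧ z ∉ W ⊔ Submodule.span F {x}).card : ℝ) +
              (q ^ (j + 1) + q ^ (j + 1)) := by exact_mod_cast h3
        push_cast
        nlinarith
      · intro z hz
        obtain ⟨hz0, hz1⟩ : z ∉ W ⊔ Submodule.span F {x₀} ∧ z ∉ W ⊔ Submodule.span F {x} := by
          simpa using hz
        have hzW : z ∉ W := fun h => hz0 (Submodule.mem_sup_left h)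
        obtain ⟨a, ha, hax⟩ := exists_mem_slFixer (W := W ⊔ Submodule.span F {z})
          (by rw [Submodule.finrank_sup_span_singleton hzW]; omega)
          (fun h => hz0 (mem_sup_span_singleton_exchange hx₀ h))
          (fun h => hz1 (mem_sup_span_singleton_exchange hxW h))
        refine ⟨⟨a, (mem_slFixer_sup.1 ha).1, (mem_slFixer_sup.1 ha).2, hax⟩, ?_⟩
        refine (Set.ncard_le_card _).trans (le_of_eq ?_)
        rw [Nat.card_eq_fintype_card, Fintype.card_fun, hW]

lemma orbitEnergy_top (v : V) : orbitEnergy ρ ⊤ v = ‖subgroupMean ρ ⊤ v‖ ^ 2 := by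
  simp only [orbitEnergy, subgroupMean_rho (Subgroup.mem_top _), mean_const]

/-- The energy of the pointwise stabilizer of a proper subspace is close to the energy of the whole
group. -/
lemma orbitEnergy_slFixer_le (hρ : ∀ g v w, inner ℝ (ρ g v) (ρ g w) = inner ℝ v w) (v : V) :
    ∀ (j c : ℕ), 1 ≤ c → j + c = Fintype.card ι → ∀ W : Submodule F (ι → F),
      Module.finrank F W = j → orbitEnergy ρ (slFixer W) v ≤
        ‖subgroupMean ρ ⊤ v‖ ^ 2 + 12 * (Fintype.card F : ℝ)⁻¹ ^ c * ‖v‖ ^ 2 := by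
  intro j
  induction j with
  | zero =>
    intro c _ _ W hW
    rw [Submodule.finrank_eq_zero] at hW
    have h1 : slFixer W = ⊤ := by
      rw [eq_top_iff]
      intro g _
      simp [mem_slFixer, hW]
    rw [h1, orbitEnergy_top]
    have : 0 ≤ 12 * (Fintype.card F : ℝ)⁻¹ ^ c * ‖v‖ ^ 2 := by positivity
    linarith
  | succ j ih =>
    intro c hc hjc W hW
    obtain ⟨W', x, hW', hx, rfl⟩ := exists_eq_sup_span_singleton hW
    have h1 := orbitEnergy_slFixer_sup_le hρ hc (by omega) hx v
    have h2 := ih (c + 1) (by omega) (by omega) W' hW'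
    have hqR : (2 : ℝ) ≤ Fintype.card F := by exact_mod_cast Fintype.one_lt_card (α := F)
    have hq : (Fintype.card F : ℝ)⁻¹ ≤ 1 / 2 := by
      rw [inv_le_comm₀ (by positivity) (by norm_num)]; linarith
    have h3 : 0 ≤ (Fintype.card F : ℝ)⁻¹ ^ c * ‖v‖ ^ 2 := by positivity
    rw [pow_succ _ c] at h2
    nlinarith

end Chain

section Hyperplane

open Matrix

variable {ι F : Type*} [Fintype ι] [DecidableEq ι] [Field F]

/-- The pointwise stabilizer of the kernel of a covector. -/
def slHyperplaneFixer (φ : ι → F) : Subgroup (SpecialLinearGroup ι F) :=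
  slFixer (LinearMap.ker (dotProductEquiv F ι φ))

lemma mem_slHyperplaneFixer {φ : ι → F} {g : SpecialLinearGroup ι F} :
    g ∈ slHyperplaneFixer φ ↔ ∀ w, φ ⬝ᵥ w = 0 → g • w = w :=
  mem_slFixer

lemma finrank_ker_dotProduct {φ : ι → F} (hφ : φ ≠ 0) :
    Module.finrank F (LinearMap.ker (dotProductEquiv F ι φ)) + 1 = Fintype.card ι := by
  rw [Module.Dual.finrank_ker_add_one_of_ne_zero (by simpa using hφ),
    Module.finrank_fintype_fun_eq_card]

lemma dotProduct_smul_of_mem_slHyperplaneFixer {φ : ι → F} {g : SpecialLinearGroup ι F}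
    (hg : g ∈ slHyperplaneFixer φ) (w : ι → F) : φ ⬝ᵥ (g • w) = φ ⬝ᵥ w := by
  rcases eq_or_ne φ 0 with rfl | hφ
  · simp
  have h : φ ⬝ᵥ (g • w - w) = 0 := smul_sub_mem_of_mem_slFixer (finrank_ker_dotProduct hφ) hg w
  rwa [dotProduct_sub, sub_eq_zero] at h

lemma smul_eq_of_mem_slHyperplaneFixer {φ f : ι → F} (hf : φ ⬝ᵥ f = 1)
    {g : SpecialLinearGroup ι F} (hg : g ∈ slHyperplaneFixer φ) (w : ι → F) :
    g • w = w + (φ ⬝ᵥ w) • (g • f - f) := by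
  have h : g • (w - (φ ⬝ᵥ w) • f) = w - (φ ⬝ᵥ w) • f :=
    mem_slHyperplaneFixer.1 hg _ (by rw [dotProduct_sub, dotProduct_smul, hf]; simp)
  rw [smul_sub, smul_comm, sub_eq_iff_eq_add] at h
  rw [h, smul_sub]
  abel

variable [Fintype F] {V : Type*} [NormedAddCommGroup V] [InnerProductSpace ℝ V]
  {ρ : SpecialLinearGroup ι F →* V →ₗ[ℝ] V}

lemma orbitCoeff_le_orbitEnergy_slHyperplaneFixer
    (hρ : ∀ g v w, inner ℝ (ρ g v) (ρ g w) = inner ℝ v w) {φ f : ι → F} (hf : φ ⬝ᵥ f = 1)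
    {x : SpecialLinearGroup ι F} {α : F} (hα : α ≠ 0) (hx : ∀ w, φ ⬝ᵥ (x • w) = α * φ ⬝ᵥ w)
    (h : ∀ w, φ ⬝ᵥ w = 0 → x • w = α • w → w = 0) (v : V) :
    orbitCoeff ρ x v ≤ orbitEnergy ρ (slHyperplaneFixer φ) v := by
  have hxinv : ∀ w, φ ⬝ᵥ w = 0 → φ ⬝ᵥ (x⁻¹ • w) = 0 := by
    intro w hw
    have h1 := hx (x⁻¹ • w)
    rw [smul_inv_smul, hw] at h1
    exact (mul_eq_zero.1 h1.symm).resolve_left hα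
  have hnorm : ∀ d ∈ slHyperplaneFixer φ, x * d * x⁻¹ ∈ slHyperplaneFixer φ := by
    intro d hd
    refine mem_slHyperplaneFixer.2 fun w hw => ?_
    rw [mul_smul, mul_smul, mem_slHyperplaneFixer.1 hd _ (hxinv w hw), smul_inv_smul]
  have hmem : ∀ d : slHyperplaneFixer φ,
      (d : SpecialLinearGroup ι F) * (x * (d : SpecialLinearGroup ι F)⁻¹ * x⁻¹) ∈
        slHyperplaneFixer φ := fun d => mul_mem d.2 (hnorm _ (inv_mem d.2))
  have hcomm : ∀ c ∈ slHyperplaneFixer φ, c * x = x * c → c = 1 := by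
    intro c hc hcx
    have h1 : φ ⬝ᵥ (c • f - f) = 0 := by
      rw [dotProduct_sub, dotProduct_smul_of_mem_slHyperplaneFixer hc, sub_self]
    have h2 : x • (c • f - f) = α • (c • f - f) := by
      rw [smul_sub, ← mul_smul, ← hcx, mul_smul, smul_eq_of_mem_slHyperplaneFixer hf hc (x • f),
        hx, hf, mul_one, add_sub_cancel_left]
    refine sl_ext_smul fun w => ?_
    rw [smul_eq_of_mem_slHyperplaneFixer hf hc w, h _ h1 h2, smul_zero, add_zero, one_smul]
  have hinj : Function.Injective fun d : slHyperplaneFixer φ =>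
      (⟨_, hmem d⟩ : slHyperplaneFixer φ) := by
    intro d d' hdd
    have h1 : (d : SpecialLinearGroup ι F) * (x * (d : SpecialLinearGroup ι F)⁻¹ * x⁻¹) =
      d' * (x * (d' : SpecialLinearGroup ι F)⁻¹ * x⁻¹) := congrArg Subtype.val hdd
    have h2 := hcomm ((d' : SpecialLinearGroup ι F)⁻¹ * d) (mul_mem (inv_mem d'.2) d.2) (by
      rw [← mul_assoc, ← mul_assoc, ← mul_assoc, ← mul_assoc, mul_left_inj] at h1
      rw [mul_assoc, inv_mul_eq_iff_eq_mul, ← mul_assoc, ← mul_assoc, ← h1]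
      group)
    exact Subtype.ext (inv_mul_eq_one.1 h2).symm
  refine orbitCoeff_le_orbitEnergy hρ hnorm
    (Equiv.ofBijective _ (Finite.injective_iff_bijective.1 hinj)) (fun d => ?_) v
  simp [mul_assoc]

end Hyperplane

section Torus

open Matrix

variable {ι F : Type*} [Fintype ι] [DecidableEq ι] [Field F]

/-- The torus element multiplying `f₁` by `s⁻¹` and `f₂` by `s`, where `φ`, `θ` are dual to `f₁`,
`f₂`, and acting trivially on the common kernel of `φ` and `θ`. -/
def slTorusElement {φ θ f₁ f₂ : ι → F} (h₁₁ : φ ⬝ᵥ f₁ = 1)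
    (h₂₂ : θ ⬝ᵥ f₂ = 1) (s : Fˣ) : SpecialLinearGroup ι F :=
  ⟨(1 + vecMulVec (((s⁻¹ : Fˣ) - 1 : F) • f₁) φ) * (1 + vecMulVec ((s - 1 : F) • f₂) θ), by
    rw [det_mul, det_one_add_vecMulVec_eq, det_one_add_vecMulVec_eq, dotProduct_smul,
      dotProduct_smul, h₁₁, h₂₂]
    simp⟩

variable {φ θ f₁ f₂ : ι → F} (h₁₁ : φ ⬝ᵥ f₁ = 1) (h₁₂ : φ ⬝ᵥ f₂ = 0) (h₂₁ : θ ⬝ᵥ f₁ = 0)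
  (h₂₂ : θ ⬝ᵥ f₂ = 1)

include h₁₂ in
lemma slTorusElement_smul (s : Fˣ) (w : ι → F) : slTorusElement h₁₁ h₂₂ s • w =
    w + (φ ⬝ᵥ w * ((s⁻¹ : Fˣ) - 1 : F)) • f₁ + (θ ⬝ᵥ w * (s - 1 : F)) • f₂ := by
  rw [sl_smul_eq_mulVec, slTorusElement, ← mulVec_mulVec, one_add_vecMulVec_mulVec,
    one_add_vecMulVec_mulVec, dotProduct_add, dotProduct_smul, dotProduct_smul, h₁₂]
  simp only [smul_eq_mul, mul_zero, add_zero]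
  module

include h₂₁ in
/-- The one-parameter torus acting on the span of `f₁` and `f₂`. -/
def slTorus : Fˣ →* SpecialLinearGroup ι F :=
  MonoidHom.mk' (slTorusElement h₁₁ h₂₂) fun s t => sl_ext_smul fun w => by
    rw [mul_smul, slTorusElement_smul h₁₁ h₁₂ h₂₂ s, slTorusElement_smul h₁₁ h₁₂ h₂₂ t,
      slTorusElement_smul h₁₁ h₁₂ h₂₂]
    simp only [dotProduct_add, dotProduct_smul, h₁₁, h₁₂, h₂₁, h₂₂, mul_inv, Units.val_mul,
      smul_eq_mul, mul_zero, mul_one, add_zero]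
    module

lemma slTorus_smul (s : Fˣ) (w : ι → F) : slTorus h₁₁ h₁₂ h₂₁ h₂₂ s • w =
    w + (φ ⬝ᵥ w * ((s⁻¹ : Fˣ) - 1 : F)) • f₁ + (θ ⬝ᵥ w * (s - 1 : F)) • f₂ :=
  slTorusElement_smul h₁₁ h₁₂ h₂₂ s w

lemma dotProduct_slTorus_smul_fst (s : Fˣ) (w : ι → F) :
    φ ⬝ᵥ (slTorus h₁₁ h₁₂ h₂₁ h₂₂ s • w) = (s⁻¹ : Fˣ) * φ ⬝ᵥ w := by
  rw [slTorus_smul, dotProduct_add, dotProduct_add, dotProduct_smul, dotProduct_smul, h₁₁, h₁₂]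
  simp only [smul_eq_mul]
  ring

lemma dotProduct_slTorus_smul_snd (s : Fˣ) (w : ι → F) :
    θ ⬝ᵥ (slTorus h₁₁ h₁₂ h₂₁ h₂₂ s • w) = s * θ ⬝ᵥ w := by
  rw [slTorus_smul, dotProduct_add, dotProduct_add, dotProduct_smul, dotProduct_smul, h₂₁, h₂₂]
  simp only [smul_eq_mul]
  ring

lemma dotProduct_commutator_smul {a : SpecialLinearGroup ι F}
    (ha : ∀ w, φ ⬝ᵥ (a⁻¹ • w) = θ ⬝ᵥ w) (s : Fˣ) (w : ι → F) :
    φ ⬝ᵥ ((a⁻¹ * slTorus h₁₁ h₁₂ h₂₁ h₂₂ s * a * (slTorus h₁₁ h₁₂ h₂₁ h₂₂ s)⁻¹) • w) =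
      (s : F) ^ 2 * φ ⬝ᵥ w := by
  have ha' : ∀ w, θ ⬝ᵥ (a • w) = φ ⬝ᵥ w := fun w => by rw [← ha, inv_smul_smul]
  rw [mul_smul, mul_smul, mul_smul, ha, dotProduct_slTorus_smul_snd, ha', ← map_inv,
    dotProduct_slTorus_smul_fst, inv_inv]
  ring

lemma eq_zero_of_commutator_smul_eq {a : SpecialLinearGroup ι F}
    (ha : ∀ w, φ ⬝ᵥ (a⁻¹ • w) = θ ⬝ᵥ w) {s : Fˣ} (hs : (s : F) ^ 2 ≠ 1)
    (hκ : ((s : F) ^ 2 + s + 1) ^ 2 ≠ (s : F) ^ 2 * (φ ⬝ᵥ (a • f₂) * θ ⬝ᵥ (a⁻¹ • f₁)))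
    {w : ι → F} (hw : φ ⬝ᵥ w = 0)
    (hx : (a⁻¹ * slTorus h₁₁ h₁₂ h₂₁ h₂₂ s * a * (slTorus h₁₁ h₁₂ h₂₁ h₂₂ s)⁻¹) • w =
      (s : F) ^ 2 • w) : w = 0 := by
  have ha' : ∀ w, θ ⬝ᵥ (a • w) = φ ⬝ᵥ w := fun w => by rw [← ha, inv_smul_smul]
  obtain ⟨y, rfl⟩ : ∃ y, slTorus h₁₁ h₁₂ h₂₁ h₂₂ s • y = w := ⟨_, smul_inv_smul _ w⟩
  have hs0 : (s : F) ≠ 0 := s.ne_zero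
  have hy : φ ⬝ᵥ y = 0 := by
    rw [dotProduct_slTorus_smul_fst] at hw
    exact (mul_eq_zero.1 hw).resolve_left (Units.ne_zero _)
  rw [mul_smul, inv_smul_smul, mul_assoc, mul_smul, inv_smul_eq_iff, smul_comm, mul_smul,
    slTorus_smul, slTorus_smul, ha', hy, smul_add] at hx
  rw [smul_add, smul_comm a, zero_mul, zero_mul, zero_smul, zero_smul, add_zero,
    add_zero] at hx
  have h₁ := congrArg (fun w => φ ⬝ᵥ w) hx
  have h₂ := congrArg (fun w => θ ⬝ᵥ (a⁻¹ • w)) hx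
  simp only [smul_add, smul_comm a⁻¹, inv_smul_smul, dotProduct_add, dotProduct_smul, h₁₁, h₂₂,
    smul_eq_mul, mul_one, Units.val_inv_eq_inv_val] at h₁ h₂
  set κ₁ := θ ⬝ᵥ (a⁻¹ • f₁)
  set κ₂ := φ ⬝ᵥ (a • f₂)
  set A := φ ⬝ᵥ (a • y)
  set B := θ ⬝ᵥ y
  have hs1 : (s : F) - 1 ≠ 0 := fun h => hs (by rw [sub_eq_zero.1 h, one_pow])
  field_simp at h₁ h₂
  have h₃ : ((s : F) ^ 2 + s + 1) * A = -(s ^ 3 * κ₂ * B) :=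
    mul_left_cancel₀ hs1 (by linear_combination -h₁)
  have h₄ : ((s : F) ^ 2 + s + 1) * s * B = -(κ₁ * A) :=
    mul_left_cancel₀ hs1 (by linear_combination -h₂)
  have hκ0 : (s : F) * (((s : F) ^ 2 + s + 1) ^ 2 - (s : F) ^ 2 * (κ₂ * κ₁)) ≠ 0 :=
    mul_ne_zero hs0 (sub_ne_zero.2 hκ)
  have hA : A = 0 := (mul_eq_zero.1 (by
    linear_combination ((s : F) ^ 2 + s + 1) * s * h₃ - s ^ 3 * κ₂ * h₄)).resolve_left hκ0
  have hB : B = 0 := (mul_eq_zero.1 (by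
    linear_combination ((s : F) ^ 2 + s + 1) * h₄ - κ₁ * h₃)).resolve_left hκ0
  rw [hA, hB, zero_mul, zero_mul, zero_smul, zero_smul, smul_zero, add_zero, add_zero] at hx
  have h₅ : ((s : F) ^ 2 - 1) • (a • y) = 0 := by rw [sub_smul, ← hx, one_smul, sub_self]
  rw [(smul_eq_zero_iff_eq a).1 ((smul_eq_zero.1 h₅).resolve_left (sub_ne_zero.2 hs)), smul_zero]

end Torus

section Noncentral

open Matrix

lemma card_filter_units_le {F : Type*} [Field F] [Fintype F] [DecidableEq F] (κ : F) :
    (Finset.univ.filter fun s : Fˣ => (s : F) ^ 2 = 1 ∨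
      ((s : F) ^ 2 + s + 1) ^ 2 = (s : F) ^ 2 * κ).card ≤ 6 := by
  set P : Polynomial F := (Polynomial.X ^ 2 - 1) *
    ((Polynomial.X ^ 2 + Polynomial.X + 1) ^ 2 - Polynomial.C κ * Polynomial.X ^ 2) with hP
  have hmonic : P.Monic := by
    refine Polynomial.Monic.mul ?_ ?_ <;> monicity!
  have hdeg : P.natDegree ≤ 6 := by
    rw [hP]
    compute_degree!
  refine le_trans ?_ ((Multiset.toFinset_card_le _).trans (P.card_roots'.trans hdeg))
  refine Finset.card_le_card_of_injOn (fun s : Fˣ => (s : F)) ?_ Units.val_injective.injOn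
  intro s hs
  have hs' : (s : F) ^ 2 = 1 ∨ ((s : F) ^ 2 + s + 1) ^ 2 = (s : F) ^ 2 * κ := by simpa using hs
  simp only [Finset.mem_coe, Multiset.mem_toFinset, Polynomial.mem_roots hmonic.ne_zero,
    Polynomial.IsRoot.def]
  simp only [hP, Polynomial.eval_mul, Polynomial.eval_sub, Polynomial.eval_add, Polynomial.eval_pow,
    Polynomial.eval_X, Polynomial.eval_one, Polynomial.eval_C]
  rcases hs' with h | h
  · rw [h, sub_self, zero_mul]
  · rw [h, mul_comm κ, sub_self, mul_zero]

variable {ι F : Type*} [Fintype ι] [DecidableEq ι] [Field F]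

/-- A noncentral element moves some covector to a linearly independent one. -/
lemma exists_dual_of_notMem_center {a : SpecialLinearGroup ι F}
    (ha : a ∉ Subgroup.center (SpecialLinearGroup ι F)) :
    ∃ φ θ f₁ f₂ : ι → F, (∀ w, φ ⬝ᵥ (a⁻¹ • w) = θ ⬝ᵥ w) ∧ φ ⬝ᵥ f₁ = 1 ∧ φ ⬝ᵥ f₂ = 0 ∧
      θ ⬝ᵥ f₁ = 0 ∧ θ ⬝ᵥ f₂ = 1 := by
  set b : Matrix ι ι F := ((a⁻¹ : SpecialLinearGroup ι F) : Matrix ι ι F) with hb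
  have h : ∃ φ, LinearIndependent F ![φ, b.vecMulLinear φ] := by
    by_contra! h
    obtain ⟨c, hc⟩ := LinearMap.exists_eq_smul_id_of_forall_notLinearIndependent h
    have hbc : ∀ φ, φ ᵥ* b = c • φ := fun φ => LinearMap.congr_fun hc φ
    have hbc' : b = c • 1 := ext_iff_vecMul.2 fun φ => by
      rw [hbc, vecMul_smul, vecMul_one]
    refine ha ((Subgroup.center _).inv_mem_iff.1 (Subgroup.mem_center_iff.2 fun g => ?_))
    have h1 : (g : Matrix ι ι F) * b = b * g := by
      rw [hbc']
      simp
    exact Subtype.ext h1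
  obtain ⟨φ, hφ⟩ := h
  have hθ : ∀ w, φ ⬝ᵥ (a⁻¹ • w) = b.vecMulLinear φ ⬝ᵥ w := fun w => dotProduct_mulVec _ _ _
  generalize b.vecMulLinear φ = θ at hφ hθ
  have h1 : φ ∉ Submodule.span F {θ} := by
    intro h
    obtain ⟨c, hc⟩ := Submodule.mem_span_singleton.1 h
    have := LinearIndependent.pair_iff.1 hφ 1 (-c) (by rw [← hc]; module)
    exact one_ne_zero this.1
  have h2 : θ ∉ Submodule.span F {φ} := by
    intro h
    obtain ⟨c, hc⟩ := Submodule.mem_span_singleton.1 h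
    have := LinearIndependent.pair_iff.1 hφ (-c) 1 (by rw [← hc]; module)
    exact one_ne_zero this.2
  obtain ⟨f₁, h₁₁, h₂₁⟩ := exists_dotProduct_eq_one h1
  obtain ⟨f₂, h₂₂, h₁₂⟩ := exists_dotProduct_eq_one h2
  refine ⟨φ, θ, f₁, f₂, hθ, ?_, ?_, ?_, ?_⟩ <;> rw [dotProduct_comm]
  exacts [h₁₁, h₁₂ _ (Submodule.mem_span_singleton_self _),
    h₂₁ _ (Submodule.mem_span_singleton_self _), h₂₂]

variable [Fintype F] {V : Type*} [NormedAddCommGroup V] [InnerProductSpace ℝ V]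
  {ρ : SpecialLinearGroup ι F →* V →ₗ[ℝ] V}

/-- The average over a noncentral conjugacy class is close to the projection to the invariants. -/
lemma norm_classMean_sq_le_of_notMem_center
    (hρ : ∀ g v w, inner ℝ (ρ g v) (ρ g w) = inner ℝ v w) {a : SpecialLinearGroup ι F}
    (ha : a ∉ Subgroup.center (SpecialLinearGroup ι F)) (v : V) :
    ‖mean fun g : SpecialLinearGroup ι F => ρ (g⁻¹ * a * g) v‖ ^ 2 ≤
      ‖subgroupMean ρ ⊤ v‖ ^ 2 + 24 * (Fintype.card F : ℝ)⁻¹ * ‖v‖ ^ 2 := by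
  classical
  obtain ⟨φ, θ, f₁, f₂, hθ, h₁₁, h₁₂, h₂₁, h₂₂⟩ := exists_dual_of_notMem_center ha
  have hφ0 : φ ≠ 0 := by
    rintro rfl
    simp at h₁₁
  set q := Fintype.card F with hq
  have hqR : (2 : ℝ) ≤ q := by exact_mod_cast Fintype.one_lt_card (α := F)
  set κ := φ ⬝ᵥ (a • f₂) * θ ⬝ᵥ (a⁻¹ • f₁) with hκ
  set bad := Finset.univ.filter fun s : Fˣ => (s : F) ^ 2 = 1 ∨
      ((s : F) ^ 2 + s + 1) ^ 2 = (s : F) ^ 2 * κ with hbad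
  have hE : orbitEnergy ρ (slHyperplaneFixer φ) v ≤
      ‖subgroupMean ρ ⊤ v‖ ^ 2 + 12 * (q : ℝ)⁻¹ * ‖v‖ ^ 2 := by
    have := orbitEnergy_slFixer_le hρ v _ 1 le_rfl (finrank_ker_dotProduct hφ0) _ rfl
    rwa [pow_one] at this
  have h1 : ∀ s : Fˣ, orbitCoeff ρ (a⁻¹ * slTorus h₁₁ h₁₂ h₂₁ h₂₂ s * a *
      (slTorus h₁₁ h₁₂ h₂₁ h₂₂ s)⁻¹) v ≤ (‖subgroupMean ρ ⊤ v‖ ^ 2 + 12 * (q : ℝ)⁻¹ * ‖v‖ ^ 2) +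
        (if s ∈ bad then 1 else 0) * ‖v‖ ^ 2 := by
    intro s
    split_ifs with hs
    · refine (orbitCoeff_le_norm hρ _ v).trans ?_
      rw [one_mul, le_add_iff_nonneg_left]
      positivity
    · rw [zero_mul, add_zero]
      simp only [hbad, Finset.mem_filter, Finset.mem_univ, true_and, not_or] at hs
      exact (orbitCoeff_le_orbitEnergy_slHyperplaneFixer hρ h₁₁ (pow_ne_zero 2 s.ne_zero)
        (dotProduct_commutator_smul h₁₁ h₁₂ h₂₁ h₂₂ hθ s)
        (fun w hw hx => eq_zero_of_commutator_smul_eq h₁₁ h₁₂ h₂₁ h₂₂ hθ hs.1 hs.2 hw hx) v).trans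
        hE
  refine (norm_classMean_sq_le hρ (slTorus h₁₁ h₁₂ h₂₁ h₂₂) a v).trans ?_
  refine (mean_le_mean h1).trans ?_
  rw [mean_add, mean_const, mean_mul_const, mean_eq_sum, Finset.sum_boole, smul_eq_mul,
    Fintype.card_units, ← hq, Nat.cast_sub (by exact_mod_cast (by linarith : (1 : ℝ) ≤ q)),
    Nat.cast_one, Finset.filter_mem_eq_inter, Finset.univ_inter]
  have h2 : ((q : ℝ) - 1)⁻¹ ≤ 2 * (q : ℝ)⁻¹ := by
    rw [inv_eq_one_div, ← div_eq_mul_inv, div_le_div_iff₀ (by linarith) (by linarith)]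
    linarith
  have h3 : (bad.card : ℝ) ≤ 6 := by exact_mod_cast card_filter_units_le κ
  have h4 : ((q : ℝ) - 1)⁻¹ * bad.card ≤ 2 * (q : ℝ)⁻¹ * 6 :=
    mul_le_mul h2 h3 (by positivity) (by positivity)
  nlinarith [mul_le_mul_of_nonneg_right h4 (sq_nonneg ‖v‖)]

end Noncentral

section Growth

variable {S G : Type*}

lemma mean_apply [Fintype G] {ι : Type*} [Finite ι] (f : ι → EuclideanSpace ℝ G) (x : G) :
    mean f x = mean fun i => f i x := by
  have := Fintype.ofFinite ι
  simp [mean_eq_sum]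

variable [Group S] [Group G]

/-- The left regular representation of `G`, restricted along `π`. -/
noncomputable def regularRep (π : S →* G) : S →* EuclideanSpace ℝ G →ₗ[ℝ] EuclideanSpace ℝ G where
  toFun s :=
    { toFun := fun f => WithLp.toLp 2 fun x => f ((π s)⁻¹ * x)
      map_add' := fun _ _ => rfl
      map_smul' := fun _ _ => rfl }
  map_one' := by ext; simp
  map_mul' s t := by
    ext f x
    change f _ = f _
    rw [map_mul, mul_inv_rev, mul_assoc]

lemma regularRep_apply (π : S →* G) (s : S) (f : EuclideanSpace ℝ G) (x : G) :
    regularRep π s f x = f ((π s)⁻¹ * x) := rfl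

variable [Fintype G]

lemma inner_regularRep (π : S →* G) (s : S) (f g : EuclideanSpace ℝ G) :
    inner ℝ (regularRep π s f) (regularRep π s g) = inner ℝ f g := by
  simp only [PiLp.inner_apply, regularRep_apply]
  exact Equiv.sum_comp (Equiv.mulLeft (π s)⁻¹) fun x => inner ℝ (f x) (g x)

lemma sum_regularRep (π : S →* G) (s : S) (f : EuclideanSpace ℝ G) :
    ∑ x, regularRep π s f x = ∑ x, f x :=
  Equiv.sum_comp (Equiv.mulLeft (π s)⁻¹) fun x => f x

lemma sum_mean_regularRep (π : S →* G) {ι : Type*} [Finite ι] [Nonempty ι] (s : ι → S)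
    (f : EuclideanSpace ℝ G) : ∑ x, (mean fun i => regularRep π (s i) f) x = ∑ x, f x := by
  have := Fintype.ofFinite ι
  simp only [mean_apply]
  simp only [mean_eq_sum, smul_eq_mul, ← Finset.mul_sum]
  rw [Finset.sum_comm]
  simp only [sum_regularRep]
  simp

variable [Finite S]

lemma norm_subgroupMean_regularRep_sq {π : S →* G} (hπ : Function.Surjective π)
    (f : EuclideanSpace ℝ G) :
    ‖subgroupMean (regularRep π) ⊤ f‖ ^ 2 = (∑ x, f x) ^ 2 / Fintype.card G := by
  set m := subgroupMean (regularRep π) ⊤ f with hm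
  have h1 : ∀ x, m x = m 1 := by
    intro x
    obtain ⟨s, rfl⟩ := hπ x
    have h2 : regularRep π s m = m := rho_subgroupMean (Subgroup.mem_top s) f
    rw [← h2, regularRep_apply, inv_mul_cancel, h2]
  have h2 : ∑ x, m x = ∑ x, f x := sum_mean_regularRep π (fun s : (⊤ : Subgroup S) => (s : S)) f
  rw [EuclideanSpace.norm_sq_eq, ← h2]
  simp only [h1, Finset.sum_const, Finset.card_univ, nsmul_eq_mul, Real.norm_eq_abs, sq_abs]
  have : (Fintype.card G : ℝ) ≠ 0 := by exact_mod_cast Fintype.card_ne_zero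
  field_simp

/-- A spectral estimate for the average over a conjugacy class gives growth of products. -/
lemma card_mul_growth {π : S →* G} (hπ : Function.Surjective π) {a : S} {δ : ℝ}
    (h : ∀ f, ‖mean fun g : S => regularRep π (g⁻¹ * a * g) f‖ ^ 2 ≤
      ‖subgroupMean (regularRep π) ⊤ f‖ ^ 2 + δ * ‖f‖ ^ 2) {A B : Set G}
    (hA : ∀ x ∈ A, ∀ g, g * x * g⁻¹ ∈ A) (ha : π a ∈ A) :
    (B.ncard : ℝ) ^ 2 ≤ (A * B).ncard * (B.ncard ^ 2 / Fintype.card G + δ * B.ncard) := by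
  classical
  set f : EuclideanSpace ℝ G := WithLp.toLp 2 fun x => if x ∈ B then 1 else 0 with hf
  have hfx : ∀ x, f x = if x ∈ B then 1 else 0 := fun x => rfl
  have hsum : ∑ x, f x = B.ncard := by
    simp only [hfx, Finset.sum_boole]
    rw [← Set.ncard_coe_finset]
    simp
  have hnorm : ‖f‖ ^ 2 = B.ncard := by
    rw [EuclideanSpace.norm_sq_eq, ← hsum]
    refine Finset.sum_congr rfl fun x _ => ?_
    rw [hfx]
    split_ifs <;> simp
  set T := mean fun g : S => regularRep π (g⁻¹ * a * g) f with hT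
  have hTsum : ∑ x, T x = B.ncard := by
    rw [hT, sum_mean_regularRep, hsum]
  have hsupp : ∀ x, x ∉ A * B → T x = 0 := by
    intro x hx
    rw [hT, mean_apply]
    have h1 : ∀ g : S, regularRep π (g⁻¹ * a * g) f x = 0 := by
      intro g
      rw [regularRep_apply, hfx, if_neg]
      intro hB
      refine hx (Set.mem_mul.2 ⟨_, ?_, _, hB, mul_inv_cancel_left _ _⟩)
      have := hA _ ha (π g)⁻¹
      simpa using this
    simp only [h1, mean_const]
  set P := Finset.univ.filter fun x => x ∈ A * B with hP
  have hPcard : (P.card : ℝ) = (A * B).ncard := by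
    rw [← Set.ncard_coe_finset]
    simp [hP]
  have h1 : ∑ x ∈ P, T x = B.ncard := by
    rw [← hTsum]
    refine Finset.sum_subset (Finset.subset_univ _) fun x _ hx => hsupp x ?_
    simpa [hP] using hx
  calc (B.ncard : ℝ) ^ 2 = (∑ x ∈ P, T x) ^ 2 := by rw [h1]
    _ ≤ P.card * ∑ x ∈ P, T x ^ 2 := sq_sum_le_card_mul_sum_sq
    _ ≤ P.card * ‖T‖ ^ 2 := by
      refine mul_le_mul_of_nonneg_left ?_ (by positivity)
      rw [EuclideanSpace.norm_sq_eq]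
      simp only [Real.norm_eq_abs, sq_abs]
      exact Finset.sum_le_sum_of_subset_of_nonneg (Finset.subset_univ _) fun x _ _ => sq_nonneg _
    _ ≤ _ := by
      rw [hPcard]
      refine mul_le_mul_of_nonneg_left ((h f).trans_eq ?_) (by positivity)
      rw [norm_subgroupMean_regularRep_sq hπ, hsum, hnorm]

end Growth

theorem stmt14 :
    ∃ c : ℝ, 0 < c ∧
      ∀ (n q : ℕ), 2 ≤ n → IsPrimePow q → ¬(n = 2 ∧ (q = 2 ∨ q = 3)) →
      ∀ (F : Type) [Field F] [Fintype F], Fintype.card F = q →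
      ∀ (A B : Set (Matrix.ProjectiveSpecialLinearGroup (Fin n) F)),
        (∀ a ∈ A, ∀ g, g * a * g⁻¹ ∈ A) →
        (∃ a ∈ A, a ≠ 1) →
        B.Nonempty →
        ((A * B).ncard : ℝ) ≥
            (Nat.card (Matrix.ProjectiveSpecialLinearGroup (Fin n) F) : ℝ) / 2 ∨
          ((A * B).ncard : ℝ) ≥ c * (q : ℝ) * (B.ncard : ℝ) := by
  refine ⟨1 / 48, by norm_num, ?_⟩
  intro n q _ _ _ F _ _ hq A B hA hA1 hB
  obtain ⟨_, haA, ha1⟩ := hA1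
  have : Fintype (Matrix.ProjectiveSpecialLinearGroup (Fin n) F) := Fintype.ofFinite _
  set π : Matrix.SpecialLinearGroup (Fin n) F →* Matrix.ProjectiveSpecialLinearGroup (Fin n) F :=
    QuotientGroup.mk' _ with hπ
  have hsurj : Function.Surjective π := QuotientGroup.mk'_surjective _
  obtain ⟨a, rfl⟩ := hsurj ‹_›
  have ha : a ∉ Subgroup.center (Matrix.SpecialLinearGroup (Fin n) F) := fun h =>
    ha1 ((QuotientGroup.eq_one_iff a).2 h)
  have key := card_mul_growth hsurj (δ := 24 * (Fintype.card F : ℝ)⁻¹)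
    (fun f => norm_classMean_sq_le_of_notMem_center (inner_regularRep π) ha f) hA haA (B := B)
  have hq0 : (0 : ℝ) < q := by
    rw [← hq]
    exact_mod_cast Fintype.card_pos
  have hB0 : (0 : ℝ) < B.ncard := by exact_mod_cast (Set.ncard_pos).2 hB
  rw [Nat.card_eq_fintype_card]
  have hG : (0 : ℝ) < Fintype.card (Matrix.ProjectiveSpecialLinearGroup (Fin n) F) := by
    exact_mod_cast Fintype.card_pos
  rw [hq] at key
  generalize (Fintype.card (Matrix.ProjectiveSpecialLinearGroup (Fin n) F) : ℝ) = N at hG key ⊢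
  generalize ((A * B).ncard : ℝ) = P at key ⊢
  generalize (B.ncard : ℝ) = b at hB0 key ⊢
  by_contra! hcon
  obtain ⟨h1, h2⟩ := hcon
  have h3 : b * (b * (N * q)) ≤ b * (P * b * q + 24 * P * N) := by
    have h4 := mul_le_mul_of_nonneg_right key (by positivity : 0 ≤ N * q)
    have h5 : P * (b ^ 2 / N + 24 * (q : ℝ)⁻¹ * b) * (N * q) = b * (P * b * q + 24 * P * N) := by
      field_simp
    rw [h5] at h4
    linarith
  have h6 := le_of_mul_le_mul_left h3 hB0
  nlinarith [mul_pos hB0 hq0, mul_lt_mul_of_pos_right h1 (mul_pos hB0 hq0),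
    mul_lt_mul_of_pos_right h2 hG]
end

section
/- Let q be a power of a prime p and let G = PSL₂(𝔽_q). Then every element g ∈ G whose order is coprime to p is real, i.e. g is conjugate in G to g⁻¹. -/
open Matrix in
/-- A matrix `X = !![x, y; z, -x]` of determinant one with `tr (X * A) = 0` conjugates `A` to its
inverse. -/
theorem Matrix.SpecialLinearGroup.isConj_inv_of_trace_zero {R : Type*} [CommRing R]
    (A : SpecialLinearGroup (Fin 2) R) (x y z : R)
    (htrace : x * (A 0 0 - A 1 1) + y * A 1 0 + z * A 0 1 = 0)
    (hdet : x ^ 2 + y * z = -1) : IsConj A A⁻¹ := by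
  let X : SpecialLinearGroup (Fin 2) R :=
    ⟨!![x, y; z, -x], by rw [det_fin_two_of]; linear_combination -hdet⟩
  refine isConj_iff.mpr ⟨X, ?_⟩
  rw [mul_inv_eq_iff_eq_mul]
  ext i j
  rw [SpecialLinearGroup.coe_mul, SpecialLinearGroup.coe_mul, SpecialLinearGroup.coe_inv,
    adjugate_fin_two]
  fin_cases i <;> fin_cases j <;>
    simp [X, mul_apply, Fin.sum_univ_two] <;>
    first | linear_combination htrace | ring

open Polynomial in
/-- Over a finite field of odd characteristic, a nondegenerate form `u² - D v²` is universal. -/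
theorem FiniteField.exists_sq_sub_mul_sq {F : Type*} [Field F] [Finite F]
    (hF : ringChar F ≠ 2) {D : F} (hD : D ≠ 0) (e : F) : ∃ u v : F, u ^ 2 - D * v ^ 2 = e := by
  have := Fintype.ofFinite F
  have h₁ : (X ^ 2 - C e : F[X]).degree = 2 := degree_X_pow_sub_C two_pos e
  have h₂ : (C (-D) * X ^ 2 : F[X]).degree = 2 := degree_C_mul_X_pow 2 (neg_ne_zero.mpr hD)
  obtain ⟨u, v, huv⟩ := FiniteField.exists_root_sum_quadratic h₁ h₂
    (FiniteField.odd_card_of_char_ne_two hF)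
  refine ⟨u, v, ?_⟩
  simp only [eval_sub, eval_mul, eval_pow, eval_X, eval_C] at huv
  linear_combination huv

/-- Over a finite field, an element of `SL₂` that does not have trace `±2` is conjugate to its
inverse. -/
theorem Matrix.SpecialLinearGroup.isConj_inv_of_trace_sq_ne_four {F : Type*} [Field F] [Finite F]
    (A : SpecialLinearGroup (Fin 2) F) (hA : (A 0 0 + A 1 1) ^ 2 ≠ 4) : IsConj A A⁻¹ := by
  have hdet : A 0 0 * A 1 1 - A 0 1 * A 1 0 = 1 := by
    rw [← Matrix.det_fin_two]; exact A.det_coe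
  by_cases hc : A 1 0 = 0
  · have had : A 0 0 - A 1 1 ≠ 0 := fun h ↦
      hA (by linear_combination (A 0 0 - A 1 1) * h + 4 * hdet + 4 * A 0 1 * hc)
    refine A.isConj_inv_of_trace_zero (-A 0 1 / (A 0 0 - A 1 1))
      (-1 - (-A 0 1 / (A 0 0 - A 1 1)) ^ 2) 1 ?_ (by ring)
    rw [hc]
    field_simp
    ring
  by_cases hF : ringChar F = 2
  · have : CharP F 2 := ringChar.of_eq hF
    refine A.isConj_inv_of_trace_zero 1 (-(A 0 0 - A 1 1) / A 1 0) 0 ?_ ?_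
    · field_simp
      ring
    · linear_combination CharTwo.two_eq_zero (R := F)
  have h2 : (2 : F) ≠ 0 := Ring.two_ne_zero hF
  have hD : (A 0 0 + A 1 1) ^ 2 - 4 ≠ 0 := sub_ne_zero.mpr hA
  obtain ⟨u, v, huv⟩ := FiniteField.exists_sq_sub_mul_sq hF hD (-(4 * A 1 0 ^ 2))
  obtain ⟨x, hx⟩ : ∃ x, 2 * A 1 0 * x - (A 0 0 - A 1 1) * v = u :=
    ⟨(u + (A 0 0 - A 1 1) * v) / (2 * A 1 0), by field_simp; ring⟩
  obtain ⟨y, hy⟩ : ∃ y, y * A 1 0 = -(x * (A 0 0 - A 1 1) + v * A 0 1) :=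
    ⟨_, div_mul_cancel₀ _ hc⟩
  refine A.isConj_inv_of_trace_zero x y v (by linear_combination hy) ?_
  have h4c : 4 * A 1 0 ^ 2 ≠ 0 := by
    rw [show (4 : F) = 2 ^ 2 by norm_num]
    exact mul_ne_zero (pow_ne_zero 2 h2) (pow_ne_zero 2 hc)
  refine mul_left_cancel₀ h4c ?_
  rw [← hx] at huv
  linear_combination huv + 4 * A 1 0 * v * hy + 4 * v ^ 2 * hdet

/-- In characteristic `p`, the `p`-th power of an element of `SL₂` of trace `±2` is central. -/
theorem Matrix.SpecialLinearGroup.pow_char_mem_center {F : Type*} [Field F] (p : ℕ)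
    [Fact p.Prime] [CharP F p] (A : SpecialLinearGroup (Fin 2) F)
    (hA : (A 0 0 + A 1 1) ^ 2 = 4) : A ^ p ∈ Subgroup.center (SpecialLinearGroup (Fin 2) F) := by
  obtain ⟨e, he, ht⟩ : ∃ e : F, e ^ 2 = 1 ∧ A 0 0 + A 1 1 = 2 * e := by
    rcases sq_eq_sq_iff_eq_or_eq_neg.mp (hA.trans (by norm_num : (4 : F) = 2 ^ 2)) with h | h
    · exact ⟨1, by ring, by rw [h]; ring⟩
    · exact ⟨-1, by ring, by rw [h]; ring⟩
  have hdet : A 0 0 * A 1 1 - A 0 1 * A 1 0 = 1 := by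
    rw [← Matrix.det_fin_two]; exact A.det_coe
  have hsq : ((A : Matrix (Fin 2) (Fin 2) F) - scalar (Fin 2) e) ^ 2 = 0 := by
    ext i j
    fin_cases i <;> fin_cases j <;> simp [pow_two, mul_apply, Fin.sum_univ_two]
    · linear_combination A 0 0 * ht - hdet + he
    · linear_combination A 0 1 * ht
    · linear_combination A 1 0 * ht
    · linear_combination A 1 1 * ht - hdet + he
  have hpow : (A : Matrix (Fin 2) (Fin 2) F) ^ p = scalar (Fin 2) (e ^ p) := by
    rw [map_pow, ← sub_eq_zero,
      ← sub_pow_char_of_commute _ (scalar_commute e (Commute.all e) _).symm]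
    exact pow_eq_zero_of_le (Fact.out : p.Prime).two_le hsq
  refine mem_center_iff.mpr ⟨e ^ p, ?_, ?_⟩
  · rw [Fintype.card_fin, ← pow_mul, mul_comm, pow_mul, he, one_pow]
  · rw [coe_pow, hpow]

/-- In `PSL₂(𝔽_q)`, `q` a power of the prime `p`, every element of order coprime
to `p` (i.e. every semisimple element) is real: it is conjugate to its inverse. -/
theorem stmt15 (p k q : ℕ) (hp : p.Prime) (hk : 0 < k) (hq : q = p ^ k)
    (F : Type) [Field F] [Fintype F] (hF : Fintype.card F = q)
    (g : Matrix.ProjectiveSpecialLinearGroup (Fin 2) F)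
    (hg : Nat.Coprime (orderOf g) p) :
    IsConj g g⁻¹ := by
  have : Fact p.Prime := ⟨hp⟩
  have : CharP F p := charP_of_card_eq_prime_pow (hF.trans hq)
  obtain ⟨A, rfl⟩ := QuotientGroup.mk'_surjective _ g
  by_cases hA : (A 0 0 + A 1 1) ^ 2 = 4
  · have hpow : QuotientGroup.mk' (Subgroup.center _) A ^ p = 1 := by
      rw [← map_pow]
      exact (QuotientGroup.eq_one_iff _).mpr (A.pow_char_mem_center p hA)
    rw [orderOf_eq_one_iff.mp (hg.eq_one_of_dvd (orderOf_dvd_of_pow_eq_one hpow)), inv_one]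
  · rw [← map_inv]
    exact (QuotientGroup.mk' _).map_isConj (A.isConj_inv_of_trace_sq_ne_four hA)
end

section
/- There exists a constant C > 0 such that for every prime power q, the number of elements of G = PSL₃(𝔽_q) that are conjugate to their own inverse is at most C·q⁷. -/
/-- The matrices of determinant one whose inverse has trace `r` times their own trace. -/
def traceTwisted {F : Type*} [Field F] (r : F) : Set (Matrix (Fin 3) (Fin 3) F) :=
  {A | A.det = 1 ∧ A.adjugate.trace = r * A.trace}

theorem ncard_le_card_pow_of_injOn {α F : Type*} [Fintype F] {n : ℕ} {S : Set α}
    (f : α → Fin n → F) (hf : Set.InjOn f S) : S.ncard ≤ Fintype.card F ^ n := by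
  have h := Set.ncard_le_ncard_of_injOn (t := Set.univ) f (fun _ _ ↦ Set.mem_univ _) hf
  simpa [Set.ncard_univ] using h

theorem mem_traceTwisted_iff {F : Type*} [Field F] {r : F} {A : Matrix (Fin 3) (Fin 3) F} :
    A ∈ traceTwisted r ↔
      A 0 0 * (A 1 1 * A 2 2 - A 1 2 * A 2 1) - A 0 1 * (A 1 0 * A 2 2 - A 1 2 * A 2 0)
        + A 0 2 * (A 1 0 * A 2 1 - A 1 1 * A 2 0) = 1 ∧
      A 0 0 * A 1 1 + A 0 0 * A 2 2 + A 1 1 * A 2 2 - A 0 1 * A 1 0 - A 0 2 * A 2 0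
        - A 1 2 * A 2 1 = r * (A 0 0 + A 1 1 + A 2 2) := by
  rw [traceTwisted, Set.mem_ofPred_eq, Matrix.det_fin_three, Matrix.adjugate_fin_three,
    Matrix.trace_fin_three, Matrix.trace_fin_three]
  refine and_congr ?_ ?_
  · rw [← sub_eq_zero, ← sub_eq_zero (b := (1 : F))]
    ring_nf
  · simp only [Matrix.of_apply, Matrix.cons_val]
    rw [← sub_eq_zero, ← sub_eq_zero (b := r * _)]
    ring_nf

/-- The determinant of the linear system in the entries `A 0 1` and `A 0 2` given by the two
equations defining `traceTwisted r`, up to sign. -/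
def systemDet {F : Type*} [Field F] (A : Matrix (Fin 3) (Fin 3) F) : F :=
  A 1 0 * (A 1 0 * A 2 1 - A 1 1 * A 2 0) + A 2 0 * (A 1 0 * A 2 2 - A 1 2 * A 2 0)

theorem ncard_traceTwisted_systemDet_ne_zero_le {F : Type*} [Field F] [Fintype F] (r : F) :
    {A ∈ traceTwisted r | systemDet A ≠ 0}.ncard ≤ Fintype.card F ^ 7 := by
  refine ncard_le_card_pow_of_injOn
    (fun A ↦ ![A 0 0, A 1 0, A 1 1, A 1 2, A 2 0, A 2 1, A 2 2]) ?_
  rintro A ⟨hA, hD⟩ B ⟨hB, -⟩ h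
  rw [mem_traceTwisted_iff] at hA hB
  simp only [Matrix.vecCons_inj, and_true] at h
  obtain ⟨h00, h10, h11, h12, h20, h21, h22⟩ := h
  rw [← h00, ← h10, ← h11, ← h12, ← h20, ← h21, ← h22] at hB
  have h01 : A 0 1 = B 0 1 := by
    refine mul_left_cancel₀ hD ?_
    unfold systemDet
    linear_combination (A 1 0 * A 2 1 - A 1 1 * A 2 0) * (hB.2 - hA.2) + A 2 0 * (hB.1 - hA.1)
  have h02 : A 0 2 = B 0 2 := by
    refine mul_left_cancel₀ hD ?_
    unfold systemDet
    linear_combination (A 1 0 * A 2 2 - A 1 2 * A 2 0) * (hB.2 - hA.2) - A 1 0 * (hB.1 - hA.1)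
  ext i j
  fin_cases i <;> fin_cases j <;> assumption

theorem ncard_traceTwisted_systemDet_eq_zero_le {F : Type*} [Field F] [Fintype F] (r : F) :
    {A ∈ traceTwisted r | systemDet A = 0 ∧ A 1 0 ≠ 0}.ncard ≤ Fintype.card F ^ 7 := by
  refine ncard_le_card_pow_of_injOn
    (fun A ↦ ![A 0 0, A 0 2, A 1 0, A 1 1, A 1 2, A 2 0, A 2 2]) ?_
  rintro A ⟨hA, hD, h0⟩ B ⟨hB, hD', -⟩ h
  rw [mem_traceTwisted_iff] at hA hB
  simp only [Matrix.vecCons_inj, and_true] at h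
  obtain ⟨h00, h02, h10, h11, h12, h20, h22⟩ := h
  unfold systemDet at hD hD'
  rw [← h10, ← h11, ← h12, ← h20, ← h22] at hD'
  rw [← h00, ← h10, ← h02, ← h11, ← h12, ← h20, ← h22] at hB
  have h21 : A 2 1 = B 2 1 := by
    refine mul_left_cancel₀ (mul_ne_zero h0 h0) ?_
    linear_combination hD - hD'
  rw [← h21] at hB
  have h01 : A 0 1 = B 0 1 := by
    refine mul_left_cancel₀ h0 ?_
    linear_combination hB.2 - hA.2
  ext i j
  fin_cases i <;> fin_cases j <;> assumption

theorem ncard_traceTwisted_systemDet_eq_zero_le' {F : Type*} [Field F] [Fintype F] (r : F) :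
    {A ∈ traceTwisted r | systemDet A = 0 ∧ A 1 0 = 0 ∧ A 2 0 ≠ 0}.ncard ≤
      Fintype.card F ^ 7 := by
  refine ncard_le_card_pow_of_injOn
    (fun A ↦ ![A 0 0, A 0 1, A 1 0, A 1 1, A 2 0, A 2 1, A 2 2]) ?_
  rintro A ⟨hA, hD, h0, h0'⟩ B ⟨hB, hD', -, -⟩ h
  rw [mem_traceTwisted_iff] at hA hB
  simp only [Matrix.vecCons_inj, and_true] at h
  obtain ⟨h00, h01, h10, h11, h20, h21, h22⟩ := h
  unfold systemDet at hD hD'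
  rw [← h10, ← h11, ← h20, ← h21, ← h22] at hD'
  rw [← h00, ← h10, ← h01, ← h11, ← h20, ← h21, ← h22] at hB
  have h12 : A 1 2 = B 1 2 := by
    refine mul_left_cancel₀ (mul_ne_zero h0' h0') ?_
    linear_combination hD' - hD
  rw [← h12] at hB
  have h02 : A 0 2 = B 0 2 := by
    refine mul_left_cancel₀ h0' ?_
    linear_combination hB.2 - hA.2
  ext i j
  fin_cases i <;> fin_cases j <;> assumption

theorem ncard_col_eq_zero_le {F : Type*} [Field F] [Fintype F] :
    {A : Matrix (Fin 3) (Fin 3) F | A 1 0 = 0 ∧ A 2 0 = 0}.ncard ≤ Fintype.card F ^ 7 := by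
  refine ncard_le_card_pow_of_injOn
    (fun A ↦ ![A 0 0, A 0 1, A 0 2, A 1 1, A 1 2, A 2 1, A 2 2]) ?_
  rintro A ⟨hA, hA'⟩ B ⟨hB, hB'⟩ h
  simp only [Matrix.vecCons_inj, and_true] at h
  obtain ⟨h00, h01, h02, h11, h12, h21, h22⟩ := h
  have h10 := hA.trans hB.symm
  have h20 := hA'.trans hB'.symm
  ext i j
  fin_cases i <;> fin_cases j <;> assumption

theorem ncard_traceTwisted_le {F : Type*} [Field F] [Fintype F] (r : F) :
    (traceTwisted r).ncard ≤ 4 * Fintype.card F ^ 7 := by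
  have hsub : traceTwisted r ⊆ ({A ∈ traceTwisted r | systemDet A ≠ 0} ∪
      {A ∈ traceTwisted r | systemDet A = 0 ∧ A 1 0 ≠ 0}) ∪
      ({A ∈ traceTwisted r | systemDet A = 0 ∧ A 1 0 = 0 ∧ A 2 0 ≠ 0} ∪
      {A | A 1 0 = 0 ∧ A 2 0 = 0}) := by
    intro A hA
    simp only [Set.mem_union, Set.mem_ofPred_eq]
    tauto
  have h := Set.ncard_le_ncard hsub (Set.toFinite _)
  have h₁ := ncard_traceTwisted_systemDet_ne_zero_le r
  have h₂ := ncard_traceTwisted_systemDet_eq_zero_le r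
  have h₃ := ncard_traceTwisted_systemDet_eq_zero_le' r
  have h₄ := ncard_col_eq_zero_le (F := F)
  grw [Set.ncard_union_le, Set.ncard_union_le, Set.ncard_union_le, h₁, h₂, h₃, h₄] at h
  linarith

open Matrix in
/-- A lift of a real element of `PSL` is conjugate to a scalar multiple of its inverse. -/
theorem exists_trace_adjugate_of_isConj_inv {F : Type*} [Field F] {n : Type*} [Fintype n]
    [DecidableEq n] (A : SpecialLinearGroup n F)
    (h : IsConj (A : ProjectiveSpecialLinearGroup n F)
      (A : ProjectiveSpecialLinearGroup n F)⁻¹) :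
    ∃ r : F, r ^ Fintype.card n = 1 ∧
      (A : Matrix n n F).adjugate.trace = r * (A : Matrix n n F).trace := by
  obtain ⟨c, hc⟩ := isConj_iff.mp h
  obtain ⟨B, rfl⟩ := QuotientGroup.mk_surjective c
  have hz : (B * A * B⁻¹)⁻¹ * A⁻¹ ∈ Subgroup.center (SpecialLinearGroup n F) :=
    QuotientGroup.eq.mp hc
  obtain ⟨r, hr, hs⟩ := Matrix.SpecialLinearGroup.mem_center_iff.mp hz
  refine ⟨r, hr, ?_⟩
  have hA : A⁻¹ = B * A * B⁻¹ * ((B * A * B⁻¹)⁻¹ * A⁻¹) := by group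
  have hB : (↑B⁻¹ : Matrix n n F) * B = 1 := by
    rw [← Matrix.SpecialLinearGroup.coe_mul, inv_mul_cancel, Matrix.SpecialLinearGroup.coe_one]
  rw [← Matrix.SpecialLinearGroup.coe_inv, hA, Matrix.SpecialLinearGroup.coe_mul, ← hs,
    Matrix.SpecialLinearGroup.coe_mul, Matrix.SpecialLinearGroup.coe_mul, Matrix.scalar_apply, ← Matrix.smul_one_eq_diagonal,
    Matrix.mul_smul, Matrix.mul_one, Matrix.trace_smul, smul_eq_mul, Matrix.trace_mul_comm,
    ← Matrix.mul_assoc, hB, Matrix.one_mul]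

theorem ncard_isConj_inv_le {F : Type*} [Field F] [Fintype F] :
    {g : Matrix.ProjectiveSpecialLinearGroup (Fin 3) F | IsConj g g⁻¹}.ncard ≤
      12 * Fintype.card F ^ 7 := by
  classical
  let T (r : F) : Set (Matrix.SpecialLinearGroup (Fin 3) F) := {A | A.1 ∈ traceTwisted r}
  have hT (r : F) : (T r).ncard ≤ 4 * Fintype.card F ^ 7 :=
    (Set.ncard_le_ncard_of_injOn (t := traceTwisted r) Subtype.val (fun _ h ↦ h)
      Subtype.val_injective.injOn).trans (ncard_traceTwisted_le r)
  have hsub : {g : Matrix.ProjectiveSpecialLinearGroup (Fin 3) F | IsConj g g⁻¹} ⊆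
      ⋃ r ∈ Polynomial.nthRootsFinset 3 (1 : F), QuotientGroup.mk '' T r := by
    intro g hg
    obtain ⟨A, rfl⟩ := QuotientGroup.mk_surjective g
    obtain ⟨r, hr, htr⟩ := exists_trace_adjugate_of_isConj_inv A hg
    refine Set.mem_biUnion (x := r) ?_ ⟨A, ⟨A.2, htr⟩, rfl⟩
    simpa [Polynomial.mem_nthRootsFinset] using hr
  have hcard : (Polynomial.nthRootsFinset 3 (1 : F)).card ≤ 3 := by
    rw [Polynomial.nthRootsFinset_def]
    exact (Multiset.toFinset_card_le _).trans (Polynomial.card_nthRoots 3 1)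
  calc _ ≤ _ := Set.ncard_le_ncard hsub (Set.toFinite _)
    _ ≤ ∑ r ∈ Polynomial.nthRootsFinset 3 (1 : F), _ := Finset.set_ncard_biUnion_le _ _
    _ ≤ (Polynomial.nthRootsFinset 3 (1 : F)).card • (4 * Fintype.card F ^ 7) :=
      Finset.sum_le_card_nsmul _ _ _ fun r _ ↦ (Set.ncard_image_le (Set.toFinite _)).trans (hT r)
    _ ≤ 3 • (4 * Fintype.card F ^ 7) := by gcongr
    _ = 12 * Fintype.card F ^ 7 := by rw [smul_eq_mul]; ring

theorem stmt16 :
    ∃ C : ℝ, 0 < C ∧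
      ∀ q : ℕ, IsPrimePow q →
      ∀ (F : Type) [Field F] [Fintype F], Fintype.card F = q →
        (({g : Matrix.ProjectiveSpecialLinearGroup (Fin 3) F | IsConj g g⁻¹}).ncard : ℝ) ≤
          C * (q : ℝ) ^ 7 := by
  refine ⟨12, by norm_num, fun q _ F _ _ hF ↦ ?_⟩
  subst hF
  exact_mod_cast ncard_isConj_inv_le (F := F)
end
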